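/- Suppose k = k(n) ≥ 3 and r = r(n) ≥ 3 satisfy (3/128) · r^{k−1}/√k − ln n → −∞ as n → ∞. If p = p(n) ≤ (3/32) · (r^{k−1}/k^{3/2}) · n/C(n,k), then P(H(n,k,p) is r-choosable) → 1 as n → ∞. -/

import Mathlib

open Finset Filter

open scoped Classical

namespace HG

/-- A finset `e` is monochromatic under the coloring `c`. -/
def Monochromatic {V α : Type*} (c : V → α) (e : Finset V) : Prop :=
  ∀ v ∈ e, ∀ w ∈ e, c v = c w

/-- The hypergraph with edge set `E` admits a proper coloring with `r` colors. -/
def RColorable {V : Type*} (r : ℕ) (E : Finset (Finset V)) : Prop :=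
  ∃ c : V → Fin r, ∀ e ∈ E, ¬ Monochromatic c e

/-- The hypergraph with edge set `E` is `r`-choosable: for every assignment of
color lists of size `r` there is a proper coloring from the lists. -/
def RChoosable {V : Type*} (r : ℕ) (E : Finset (Finset V)) : Prop :=
  ∀ L : V → Finset ℕ, (∀ v, (L v).card = r) →
    ∃ c : V → ℕ, (∀ v, c v ∈ L v) ∧ ∀ e ∈ E, ¬ Monochromatic c e

/-- Probability that the binomial random hypergraph `H(n,k,p)` (each of the
`C(n,k)` possible `k`-element edges present independently with probability `p`)
satisfies the property `P` of its edge set. -/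
noncomputable def hyperProb (n k : ℕ) (p : ℝ)
    (P : Finset (Finset (Fin n)) → Prop) : ℝ :=
  ∑ E ∈ ((Finset.univ : Finset (Fin n)).powersetCard k).powerset,
    if P E then
      p ^ E.card *
        (1 - p) ^ (((Finset.univ : Finset (Fin n)).powersetCard k).card - E.card)
    else 0

/-- Maximum vertex degree of the hypergraph with edge set `E`. -/
def maxDegree {V : Type*} [DecidableEq V] (E : Finset (Finset V)) : ℕ :=
  (E.biUnion id).sup fun v => (E.filter fun e => v ∈ e).card

/-- Three distinct edges forming a 3-cycle (triangle). -/
def IsTriangle {V : Type*} [DecidableEq V] (e f h : Finset V) : Prop :=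
  e ≠ f ∧ e ≠ h ∧ f ≠ h ∧ ((e ∩ f) \ h).Nonempty ∧ ((e ∩ h) \ f).Nonempty ∧
    ((f ∩ h) \ e).Nonempty

/-- A hypergraph is 2-simple if any two distinct edges share at most 2 vertices. -/
def TwoSimple {V : Type*} [DecidableEq V] (E : Finset (Finset V)) : Prop :=
  ∀ e ∈ E, ∀ f ∈ E, e ≠ f → (e ∩ f).card ≤ 2

/-- The number of 3-cycles of the hypergraph `E` containing the edge `e`. -/
noncomputable def triCount {V : Type*} [DecidableEq V]
    (E : Finset (Finset V)) (e : Finset V) : ℕ :=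
  ((E.powersetCard 2).filter fun s =>
    ∃ f ∈ s, ∃ h ∈ s, f ≠ h ∧ IsTriangle e f h).card

/-- The function `φ(k) = 4⌊√(ln k / ln (2 ln k))⌋⁻¹`. -/
noncomputable def phi (k : ℕ) : ℝ :=
  4 * ((⌊Real.sqrt (Real.log k / Real.log (2 * Real.log k))⌋₊ : ℝ))⁻¹

/-- In a finite product, forcing one coordinate into `F` scales the count of a property that does
not depend on that coordinate by `#F / #Ω`. -/
lemma card_filter_coord {V α : Type*} [Fintype V]
    (Ω : V → Finset α) (hΩ : ∀ v, (Ω v).Nonempty) (v : V) (F : Finset α) (hF : F ⊆ Ω v)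
    (Q : (V → α) → Prop) (hQ : ∀ ω x, Q (Function.update ω v x) ↔ Q ω) :
    (((Fintype.piFinset Ω).filter fun ω => Q ω ∧ ω v ∈ F).card : ℝ) =
      ((F.card : ℝ) / (Ω v).card) * ((Fintype.piFinset Ω).filter Q).card := by
  have h : (((Fintype.piFinset Ω).filter fun ω => Q ω ∧ ω v ∈ F) ×ˢ Ω v).card =
      (F ×ˢ ((Fintype.piFinset Ω).filter Q)).card := by
    refine Finset.card_bij' (fun a _ => (a.1 v, Function.update a.1 v a.2))
      (fun b _ => (Function.update b.2 v b.1, b.2 v)) ?_ ?_ ?_ ?_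
    · rintro ⟨ω, x⟩ h
      simp only [mem_product, mem_filter, Fintype.mem_piFinset] at h ⊢
      refine ⟨h.1.2.2, fun u => ?_, (hQ _ _).2 h.1.2.1⟩
      by_cases hu : u = v
      · subst hu; simpa using h.2
      · simpa [Function.update_of_ne hu] using h.1.1 u
    · rintro ⟨x, ω⟩ h
      simp only [mem_product, mem_filter, Fintype.mem_piFinset] at h ⊢
      refine ⟨⟨fun u => ?_, (hQ _ _).2 h.2.2, by simpa using h.1⟩, h.2.1 v⟩
      by_cases hu : u = v
      · subst hu; simpa using hF h.1
      · simpa [Function.update_of_ne hu] using h.2.1 u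
    · rintro ⟨ω, x⟩ h; simp
    · rintro ⟨x, ω⟩ h; simp
  rw [card_product, card_product] at h
  have h0 : ((Ω v).card : ℝ) ≠ 0 := by
    have := (hΩ v).card_pos
    positivity
  have h' : (((Fintype.piFinset Ω).filter fun ω => Q ω ∧ ω v ∈ F).card : ℝ) * (Ω v).card =
      F.card * ((Fintype.piFinset Ω).filter Q).card := by exact_mod_cast h
  field_simp
  linarith

lemma card_filter_cylinder {V α : Type*} [Fintype V]
    (Ω : V → Finset α) (hΩ : ∀ v, (Ω v).Nonempty) (F : V → Finset α) (A : Finset V)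
    (hF : ∀ v ∈ A, F v ⊆ Ω v)
    (Q : (V → α) → Prop) (hQ : ∀ v ∈ A, ∀ ω x, Q (Function.update ω v x) ↔ Q ω) :
    (((Fintype.piFinset Ω).filter fun ω => Q ω ∧ ∀ v ∈ A, ω v ∈ F v).card : ℝ) =
      (∏ v ∈ A, ((F v).card : ℝ) / (Ω v).card) * ((Fintype.piFinset Ω).filter Q).card := by
  induction A using Finset.induction_on with
  | empty => simp
  | insert a s ha ih =>
    have ih' := ih (fun v hv => hF v (mem_insert_of_mem hv))
      (fun v hv => hQ v (mem_insert_of_mem hv))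
    have key := card_filter_coord Ω hΩ a (F a) (hF a (mem_insert_self _ _))
      (fun ω => Q ω ∧ ∀ v ∈ s, ω v ∈ F v) (by
        intro ω x
        rw [hQ a (mem_insert_self _ _)]
        refine and_congr_right fun _ => forall₂_congr fun v hv => ?_
        have : v ≠ a := fun h => ha (h ▸ hv)
        rw [Function.update_of_ne this])
    rw [prod_insert ha, mul_assoc, ← ih']
    convert key using 2
    · congr 1
      ext ω
      simp only [mem_filter, mem_insert, forall_eq_or_imp]
      tauto
    · congr

/-- A counting form of the local lemma: if for every coordinate the total weight
`P(A) β^{-(|A|-1)}` of the bad cylinders through it is at most `1 - β`, all bad cylinders can be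
avoided at once. -/
theorem exists_avoiding {V α I : Type*} [Fintype V]
    (Ω : V → Finset α) (hΩ : ∀ v, (Ω v).Nonempty) (J : Finset I) (A : I → Finset V)
    (F : I → V → Finset α) (hF : ∀ i ∈ J, ∀ v ∈ A i, F i v ⊆ Ω v)
    (hA : ∀ i ∈ J, (A i).Nonempty) (β : ℝ) (hβ : 0 < β)
    (h : ∀ v, ∑ i ∈ J with v ∈ A i,
      (∏ u ∈ A i, ((F i u).card : ℝ) / (Ω u).card) * β⁻¹ ^ ((A i).card - 1) ≤ 1 - β) :
    ∃ ω : V → α, (∀ v, ω v ∈ Ω v) ∧ ∀ i ∈ J, ∃ v ∈ A i, ω v ∉ F i v := by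
  let Q : Finset V → (V → α) → Prop := fun S ω => ∀ i ∈ J, A i ⊆ S → ∃ v ∈ A i, ω v ∉ F i v
  obtain ⟨N, hN⟩ : ∃ N : Finset V → ℝ, ∀ S, N S = ((Fintype.piFinset Ω).filter (Q S)).card :=
    ⟨_, fun _ => rfl⟩
  have hN0 : ∀ S, 0 ≤ N S := fun S => by rw [hN]; exact Nat.cast_nonneg _
  have step : ∀ m : ℕ, ∀ S : Finset V, S.card = m → ∀ v ∉ S, β * N S ≤ N (insert v S) := by
    intro m
    induction m using Nat.strong_induction_on with
    | _ m ih =>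
    intro S hS v hv
    have sub : ∀ T ⊆ S, N (S \ T) ≤ β⁻¹ ^ T.card * N S := by
      intro T
      induction T using Finset.induction_on with
      | empty => intro _; simp
      | insert a T ha ihT =>
        intro hT
        have hT' := ihT (fun x hx => hT (mem_insert_of_mem hx))
        have haS : a ∈ S := hT (mem_insert_self _ _)
        have hlt : (S \ insert a T).card < m := by
          rw [← hS]
          exact card_lt_card ⟨sdiff_subset, fun hh => by
            have := hh haS; simp at this⟩
        have h1 := ih _ hlt (S \ insert a T) rfl a (by simp)
        have h2 : insert a (S \ insert a T) = S \ T := by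
          ext x
          by_cases hx : x = a
          · subst hx; simp [haS, ha]
          · simp [hx]
        rw [h2] at h1
        rw [card_insert_of_notMem ha, pow_succ]
        have : N (S \ insert a T) ≤ β⁻¹ * N (S \ T) := by
          rw [inv_mul_eq_div, le_div_iff₀ hβ]; linarith
        calc N (S \ insert a T) ≤ β⁻¹ * N (S \ T) := this
          _ ≤ β⁻¹ * (β⁻¹ ^ T.card * N S) := by gcongr
          _ = _ := by ring
    -- assignments good for `S` but not for `insert v S`
    have hsub : (Fintype.piFinset Ω).filter (Q S) ⊆
        (Fintype.piFinset Ω).filter (Q (insert v S)) ∪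
          (J.filter fun i => v ∈ A i ∧ A i ⊆ insert v S).biUnion fun i =>
            (Fintype.piFinset Ω).filter fun ω => Q (S \ A i) ω ∧ ∀ u ∈ A i, ω u ∈ F i u := by
      intro ω hω
      rw [mem_filter] at hω
      by_cases hq : Q (insert v S) ω
      · exact mem_union_left _ (mem_filter.2 ⟨hω.1, hq⟩)
      · apply mem_union_right
        simp only [Q, not_forall] at hq
        obtain ⟨i, hi, hAi, hno⟩ := hq
        push Not at hno
        have hvi : v ∈ A i := by
          by_contra hvi
          obtain ⟨u, hu, hu'⟩ := hω.2 i hi (fun x hx => by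
            rcases mem_insert.1 (hAi hx) with h | h
            · subst h; exact absurd hx hvi
            · exact h)
          exact hu' (hno u hu)
        exact mem_biUnion.2 ⟨i, mem_filter.2 ⟨hi, hvi, hAi⟩, mem_filter.2 ⟨hω.1,
          fun j hj hj' => hω.2 j hj (hj'.trans sdiff_subset), hno⟩⟩
    have hcard : N S ≤ N (insert v S) + ∑ i ∈ J with v ∈ A i,
        (∏ u ∈ A i, ((F i u).card : ℝ) / (Ω u).card) * β⁻¹ ^ ((A i).card - 1) * N S := by
      have h1 := (card_le_card hsub).trans ((card_union_le _ _).trans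
        (Nat.add_le_add_left card_biUnion_le _))
      have h2 : N S ≤ N (insert v S) + ∑ i ∈ J.filter fun i => v ∈ A i ∧ A i ⊆ insert v S,
          (((Fintype.piFinset Ω).filter fun ω =>
            Q (S \ A i) ω ∧ ∀ u ∈ A i, ω u ∈ F i u).card : ℝ) := by
        have := (Nat.cast_le (α := ℝ)).2 h1
        push_cast at this
        rw [hN, hN]
        exact this
      refine h2.trans (by
        refine add_le_add le_rfl ?_
        rw [← filter_filter, sum_filter]
        refine sum_le_sum fun i hi => ?_
        rw [mem_filter] at hi
        have hnn : (0:ℝ) ≤ (∏ u ∈ A i, ((F i u).card : ℝ) / (Ω u).card) *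
            β⁻¹ ^ ((A i).card - 1) * N S := by
          exact mul_nonneg (mul_nonneg (prod_nonneg fun u _ => by positivity) (by positivity))
            (hN0 S)
        split_ifs with hAi
        · have key : (((Fintype.piFinset Ω).filter fun ω =>
              Q (S \ A i) ω ∧ ∀ u ∈ A i, ω u ∈ F i u).card : ℝ) =
              (∏ v ∈ A i, ((F i v).card : ℝ) / (Ω v).card) * N (S \ A i) := by
            rw [hN]
            convert card_filter_cylinder Ω hΩ (F i) (A i) (hF i hi.1) (Q (S \ A i)) ?_
            intro u hu ω x
            refine forall₃_congr fun j hj hj' => exists_congr fun w => and_congr_right fun hw => ?_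
            have : w ≠ u := fun h => by
              have := hj' hw; rw [Finset.mem_sdiff] at this; exact this.2 (h ▸ hu)
            rw [Function.update_of_ne this]
          refine (le_of_eq (Eq.trans ?_ key)).trans ?_
          · congr
          · rw [mul_assoc]
            refine mul_le_mul_of_nonneg_left ?_ (prod_nonneg fun u _ => by positivity)
            have := sub ((A i).erase v) (fun x hx => by
              rw [mem_erase] at hx
              exact (mem_insert.1 (hAi hx.2)).resolve_left hx.1)
            rw [card_erase_of_mem hi.2] at this
            have e : S \ (A i).erase v = S \ A i := by
              ext x; simp only [Finset.mem_sdiff, mem_erase]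
              constructor
              · rintro ⟨a, b⟩; exact ⟨a, fun hx => b ⟨fun h => hv (h ▸ a), hx⟩⟩
              · rintro ⟨a, b⟩; exact ⟨a, fun hx => b hx.2⟩
            rw [e] at this
            exact this
        · exact hnn)
    rw [← sum_mul] at hcard
    have := mul_le_mul_of_nonneg_right (h v) (hN0 S)
    linarith
  have pos : ∀ S : Finset V, 0 < N S := by
    intro S
    induction S using Finset.induction_on with
    | empty =>
      have : Q ∅ = fun _ => True := by
        funext ω
        simp only [Q, eq_iff_iff, iff_true]
        intro i hi h0
        exact absurd (subset_empty.1 h0) (hA i hi).ne_empty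
      simp only [hN, this, filter_true]
      exact_mod_cast (Finset.card_pos.2 (Fintype.piFinset_nonempty.2 hΩ))
    | insert a S ha ih => exact lt_of_lt_of_le (by positivity) (step _ S rfl a ha)
  have hu := pos univ
  rw [hN, Nat.cast_pos, card_pos] at hu
  obtain ⟨ω, hω⟩ := hu
  rw [mem_filter, Fintype.mem_piFinset] at hω
  exact ⟨ω, hω.1, fun i hi => hω.2 i hi (subset_univ _)⟩

section Recolor

variable {V ι : Type*}

/-- The coordinates on which a recoloring event centred at `f` depends. -/
noncomputable def rcSupp (A : ι → Finset V) (f : ι) (h : V → Option (ι × ℕ)) : Finset V :=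
  A f ∪ (A f).biUnion fun v => (h v).elim ∅ fun y => A y.1 \ A f

/-- The constraint a recoloring event puts on the pair of colors at `u`. -/
noncomputable def rcBox (L : V → Finset ℕ) (A : ι → Finset V) (f : ι) (α : ℕ)
    (h : V → Option (ι × ℕ)) (u : V) : Finset (ℕ × ℕ) :=
  (L u).offDiag.filter fun x =>
    if u ∈ A f then (h u).elim (x.1 = α) fun y => x = (y.2, α)
    else ∀ v ∈ A f, ∀ y, h v = some y → u ∈ A y.1 → x.1 = y.2

lemma mem_rcBox {L : V → Finset ℕ} {A : ι → Finset V} {f : ι} {α : ℕ}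
    {h : V → Option (ι × ℕ)} {u : V} {x : ℕ × ℕ} : x ∈ rcBox L A f α h u ↔ x ∈ (L u).offDiag ∧
      if u ∈ A f then (h u).elim (x.1 = α) fun y => x = (y.2, α)
      else ∀ v ∈ A f, ∀ y, h v = some y → u ∈ A y.1 → x.1 = y.2 := by
  rw [rcBox, mem_filter]

/-- The weight of one option of a recoloring event. -/
noncomputable def rcWt (A : ι → Finset V) (t a : ℝ) (f : ι) (o : Option (ι × ℕ)) : ℝ :=
  o.elim t fun y => t / a * t ^ (A y.1 \ A f).card

lemma rcWt_nonneg (A : ι → Finset V) {t a : ℝ} (ht : 0 ≤ t) (ha : 0 ≤ a) (f : ι)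
    (o : Option (ι × ℕ)) : 0 ≤ rcWt A t a f o := by
  cases o with
  | none => exact ht
  | some y => simp only [rcWt, Option.elim]; positivity

lemma card_offDiag_fst_le (s : Finset ℕ) (α : ℕ) :
    ((s.offDiag.filter fun x => x.1 = α).card) ≤ s.card - 1 := by
  by_cases hα : α ∈ s
  · rw [← card_erase_of_mem hα]
    refine card_le_card_of_injOn Prod.snd ?_ ?_
    · intro x hx
      simp only [coe_filter, mem_offDiag, Set.mem_ofPred_eq] at hx
      simp only [coe_erase, Set.mem_sdiff, mem_coe, Set.mem_singleton_iff]
      exact ⟨hx.1.2.1, fun h => hx.1.2.2 (hx.2.trans h.symm)⟩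
    · intro x hx y hy hxy
      simp only [coe_filter, Set.mem_ofPred_eq] at hx hy
      exact Prod.ext (hx.2.trans hy.2.symm) hxy
  · rw [Finset.card_eq_zero.2]
    · exact Nat.zero_le _
    · rw [filter_eq_empty_iff]
      rintro x hx rfl
      exact hα (mem_offDiag.1 hx).1

lemma rc_weight_le (L : V → Finset ℕ) (A : ι → Finset V) (r : ℕ) (hr : 2 ≤ r)
    (hL : ∀ v, (L v).card = r) (β : ℝ) (hβ : 0 < β) (f : ι) (hf : (A f).Nonempty) (α : ℕ)
    (h : V → Option (ι × ℕ))
    (hdis : ∀ v₁ ∈ A f, ∀ v₂ ∈ A f, v₁ ≠ v₂ → ∀ y₁ y₂, h v₁ = some y₁ → h v₂ = some y₂ →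
      Disjoint (A y₁.1 \ A f) (A y₂.1 \ A f)) :
    (∏ u ∈ rcSupp A f h, ((rcBox L A f α h u).card : ℝ) / ((L u).offDiag.card : ℝ)) *
        β⁻¹ ^ ((rcSupp A f h).card - 1) ≤
      β * ∏ v ∈ A f, rcWt A (β⁻¹ / r) (r - 1) f (h v) := by
  have hr1 : (0:ℝ) < (r:ℝ) - 1 := by
    have : (2:ℝ) ≤ r := by exact_mod_cast hr
    linarith
  have hr0 : (0:ℝ) < r := by linarith
  have hΩ : ∀ u, ((L u).offDiag.card : ℝ) = r * (r - 1) := by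
    intro u
    rw [offDiag_card, hL, Nat.cast_sub (Nat.le_mul_self r)]
    push_cast; ring
  have hfst : ∀ (u : V) (c : ℕ),
      (((L u).offDiag.filter fun x => x.1 = c).card : ℝ) ≤ r - 1 := by
    intro u c
    have := card_offDiag_fst_le (L u) c
    rw [hL] at this
    have h2 : (((L u).offDiag.filter fun x => x.1 = c).card : ℝ) ≤ ((r - 1 : ℕ) : ℝ) := by
      exact_mod_cast this
    rwa [Nat.cast_sub (by omega), Nat.cast_one] at h2
  have hsupp : (rcSupp A f h).Nonempty := hf.mono subset_union_left
  have e1 : β⁻¹ ^ ((rcSupp A f h).card - 1) = β * ∏ _u ∈ rcSupp A f h, β⁻¹ := by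
    rw [prod_const]
    obtain ⟨m, hm⟩ := Nat.exists_eq_succ_of_ne_zero hsupp.card_pos.ne'
    rw [hm, Nat.succ_sub_one, pow_succ]
    field_simp
  set ext : V → Finset V := fun v => (h v).elim ∅ fun y => A y.1 \ A f with hext
  set x : V → ℝ := fun u => ((rcBox L A f α h u).card : ℝ) / ((L u).offDiag.card : ℝ) * β⁻¹
    with hx
  have hx0 : ∀ u, 0 ≤ x u := fun u => by simp only [hx]; positivity
  have e2 : ∏ u ∈ rcSupp A f h, x u = ∏ v ∈ A f, (x v * ∏ u ∈ ext v, x u) := by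
    unfold rcSupp
    rw [prod_union, prod_biUnion, ← prod_mul_distrib]
    · intro v₁ h₁ v₂ h₂ hne
      simp only [Function.onFun]
      rcases e₁ : h v₁ with _ | y₁
      · simp
      · rcases e₂ : h v₂ with _ | y₂
        · simp
        · exact hdis v₁ h₁ v₂ h₂ hne _ _ e₁ e₂
    · rw [disjoint_biUnion_right]
      intro v hv
      rcases e₁ : h v with _ | y₁
      · simp
      · exact disjoint_sdiff
  rw [e1, mul_left_comm, ← prod_mul_distrib]
  change β * ∏ u ∈ rcSupp A f h, x u ≤ _
  rw [e2]
  refine mul_le_mul_of_nonneg_left (prod_le_prod (fun v _ =>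
    mul_nonneg (hx0 v) (prod_nonneg fun u _ => hx0 u)) ?_) hβ.le
  intro v hv
  have hβ' := inv_pos.2 hβ
  rcases e₁ : h v with _ | y
  · simp only [hext, e₁, Option.elim, prod_empty, mul_one, rcWt, hx]
    have h1 : ((rcBox L A f α h v).card : ℝ) ≤ r - 1 := by
      refine le_trans ?_ (hfst v α)
      refine Nat.cast_le.2 (card_le_card ?_)
      intro z hz
      simp only [rcBox, mem_filter, if_pos hv, e₁, Option.elim] at hz
      exact mem_filter.2 hz
    rw [hΩ]
    calc ((rcBox L A f α h v).card : ℝ) / (r * (r - 1)) * β⁻¹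
        ≤ (r - 1) / (r * (r - 1)) * β⁻¹ := by gcongr
      _ = β⁻¹ / r := by field_simp
  · simp only [hext, e₁, Option.elim, rcWt]
    have h1 : x v ≤ β⁻¹ / r / (r - 1) := by
      have : ((rcBox L A f α h v).card : ℝ) ≤ 1 := by
        have : (rcBox L A f α h v).card ≤ 1 := by
          rw [card_le_one]
          intro z hz z' hz'
          simp only [rcBox, mem_filter, if_pos hv, e₁, Option.elim] at hz hz'
          exact hz.2.trans hz'.2.symm
        exact_mod_cast this
      simp only [hx, hΩ]
      calc ((rcBox L A f α h v).card : ℝ) / (r * (r - 1)) * β⁻¹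
          ≤ 1 / (r * (r - 1)) * β⁻¹ := by gcongr
        _ = β⁻¹ / r / (r - 1) := by field_simp
    have h2 : ∏ u ∈ A y.1 \ A f, x u ≤ (β⁻¹ / r) ^ (A y.1 \ A f).card := by
      rw [← prod_const]
      refine prod_le_prod (fun u _ => hx0 u) fun u hu => ?_
      rw [Finset.mem_sdiff] at hu
      have : ((rcBox L A f α h u).card : ℝ) ≤ r - 1 := by
        refine le_trans ?_ (hfst u y.2)
        refine Nat.cast_le.2 (card_le_card ?_)
        intro z hz
        simp only [rcBox, mem_filter, if_neg hu.2] at hz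
        exact mem_filter.2 ⟨hz.1, hz.2 v hv y e₁ hu.1⟩
      simp only [hx, hΩ]
      calc ((rcBox L A f α h u).card : ℝ) / (r * (r - 1)) * β⁻¹
          ≤ (r - 1) / (r * (r - 1)) * β⁻¹ := by gcongr
        _ = β⁻¹ / r := by field_simp
    exact mul_le_mul h1 h2 (prod_nonneg fun u _ => hx0 u) (by positivity)

end Recolor

section Recolor

variable {V ι : Type*}

lemma sum_piFinset_prod_le [Fintype V] {O : Type*} (T : Finset V) (o₀ : O) (Opt : V → Finset O)
    (w : O → ℝ) (hw : ∀ o, 0 ≤ w o) (b : V → ℝ) (hb : ∀ v ∈ T, ∑ o ∈ Opt v, w o ≤ b v) :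
    ∑ h ∈ Fintype.piFinset (fun v => if v ∈ T then Opt v else {o₀}), ∏ v ∈ T, w (h v) ≤
      ∏ v ∈ T, b v := by
  have h1 : ∀ h : V → O, ∏ v ∈ T, w (h v) = ∏ v, (if v ∈ T then w (h v) else 1) := by
    intro h
    rw [prod_ite_mem, univ_inter]
  simp_rw [h1]
  rw [← prod_univ_sum (fun v => if v ∈ T then Opt v else {o₀})
    (fun v o => if v ∈ T then w o else 1)]
  rw [← univ_inter T, ← prod_ite_mem]
  refine prod_le_prod (fun v _ => sum_nonneg fun o _ => ?_) fun v _ => ?_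
  · split_ifs
    · exact hw o
    · exact zero_le_one
  · by_cases hv : v ∈ T
    · simpa [hv] using hb v hv
    · simp [hv]

/-- The edges `e ≠ f` whose sink is `v`, with a forbidden color other than `α`. -/
noncomputable def rcPairs (𝓔 : Finset ι) (Γ : ι → Finset ℕ) (s : ι → V) (L : V → Finset ℕ)
    (f : ι) (α : ℕ) (v : V) : Finset (ι × ℕ) :=
  (𝓔 ×ˢ 𝓔.biUnion Γ).filter fun y =>
    s y.1 = v ∧ y.1 ≠ f ∧ y.2 ∈ Γ y.1 ∧ y.2 ≠ α ∧ α ∈ L v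

/-- The ways in which the sink of `f` is recolored because of `f` itself. -/
noncomputable def rcSelf (Γ : ι → Finset ℕ) (f : ι) (α : ℕ) : Finset (ι × ℕ) :=
  ((Γ f).erase α).image fun γ => (f, γ)

/-- The recoloring patterns along `f` not involving `f` itself. -/
noncomputable def rcOuter [Fintype V] (𝓔 : Finset ι) (A : ι → Finset V) (Γ : ι → Finset ℕ)
    (s : ι → V) (L : V → Finset ℕ) (f : ι) (α : ℕ) : Finset (V → Option (ι × ℕ)) :=
  (Fintype.piFinset fun v => if v ∈ A f then insertNone (rcPairs 𝓔 Γ s L f α v)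
    else {none}).erase fun _ => none

/-- The recoloring patterns along `f` in which `f` recolors its sink. -/
noncomputable def rcInner [Fintype V] (𝓔 : Finset ι) (A : ι → Finset V) (Γ : ι → Finset ℕ)
    (s : ι → V) (L : V → Finset ℕ) (f : ι) (α : ℕ) : Finset (V → Option (ι × ℕ)) :=
  Fintype.piFinset fun v => if v ∈ A f then
    (if v = s f then (rcSelf Γ f α).map .some else (rcPairs 𝓔 Γ s L f α v).map .some)
    else {none}

lemma rcPattern_spec [Fintype V] {𝓔 : Finset ι} {A : ι → Finset V} {Γ : ι → Finset ℕ} {s : ι → V}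
    {L : V → Finset ℕ} {f : ι} (hf : f ∈ 𝓔) {α : ℕ} {h : V → Option (ι × ℕ)}
    (hh : h ∈ rcOuter 𝓔 A Γ s L f α ∪ rcInner 𝓔 A Γ s L f α) (v : V) (y : ι × ℕ)
    (hy : h v = some y) : y.1 ∈ 𝓔 ∧ s y.1 = v ∧ y.2 ∈ Γ y.1 ∧ y.2 ≠ α := by
  rcases mem_union.1 hh with h1 | h1
  · have h2 := Fintype.mem_piFinset.1 (mem_erase.1 h1).2 v
    rw [hy] at h2
    split_ifs at h2 with hv
    · rw [some_mem_insertNone] at h2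
      simp only [rcPairs, mem_filter, mem_product] at h2
      exact ⟨h2.1.1, h2.2.1, h2.2.2.2.1, h2.2.2.2.2.1⟩
    · simp at h2
  · have h2 := Fintype.mem_piFinset.1 h1 v
    rw [hy] at h2
    split_ifs at h2 with hv hv'
    · simp only [rcSelf, Finset.mem_map, mem_image, mem_erase, Function.Embedding.some_apply] at h2
      obtain ⟨y', ⟨γ, hγ, rfl⟩, hy'⟩ := h2
      obtain rfl := Option.some.inj hy'
      exact ⟨hf, hv'.symm, hγ.2, hγ.1⟩
    · simp only [Finset.mem_map, Function.Embedding.some_apply] at h2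
      obtain ⟨y', h2, hy'⟩ := h2
      obtain rfl := Option.some.inj hy'
      simp only [rcPairs, mem_filter, mem_product] at h2
      exact ⟨h2.1.1, h2.2.1, h2.2.2.2.1, h2.2.2.2.2.1⟩
    · simp at h2

/-- If recoloring leaves `f` monochromatic in `α`, then some recoloring event occurs. -/
lemma exists_rcPattern [Fintype V] {𝓔 : Finset ι} {A : ι → Finset V} {Γ : ι → Finset ℕ}
    {s : ι → V} {L : V → Finset ℕ} (hs : ∀ e ∈ 𝓔, s e ∈ A e) {f : ι} (hf : f ∈ 𝓔) {α : ℕ}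
    (hα : α ∈ Γ f) (ω : V → ℕ × ℕ) (hω : ∀ v, ω v ∈ (L v).offDiag)
    (hc : ∀ x ∈ A f, (if ∃ e ∈ 𝓔, s e = x ∧ ∃ γ ∈ Γ e, ∀ z ∈ A e, (ω z).1 = γ then (ω x).2
      else (ω x).1) = α) :
    ∃ h ∈ rcOuter 𝓔 A Γ s L f α ∪ rcInner 𝓔 A Γ s L f α, ∀ u, ω u ∈ rcBox L A f α h u := by
  have hpair : ∀ e ∈ 𝓔, s e ∈ A f → ∀ γ ∈ Γ e, (∀ z ∈ A e, (ω z).1 = γ) → (ω (s e)).1 = γ ∧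
      (ω (s e)).2 = α ∧ γ ≠ α ∧ α ∈ L (s e) := by
    intro e he hse γ hγ hm
    have h1 := hm _ (hs e he)
    have h2 := hc _ hse
    rw [if_pos ⟨e, he, rfl, γ, hγ, hm⟩] at h2
    have h3 := mem_offDiag.1 (hω (s e))
    exact ⟨h1, h2, fun h => h3.2.2 (by rw [h1, h2, h]), h2 ▸ h3.2.1⟩
  have box : ∀ h : V → Option (ι × ℕ), (∀ v ∈ A f, ∀ y, h v = some y → y.1 ∈ 𝓔 ∧ s y.1 = v ∧
      y.2 ∈ Γ y.1 ∧ ∀ z ∈ A y.1, (ω z).1 = y.2) → (∀ v ∈ A f, h v = none →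
        ¬ ∃ e ∈ 𝓔, s e = v ∧ ∃ γ ∈ Γ e, ∀ z ∈ A e, (ω z).1 = γ) →
      ∀ u, ω u ∈ rcBox L A f α h u := by
    intro h h1 h2 u
    rw [mem_rcBox]
    refine ⟨hω u, ?_⟩
    split_ifs with hu
    · rcases e₁ : h u with _ | y
      · have := hc u hu
        rw [if_neg (h2 u hu e₁)] at this
        exact this
      · obtain ⟨a, b, c, d⟩ := h1 u hu y e₁
        have := hpair y.1 a (b ▸ hu) y.2 c d
        rw [b] at this
        exact Prod.ext this.1 this.2.1
    · intro v hv y hy hu'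
      exact (h1 v hv y hy).2.2.2 u hu'
  have mem_pairs : ∀ e ∈ 𝓔, s e ∈ A f → e ≠ f → ∀ γ ∈ Γ e, (∀ z ∈ A e, (ω z).1 = γ) →
      (e, γ) ∈ rcPairs 𝓔 Γ s L f α (s e) := by
    intro e he hse hef γ hγ hm
    have := hpair e he hse γ hγ hm
    exact mem_filter.2 ⟨mem_product.2 ⟨he, mem_biUnion.2 ⟨e, he, hγ⟩⟩, rfl, hef, hγ, this.2.2⟩
  let good : V → Prop := fun v => ∃ y : ι × ℕ, y.1 ∈ 𝓔 ∧ y.1 ≠ f ∧ s y.1 = v ∧ y.2 ∈ Γ y.1 ∧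
    ∀ z ∈ A y.1, (ω z).1 = y.2
  by_cases hcase : ∀ v ∈ A f, (∃ e ∈ 𝓔, s e = v ∧ ∃ γ ∈ Γ e, ∀ z ∈ A e, (ω z).1 = γ) → good v
  · let h : V → Option (ι × ℕ) := fun v =>
      if hv : v ∈ A f ∧ good v then some hv.2.choose else none
    have hsome : ∀ v y, h v = some y → v ∈ A f ∧ y.1 ∈ 𝓔 ∧ y.1 ≠ f ∧ s y.1 = v ∧ y.2 ∈ Γ y.1 ∧
        ∀ z ∈ A y.1, (ω z).1 = y.2 := by
      intro v y hy
      by_cases hv : v ∈ A f ∧ good v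
      · simp only [h, dif_pos hv, Option.some.injEq] at hy
        subst hy
        exact ⟨hv.1, hv.2.choose_spec⟩
      · simp [h, dif_neg hv] at hy
    have hnone : ∀ v ∈ A f, h v = none → ¬ good v := by
      intro v hv hn hg
      simp [h, hv, hg] at hn
    refine ⟨h, mem_union_left _ (mem_erase.2 ⟨?_, Fintype.mem_piFinset.2 fun v => ?_⟩),
      box h (fun v _ y hy => ?_) (fun v hv hn hr => hnone v hv hn (hcase v hv hr))⟩
    · intro hall
      have h1 : ∀ x ∈ A f, (ω x).1 = α := by
        intro x hx
        have := hc x hx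
        rwa [if_neg (fun hr => hnone x hx (congrFun hall x) (hcase x hx hr))] at this
      exact (hpair f hf (hs f hf) α hα h1).2.2.1 rfl
    · split_ifs with hv
      · rw [mem_insertNone]
        intro y hy
        obtain ⟨-, a, b, c, d, e⟩ := hsome v y hy
        have := mem_pairs y.1 a (c ▸ hv) b y.2 d e
        rwa [c] at this
      · simp [h, hv]
    · obtain ⟨-, a, b, c, d, e⟩ := hsome v y hy
      exact ⟨a, c, d, e⟩
  · push Not at hcase
    obtain ⟨v₀, hv₀, ⟨e₀, he₀, hs₀, γ, hγ, hm⟩, hng⟩ := hcase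
    have hef : e₀ = f := by
      by_contra hne
      exact hng ⟨(e₀, γ), he₀, hne, hs₀, hγ, hm⟩
    subst hef
    have h0 := hpair e₀ he₀ (hs _ he₀) γ hγ hm
    have hgood : ∀ v ∈ A e₀, v ≠ s e₀ → good v := by
      intro v hv hne
      have h1 := hc v hv
      by_cases hr : ∃ e ∈ 𝓔, s e = v ∧ ∃ γ ∈ Γ e, ∀ z ∈ A e, (ω z).1 = γ
      · obtain ⟨e, he, hse, γ', hγ', hm'⟩ := hr
        exact ⟨(e, γ'), he, fun h => hne (by rw [← hse]; exact congrArg s h), hse, hγ', hm'⟩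
      · rw [if_neg hr, hm v hv] at h1
        exact absurd h1 h0.2.2.1
    let h : V → Option (ι × ℕ) := fun v =>
      if hv : v ∈ A e₀ then
        (if hv' : v = s e₀ then some (e₀, γ) else some (hgood v hv hv').choose) else none
    have hsome : ∀ v ∈ A e₀, v ≠ s e₀ → ∃ y, h v = some y ∧ y.1 ∈ 𝓔 ∧ y.1 ≠ e₀ ∧ s y.1 = v ∧
        y.2 ∈ Γ y.1 ∧ ∀ z ∈ A y.1, (ω z).1 = y.2 := by
      intro v hv hv'
      exact ⟨_, by simp only [h, dif_pos hv, dif_neg hv'], (hgood v hv hv').choose_spec⟩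
    have hself : h (s e₀) = some (e₀, γ) := by simp [h, hs _ he₀]
    refine ⟨h, mem_union_right _ (Fintype.mem_piFinset.2 fun v => ?_),
      box h (fun v hv y hy => ?_) (fun v hv hn => ?_)⟩
    · split_ifs with hv hv'
      · subst hv'
        rw [hself]
        simp [rcSelf, hγ, h0.2.2.1]
      · obtain ⟨y, hy, a, b, c, d, e⟩ := hsome v hv hv'
        have := mem_pairs y.1 a (c ▸ hv) b y.2 d e
        rw [c] at this
        rw [hy]
        exact Finset.mem_map.2 ⟨_, this, rfl⟩
      · simp [h, hv]
    · by_cases hv' : v = s e₀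
      · subst hv'
        rw [hself] at hy
        obtain rfl := Option.some.inj hy
        exact ⟨he₀, rfl, hγ, hm⟩
      · obtain ⟨y', hy', a, b, c, d, e⟩ := hsome v hv hv'
        rw [hy'] at hy
        obtain rfl := Option.some.inj hy
        exact ⟨a, c, d, e⟩
    · exfalso
      by_cases hv' : v = s e₀
      · subst hv'; rw [hself] at hn; cases hn
      · obtain ⟨y', hy', -⟩ := hsome v hv hv'
        rw [hy'] at hn; cases hn

end Recolor

section Recolor

variable {V ι : Type*}

/-- The combinatorial hypotheses of the recoloring lemma: edges with traces `A e` of size `k`, or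
of size `k - 1` with at most one forbidden color, forming a linear triangle-free system. -/
structure RcSystem (𝓔 : Finset ι) (A : ι → Finset V) (Γ : ι → Finset ℕ) (s : ι → V)
    (L : V → Finset ℕ) (k r : ℕ) : Prop where
  three_le : 3 ≤ k
  two_le : 2 ≤ r
  card_list : ∀ v, (L v).card = r
  sink_mem : ∀ e ∈ 𝓔, s e ∈ A e
  colors : ∀ e ∈ 𝓔, Γ e ⊆ L (s e)
  card_trace : ∀ e ∈ 𝓔, (A e).card = k ∨ (A e).card + 1 = k ∧ (Γ e).card ≤ 1
  linear : ∀ e ∈ 𝓔, ∀ f ∈ 𝓔, e ≠ f → ∀ v ∈ A e, v ∈ A f → A e ∩ A f = {v}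
  triangle_free : ∀ f ∈ 𝓔, ∀ e₁ ∈ 𝓔, ∀ e₂ ∈ 𝓔, e₁ ≠ f → e₂ ≠ f → ∀ v₁ ∈ A f, ∀ v₂ ∈ A f,
    v₁ ≠ v₂ → v₁ ∈ A e₁ → v₂ ∈ A e₂ → Disjoint (A e₁) (A e₂)

lemma prod_ite_eq_mul_pow (T : Finset V) {a : V} (ha : a ∈ T) (x y : ℝ) :
    ∏ v ∈ T, (if v = a then x else y) = x * y ^ (T.card - 1) := by
  rw [← mul_prod_erase T _ ha, if_pos rfl, ← card_erase_of_mem ha, ← prod_const]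
  congr 1
  exact prod_congr rfl fun v hv => if_neg (ne_of_mem_erase hv)

lemma prod_ite_ite_eq_mul_pow (T : Finset V) {a b : V} (ha : a ∈ T) (hb : b ∈ T) (hab : b ≠ a)
    (x y z : ℝ) :
    ∏ v ∈ T, (if v = a then x else if v = b then y else z) = x * (y * z ^ (T.card - 2)) := by
  rw [← mul_prod_erase T _ ha, if_pos rfl]
  have h := prod_ite_eq_mul_pow (T.erase a) (mem_erase.2 ⟨hab, hb⟩) y z
  rw [card_erase_of_mem ha, Nat.sub_sub] at h
  rw [← h]
  congr 1
  exact prod_congr rfl fun v hv => if_neg (ne_of_mem_erase hv)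

section Sums

variable {𝓔 : Finset ι} {A : ι → Finset V} {Γ : ι → Finset ℕ} {s : ι → V}
  {L : V → Finset ℕ} {k r : ℕ} {β L₀ t G : ℝ}

lemma RcSystem.sum_colors_le (H : RcSystem 𝓔 A Γ s L k r) (hβ : 0 < β)
    (hL₀ : 1 ≤ L₀) (hL₀' : β * r / (r - 1) ≤ L₀) (ht : t = β⁻¹ / r)
    (hG : G = L₀ * t ^ (k - 1)) {f e : ι} (hf : f ∈ 𝓔) (he : e ∈ 𝓔) (hef : e ≠ f)
    (hsf : s e ∈ A f) (α : ℕ) :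
    ∑ γ ∈ (Γ e).filter (fun γ => γ ≠ α ∧ α ∈ L (s e)), rcWt A t (r - 1) f (some (e, γ)) ≤
      t * G := by
  have hr1 : (0:ℝ) < (r:ℝ) - 1 := by
    have : (2:ℝ) ≤ r := by exact_mod_cast H.two_le
    linarith
  have hr0 : (0:ℝ) < r := by linarith
  have ht0 : 0 < t := by rw [ht]; positivity
  have hcard : (A e \ A f).card = (A e).card - 1 := by
    rw [card_sdiff, inter_comm, H.linear e he f hf hef _ (H.sink_mem e he) hsf, card_singleton]
  simp only [rcWt, Option.elim, sum_const, hcard, nsmul_eq_mul]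
  have h3 := H.three_le
  rcases H.card_trace e he with h | ⟨h, h'⟩
  · have h1 : (((Γ e).filter (fun γ => γ ≠ α ∧ α ∈ L (s e))).card : ℝ) ≤ r - 1 := by
      by_cases hα : α ∈ L (s e)
      · have h2 : ((Γ e).filter (fun γ => γ ≠ α ∧ α ∈ L (s e))).card ≤ r - 1 := by
          rw [← H.card_list (s e), ← card_erase_of_mem hα]
          refine card_le_card fun γ hγ => ?_
          rw [mem_filter] at hγ
          exact mem_erase.2 ⟨hγ.2.1, H.colors e he hγ.1⟩
        have h4 : (((Γ e).filter (fun γ => γ ≠ α ∧ α ∈ L (s e))).card : ℝ) ≤ ((r - 1 : ℕ) : ℝ) :=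
          by exact_mod_cast h2
        rwa [Nat.cast_sub (by have := H.two_le; omega), Nat.cast_one] at h4
      · simp [hα]
        exact_mod_cast (by have := H.two_le; omega : 1 ≤ r)
    rw [h, hG]
    calc _ ≤ ((r:ℝ) - 1) * (t / (r - 1) * t ^ (k - 1)) := by gcongr
      _ = t * (1 * t ^ (k - 1)) := by field_simp
      _ ≤ _ := by gcongr
  · have h1 : (((Γ e).filter (fun γ => γ ≠ α ∧ α ∈ L (s e))).card : ℝ) ≤ 1 := by
      exact_mod_cast (card_filter_le _ _).trans h'
    have h2 : (A e).card - 1 = k - 2 := by omega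
    have h4 : t ^ (k - 1) = t ^ (k - 2) * t := by
      rw [← pow_succ]; congr 1; omega
    rw [h2, hG, h4]
    calc _ ≤ (1:ℝ) * (t / (r - 1) * t ^ (k - 2)) := by gcongr
      _ = t * (β * r / (r - 1) * (t ^ (k - 2) * t)) := by
        rw [ht]; field_simp
      _ ≤ _ := by gcongr

lemma RcSystem.sum_pairs_le (H : RcSystem 𝓔 A Γ s L k r) (hβ : 0 < β)
    (hL₀ : 1 ≤ L₀) (hL₀' : β * r / (r - 1) ≤ L₀) (ht : t = β⁻¹ / r)
    (hG : G = L₀ * t ^ (k - 1)) {ρ : ℕ} (hρ : ∀ v, (𝓔.filter fun e => s e = v).card ≤ ρ)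
    {f : ι} (hf : f ∈ 𝓔) {v : V} (hv : v ∈ A f) (α : ℕ) :
    ∑ y ∈ rcPairs 𝓔 Γ s L f α v, rcWt A t (r - 1) f (some y) ≤ t * (ρ * G) := by
  have ht0 : 0 ≤ t := by rw [ht]; positivity
  have hG0 : 0 ≤ G := by rw [hG]; positivity
  rw [sum_finset_product (rcPairs 𝓔 Γ s L f α v) (𝓔.filter fun e => s e = v ∧ e ≠ f)
    (fun e => (Γ e).filter (fun γ => γ ≠ α ∧ α ∈ L v))]
  · calc _ ≤ ∑ e ∈ 𝓔.filter (fun e => s e = v ∧ e ≠ f), t * G := by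
          refine sum_le_sum fun e he => ?_
          rw [mem_filter] at he
          obtain ⟨he, rfl, hef⟩ := he
          exact H.sum_colors_le hβ hL₀ hL₀' ht hG hf he hef hv α
      _ = ((𝓔.filter (fun e => s e = v ∧ e ≠ f)).card : ℝ) * (t * G) := by
          rw [sum_const, nsmul_eq_mul]
      _ ≤ ρ * (t * G) := by
          gcongr
          refine (card_le_card fun e he => ?_).trans (hρ v)
          rw [mem_filter] at he ⊢
          exact ⟨he.1, he.2.1⟩
      _ = _ := by ring
  · rintro ⟨e, γ⟩
    simp only [rcPairs, mem_filter, mem_product, mem_biUnion]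
    constructor
    · rintro ⟨⟨a, b⟩, c, d, e, f, g⟩; exact ⟨⟨a, c, d⟩, e, f, g⟩
    · rintro ⟨⟨a, c, d⟩, e', f, g⟩; exact ⟨⟨a, ⟨e, a, e'⟩⟩, c, d, e', f, g⟩

lemma RcSystem.sum_self_le (H : RcSystem 𝓔 A Γ s L k r) (ht0 : 0 ≤ t)
    {f : ι} (hf : f ∈ 𝓔) {α : ℕ} (hα : α ∈ Γ f) :
    ∑ y ∈ rcSelf Γ f α, rcWt A t (r - 1) f (some y) ≤ t := by
  have hr1 : (0:ℝ) < (r:ℝ) - 1 := by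
    have : (2:ℝ) ≤ r := by exact_mod_cast H.two_le
    linarith
  rw [rcSelf, sum_image (by intro a _ b _ h; exact (Prod.mk.inj h).2)]
  simp only [rcWt, Option.elim, sum_const, sdiff_self, nsmul_eq_mul]
  have h2 : ((Γ f).erase α).card ≤ r - 1 := by
    rw [card_erase_of_mem hα, ← H.card_list (s f)]
    exact Nat.sub_le_sub_right (card_le_card (H.colors f hf)) 1
  have h4 : (((Γ f).erase α).card : ℝ) ≤ ((r - 1 : ℕ) : ℝ) := by exact_mod_cast h2
  rw [Nat.cast_sub (by have := H.two_le; omega), Nat.cast_one] at h4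
  simp only [bot_eq_empty, card_empty, pow_zero, mul_one]
  calc _ ≤ ((r:ℝ) - 1) * (t / (r - 1)) := by gcongr
    _ = t := by field_simp

lemma RcSystem.rcInner_eq_empty [Fintype V] (H : RcSystem 𝓔 A Γ s L k r) {f : ι} (hf : f ∈ 𝓔)
    {α : ℕ} (hα : α ∈ Γ f) (h1 : (Γ f).card ≤ 1) : rcInner 𝓔 A Γ s L f α = ∅ := by
  rw [eq_empty_iff_forall_notMem]
  intro h hh
  have h2 := Fintype.mem_piFinset.1 hh (s f)
  rw [if_pos (H.sink_mem f hf), if_pos rfl] at h2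
  simp only [rcSelf, Finset.mem_map, mem_image, mem_erase] at h2
  obtain ⟨-, ⟨γ, ⟨hne, hγ⟩, -⟩, -⟩ := h2
  exact hne (card_le_one.1 h1 γ hγ α hα)

lemma RcSystem.card_mul_sum_le [Fintype V] (H : RcSystem 𝓔 A Γ s L k r) (hβ : 0 < β) (hβ1 : β ≤ 1)
    (hL₀ : 1 ≤ L₀) (hL₀' : β * r / (r - 1) ≤ L₀) (ht : t = β⁻¹ / r)
    (hG : G = L₀ * t ^ (k - 1)) {ρ : ℕ} (hρ : ∀ v, (𝓔.filter fun e => s e = v).card ≤ ρ)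
    {g : ℝ} (hg : g = ρ * G) {f : ι} (hf : f ∈ 𝓔) {α : ℕ} (hα : α ∈ Γ f) :
    (Γ f).card * ∑ h ∈ rcOuter 𝓔 A Γ s L f α ∪ rcInner 𝓔 A Γ s L f α,
      ∏ v ∈ A f, rcWt A t (r - 1) f (h v) ≤ r * t ^ k * ((1 + g) ^ k - 1 + g ^ (k - 1)) := by
  have hr1 : (0:ℝ) < (r:ℝ) - 1 := by
    have : (2:ℝ) ≤ r := by exact_mod_cast H.two_le
    linarith
  have hr0 : (0:ℝ) < r := by linarith
  have ht0 : 0 < t := by rw [ht]; positivity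
  have hG0 : 0 ≤ G := by rw [hG]; positivity
  have hg0 : 0 ≤ g := by rw [hg]; positivity
  have hw := rcWt_nonneg A ht0.le hr1.le f
  have hsn : ∀ S : Finset (V → Option (ι × ℕ)),
      0 ≤ ∑ h ∈ S, ∏ v ∈ A f, rcWt A t (r - 1) f (h v) :=
    fun S => sum_nonneg fun h _ => prod_nonneg fun v _ => hw _
  have outer : ∑ h ∈ rcOuter 𝓔 A Γ s L f α, ∏ v ∈ A f, rcWt A t (r - 1) f (h v) ≤
      t ^ (A f).card * ((1 + g) ^ (A f).card - 1) := by
    rw [rcOuter, sum_erase_eq_sub]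
    · have := sum_piFinset_prod_le (A f) none (fun v => insertNone (rcPairs 𝓔 Γ s L f α v))
        (rcWt A t (r - 1) f) hw (fun _ => t * (1 + g)) (fun v hv => by
          rw [sum_insertNone, mul_add, mul_one, hg]
          exact add_le_add le_rfl (H.sum_pairs_le hβ hL₀ hL₀' ht hG hρ hf hv α))
      rw [prod_const, mul_pow] at this
      have e : ∏ _v ∈ A f, rcWt A t (r - 1) f none = t ^ (A f).card := by
        rw [prod_const]; rfl
      rw [e]
      linarith
    · rw [Fintype.mem_piFinset]
      intro v
      split_ifs <;> simp
  have inner : ∑ h ∈ rcInner 𝓔 A Γ s L f α, ∏ v ∈ A f, rcWt A t (r - 1) f (h v) ≤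
      t ^ (A f).card * g ^ ((A f).card - 1) := by
    have := sum_piFinset_prod_le (A f) none (fun v => if v = s f then (rcSelf Γ f α).map .some
        else (rcPairs 𝓔 Γ s L f α v).map .some)
        (rcWt A t (r - 1) f) hw (fun v => if v = s f then t else t * g) (fun v hv => by
          split_ifs with h
          · rw [sum_map]; exact H.sum_self_le ht0.le hf hα
          · rw [sum_map, hg]; exact H.sum_pairs_le hβ hL₀ hL₀' ht hG hρ hf hv α)
    rw [prod_ite_eq_mul_pow _ (H.sink_mem f hf), mul_pow, ← mul_assoc, ← pow_succ',
      Nat.sub_add_cancel (card_pos.2 ⟨_, H.sink_mem f hf⟩)] at this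
    exact this
  have union := (sum_union_inter (s₁ := rcOuter 𝓔 A Γ s L f α) (s₂ := rcInner 𝓔 A Γ s L f α)
    (f := fun h => ∏ v ∈ A f, rcWt A t (r - 1) f (h v)))
  have hnn : 0 ≤ ∑ h ∈ rcOuter 𝓔 A Γ s L f α ∩ rcInner 𝓔 A Γ s L f α,
      ∏ v ∈ A f, rcWt A t (r - 1) f (h v) := sum_nonneg fun h _ => prod_nonneg fun v _ => hw _
  have h3 := H.three_le
  have hone : ∀ m : ℕ, 0 ≤ (1 + g) ^ m - 1 := fun m => by
    have := one_le_pow₀ (by linarith : 1 ≤ 1 + g) (n := m)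
    linarith
  rcases H.card_trace f hf with h | ⟨h, h'⟩
  · rw [h] at outer inner
    have hc : ((Γ f).card : ℝ) ≤ r := by
      rw [← H.card_list (s f)]
      exact_mod_cast card_le_card (H.colors f hf)
    have := hone k
    calc _ ≤ (r:ℝ) * (t ^ k * ((1 + g) ^ k - 1) + t ^ k * g ^ (k - 1)) :=
          mul_le_mul hc (by linarith) (hsn _) hr0.le
      _ = _ := by ring
  · rw [H.rcInner_eq_empty hf hα h', union_empty]
    have hc : ((Γ f).card : ℝ) ≤ 1 := by exact_mod_cast h'
    have e : r * t ^ k = β⁻¹ * t ^ (A f).card := by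
      rw [← h, pow_succ, ht]; field_simp
    have hb : 1 ≤ β⁻¹ := (one_le_inv₀ hβ).2 hβ1
    have := hone (A f).card
    have := hone k
    calc _ ≤ (1:ℝ) * (t ^ (A f).card * ((1 + g) ^ (A f).card - 1)) :=
          mul_le_mul hc outer (hsn _) zero_le_one
      _ ≤ β⁻¹ * (t ^ (A f).card * ((1 + g) ^ k - 1)) := by
          gcongr
          · linarith
          · omega
      _ = β⁻¹ * t ^ (A f).card * ((1 + g) ^ k - 1) := by ring
      _ ≤ _ := by
          rw [e]
          gcongr
          have := pow_nonneg hg0 (k - 1)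
          linarith

lemma RcSystem.card_mul_sum_through_le [Fintype V] (H : RcSystem 𝓔 A Γ s L k r) (hβ : 0 < β)
    (hβ1 : β ≤ 1)
    (hL₀ : 1 ≤ L₀) (hL₀' : β * r / (r - 1) ≤ L₀) (ht : t = β⁻¹ / r)
    (hG : G = L₀ * t ^ (k - 1)) {ρ : ℕ} (hρ : ∀ v, (𝓔.filter fun e => s e = v).card ≤ ρ)
    {g : ℝ} (hg : g = ρ * G) {f e : ι} (hf : f ∈ 𝓔) (he : e ∈ 𝓔) (hef : e ≠ f)
    (hsf : s e ∈ A f) {α : ℕ} (hα : α ∈ Γ f) :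
    (Γ f).card * ∑ h ∈ (rcOuter 𝓔 A Γ s L f α ∪ rcInner 𝓔 A Γ s L f α).filter
        (fun h => ∃ γ, h (s e) = some (e, γ)),
      ∏ v ∈ A f, rcWt A t (r - 1) f (h v) ≤
        r * t ^ k * G * ((1 + g) ^ (k - 1) + g ^ (k - 2)) := by
  have hr1 : (0:ℝ) < (r:ℝ) - 1 := by
    have : (2:ℝ) ≤ r := by exact_mod_cast H.two_le
    linarith
  have hr0 : (0:ℝ) < r := by linarith
  have ht0 : 0 < t := by rw [ht]; positivity
  have hG0 : 0 ≤ G := by rw [hG]; positivity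
  have hg0 : 0 ≤ g := by rw [hg]; positivity
  have hw := rcWt_nonneg A ht0.le hr1.le f
  have hsn : ∀ S : Finset (V → Option (ι × ℕ)),
      0 ≤ ∑ h ∈ S, ∏ v ∈ A f, rcWt A t (r - 1) f (h v) :=
    fun S => sum_nonneg fun h _ => prod_nonneg fun v _ => hw _
  set Opt : Finset (Option (ι × ℕ)) :=
    ((rcPairs 𝓔 Γ s L f α (s e)).filter fun y => y.1 = e).map .some with hOpt
  have hOptsum : ∑ o ∈ Opt, rcWt A t (r - 1) f o ≤ t * G := by
    rw [hOpt, sum_map]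
    refine le_trans (le_of_eq ?_) (H.sum_colors_le hβ hL₀ hL₀' ht hG hf he hef hsf α)
    rw [sum_finset_product _ {e} (fun e' => (Γ e').filter (fun γ => γ ≠ α ∧ α ∈ L (s e')))]
    · rw [sum_singleton]; rfl
    · rintro ⟨e', γ⟩
      simp only [rcPairs, mem_filter, mem_product, mem_biUnion, mem_singleton]
      constructor
      · rintro ⟨⟨⟨a, b⟩, c, d, e, f, g⟩, rfl⟩; exact ⟨rfl, e, f, g⟩
      · rintro ⟨rfl, a, b, c⟩; exact ⟨⟨⟨he, ⟨_, he, a⟩⟩, rfl, hef, a, b, c⟩, rfl⟩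
  have hcpos : 0 < (A f).card := card_pos.2 ⟨_, H.sink_mem f hf⟩
  have outer : ∑ h ∈ (rcOuter 𝓔 A Γ s L f α).filter (fun h => ∃ γ, h (s e) = some (e, γ)),
      ∏ v ∈ A f, rcWt A t (r - 1) f (h v) ≤
      t ^ (A f).card * G * (1 + g) ^ ((A f).card - 1) := by
    have := sum_piFinset_prod_le (A f) none
        (fun v => if v = s e then Opt else insertNone (rcPairs 𝓔 Γ s L f α v))
        (rcWt A t (r - 1) f) hw (fun v => if v = s e then t * G else t * (1 + g)) (fun v hv => by
          split_ifs with h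
          · exact hOptsum
          · rw [sum_insertNone, mul_add, mul_one, hg]
            exact add_le_add le_rfl (H.sum_pairs_le hβ hL₀ hL₀' ht hG hρ hf hv α))
    rw [prod_ite_eq_mul_pow _ hsf, mul_pow] at this
    refine (sum_le_sum_of_subset_of_nonneg ?_ fun h _ _ => prod_nonneg fun v _ => hw _).trans
      (this.trans (le_of_eq ?_))
    · intro h hh
      rw [mem_filter, rcOuter, mem_erase, Fintype.mem_piFinset] at hh
      obtain ⟨⟨-, h1⟩, γ, h2⟩ := hh
      rw [Fintype.mem_piFinset]
      intro v
      have h3 := h1 v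
      by_cases hv : v = s e
      · subst hv
        rw [if_pos hsf, h2, some_mem_insertNone] at h3
        rw [if_pos hsf, if_pos rfl, h2]
        exact Finset.mem_map.2 ⟨_, mem_filter.2 ⟨h3, rfl⟩, rfl⟩
      · rwa [if_neg hv]
    · obtain ⟨m, hm⟩ := Nat.exists_eq_succ_of_ne_zero hcpos.ne'
      rw [hm, Nat.succ_sub_one, pow_succ]; ring
  have inner : k = (A f).card → ∑ h ∈ (rcInner 𝓔 A Γ s L f α).filter
      (fun h => ∃ γ, h (s e) = some (e, γ)),
      ∏ v ∈ A f, rcWt A t (r - 1) f (h v) ≤ t ^ k * G * g ^ (k - 2) := by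
    intro hk
    by_cases hse : s e = s f
    · rw [filter_false_of_mem, sum_empty]
      · positivity
      · rintro h hh ⟨γ, hγ⟩
        have h1 := Fintype.mem_piFinset.1 hh (s e)
        rw [if_pos hsf, if_pos hse, hγ] at h1
        simp only [rcSelf, Finset.mem_map, mem_image] at h1
        obtain ⟨-, ⟨γ', -, rfl⟩, h2⟩ := h1
        exact hef (congrArg Prod.fst (Option.some.inj h2)).symm
    · have := sum_piFinset_prod_le (A f) none (fun v => if v = s f then (rcSelf Γ f α).map .some
          else if v = s e then Opt else (rcPairs 𝓔 Γ s L f α v).map .some)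
          (rcWt A t (r - 1) f) hw
          (fun v => if v = s f then t else if v = s e then t * G else t * g) (fun v hv => by
            split_ifs with h h'
            · rw [sum_map]; exact H.sum_self_le ht0.le hf hα
            · exact hOptsum
            · rw [sum_map, hg]; exact H.sum_pairs_le hβ hL₀ hL₀' ht hG hρ hf hv α)
      rw [prod_ite_ite_eq_mul_pow _ (H.sink_mem f hf) hsf hse, mul_pow] at this
      refine (sum_le_sum_of_subset_of_nonneg ?_ fun h _ _ => prod_nonneg fun v _ => hw _).trans
        (this.trans (le_of_eq ?_))
      · intro h hh
        rw [mem_filter, rcInner, Fintype.mem_piFinset] at hh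
        obtain ⟨h1, γ, h2⟩ := hh
        rw [Fintype.mem_piFinset]
        intro v
        have h3 := h1 v
        by_cases hv : v = s e
        · subst hv
          rw [if_pos hsf, if_neg hse, h2] at h3
          rw [if_pos hsf, if_neg hse, if_pos rfl, h2]
          obtain ⟨y, hy, hy'⟩ := Finset.mem_map.1 h3
          obtain rfl := Option.some.inj hy'
          exact Finset.mem_map.2 ⟨_, mem_filter.2 ⟨hy, rfl⟩, rfl⟩
        · rwa [if_neg hv]
      · rw [← hk]
        obtain ⟨m, hm⟩ := Nat.exists_eq_add_of_le H.three_le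
        have e1 : k - 2 = m + 1 := by omega
        rw [e1, hm]; ring
  have hsum : ∑ h ∈ (rcOuter 𝓔 A Γ s L f α ∪ rcInner 𝓔 A Γ s L f α).filter
        (fun h => ∃ γ, h (s e) = some (e, γ)), ∏ v ∈ A f, rcWt A t (r - 1) f (h v) ≤
      ∑ h ∈ (rcOuter 𝓔 A Γ s L f α).filter (fun h => ∃ γ, h (s e) = some (e, γ)),
        ∏ v ∈ A f, rcWt A t (r - 1) f (h v) +
      ∑ h ∈ (rcInner 𝓔 A Γ s L f α).filter (fun h => ∃ γ, h (s e) = some (e, γ)),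
        ∏ v ∈ A f, rcWt A t (r - 1) f (h v) := by
    rw [filter_union, ← sum_union_inter]
    exact le_add_of_nonneg_right (sum_nonneg fun h _ => prod_nonneg fun v _ => hw _)
  have h3 := H.three_le
  rcases H.card_trace f hf with h | ⟨h, h'⟩
  · have inner := inner h.symm
    rw [h] at outer
    have hc : ((Γ f).card : ℝ) ≤ r := by
      rw [← H.card_list (s f)]
      exact_mod_cast card_le_card (H.colors f hf)
    calc _ ≤ (r:ℝ) * (t ^ k * G * (1 + g) ^ (k - 1) + t ^ k * G * g ^ (k - 2)) :=
          mul_le_mul hc (by linarith) (hsn _) hr0.le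
      _ = _ := by ring
  · rw [H.rcInner_eq_empty hf hα h', union_empty]
    have hc : ((Γ f).card : ℝ) ≤ 1 := by exact_mod_cast h'
    have e : r * t ^ k = β⁻¹ * t ^ (A f).card := by
      rw [← h, pow_succ, ht]; field_simp
    have hb : 1 ≤ β⁻¹ := (one_le_inv₀ hβ).2 hβ1
    calc _ ≤ (1:ℝ) * (t ^ (A f).card * G * (1 + g) ^ ((A f).card - 1)) :=
          mul_le_mul hc outer (hsn _) zero_le_one
      _ ≤ β⁻¹ * (t ^ (A f).card * G * (1 + g) ^ (k - 1)) := by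
          gcongr
          · linarith
          · omega
      _ = β⁻¹ * t ^ (A f).card * G * (1 + g) ^ (k - 1) := by ring
      _ ≤ _ := by
          rw [e]
          gcongr
          have := pow_nonneg hg0 (k - 2)
          linarith

end Sums

end Recolor

section Recolor

variable {V ι : Type*} {𝓔 : Finset ι} {A : ι → Finset V} {Γ : ι → Finset ℕ} {s : ι → V}
  {L : V → Finset ℕ} {k r : ℕ}

lemma rcBox_subset (L : V → Finset ℕ) (A : ι → Finset V) (f : ι) (α : ℕ)
    (h : V → Option (ι × ℕ)) (v : V) : rcBox L A f α h v ⊆ (L v).offDiag :=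
  filter_subset _ _

lemma sum_le_of_card_mul_le {κ : Type*} (T : Finset κ) (S : κ → ℝ) (X : ℝ) (hX : 0 ≤ X)
    (h : ∀ a ∈ T, T.card * S a ≤ X) : ∑ a ∈ T, S a ≤ X := by
  rcases T.eq_empty_or_nonempty with rfl | hT
  · simpa using hX
  · have h0 : (0:ℝ) < T.card := by exact_mod_cast hT.card_pos
    calc ∑ a ∈ T, S a ≤ ∑ _a ∈ T, X / T.card :=
          sum_le_sum fun a ha => by rw [le_div_iff₀ h0, mul_comm]; exact h a ha
      _ = X := by rw [sum_const, nsmul_eq_mul]; field_simp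

theorem RcSystem.exists_coloring [Fintype V] (H : RcSystem 𝓔 A Γ s L k r) {D ρ : ℕ}
    (hD : ∀ v, (𝓔.filter fun e => v ∈ A e).card ≤ D)
    (hρ : ∀ v, (𝓔.filter fun e => s e = v).card ≤ ρ)
    {β L₀ T g : ℝ} (hβ : 0 < β) (hβ1 : β ≤ 1) (hL₀ : 1 ≤ L₀) (hL₀' : β * r / (r - 1) ≤ L₀)
    (hT : T = (β⁻¹ / r) ^ (k - 1)) (hg : g = ρ * (L₀ * T))
    (hnum : D * T * ((1 + g) ^ k - 1 + g ^ (k - 1)) +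
      (D * T) ^ 2 * L₀ * ((1 + g) ^ (k - 1) + g ^ (k - 2)) ≤ 1 - β) :
    ∃ c : V → ℕ, (∀ v, c v ∈ L v) ∧ ∀ e ∈ 𝓔, ∀ γ ∈ Γ e, ∃ x ∈ A e, c x ≠ γ := by
  obtain ⟨t, ht⟩ : ∃ t, t = β⁻¹ / r := ⟨_, rfl⟩
  obtain ⟨G, hG⟩ : ∃ G, G = L₀ * t ^ (k - 1) := ⟨_, rfl⟩
  have hGT : G = L₀ * T := by rw [hG, hT, ht]
  have hg' : g = ρ * G := by rw [hg, hGT]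
  have hr1 : (0:ℝ) < (r:ℝ) - 1 := by
    have : (2:ℝ) ≤ r := by exact_mod_cast H.two_le
    linarith
  have hr0 : (0:ℝ) < r := by linarith
  have ht0 : 0 < t := by rw [ht]; positivity
  have hG0 : 0 ≤ G := by rw [hG]; positivity
  have hg0 : 0 ≤ g := by rw [hg']; positivity
  have hone : 0 ≤ (1 + g) ^ k - 1 := by
    have := one_le_pow₀ (by linarith : 1 ≤ 1 + g) (n := k)
    linarith
  have h3 := H.three_le
  have hTt : β * (r * t ^ k) = T := by
    have : t ^ k = t ^ (k - 1) * t := by rw [← pow_succ]; congr 1; omega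
    rw [this, hT, ← ht]
    nth_rewrite 2 [ht]
    field_simp
  obtain ⟨X₁, hX₁⟩ : ∃ X, X = r * t ^ k * ((1 + g) ^ k - 1 + g ^ (k - 1)) := ⟨_, rfl⟩
  obtain ⟨X₂, hX₂⟩ : ∃ X, X = r * t ^ k * G * ((1 + g) ^ (k - 1) + g ^ (k - 2)) := ⟨_, rfl⟩
  have hX₁0 : 0 ≤ X₁ := by rw [hX₁]; positivity
  have hX₂0 : 0 ≤ X₂ := by rw [hX₂]; positivity
  let P : ι → ℕ → Finset (V → Option (ι × ℕ)) := fun f α =>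
    rcOuter 𝓔 A Γ s L f α ∪ rcInner 𝓔 A Γ s L f α
  let W : ι → (V → Option (ι × ℕ)) → ℝ := fun f h => ∏ v ∈ A f, rcWt A t (r - 1) f (h v)
  have hW : ∀ f h, 0 ≤ W f h := fun f h => prod_nonneg fun v _ => rcWt_nonneg A ht0.le hr1.le f _
  let J : Finset (Σ _ : (Σ _ : ι, ℕ), (V → Option (ι × ℕ))) :=
    (𝓔.sigma Γ).sigma fun x => P x.1 x.2
  have hΩ : ∀ v, ((L v).offDiag).Nonempty := by
    intro v
    rw [← card_pos, offDiag_card, H.card_list]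
    have := H.two_le
    have : r * 2 ≤ r * r := Nat.mul_le_mul_left r this
    omega
  have key := exists_avoiding (fun v => (L v).offDiag) hΩ J
    (fun i => rcSupp A i.1.1 i.2) (fun i => rcBox L A i.1.1 i.1.2 i.2)
    (fun i _ v _ => rcBox_subset _ _ _ _ _ _)
    (fun i hi => by
      have := (mem_sigma.1 (mem_sigma.1 hi).1).1
      exact ⟨_, mem_union_left _ (H.sink_mem _ this)⟩) β hβ ?_
  · obtain ⟨ω, hω, hav⟩ := key
    refine ⟨fun x => if ∃ e ∈ 𝓔, s e = x ∧ ∃ γ ∈ Γ e, ∀ z ∈ A e, (ω z).1 = γ then (ω x).2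
      else (ω x).1, fun v => ?_, fun f hf α hα => ?_⟩
    · have := mem_offDiag.1 (hω v)
      dsimp only
      split_ifs
      exacts [this.2.1, this.1]
    · by_contra hcon
      push Not at hcon
      obtain ⟨h, hh, hbox⟩ := exists_rcPattern H.sink_mem hf hα ω hω hcon
      obtain ⟨u, -, hu⟩ := hav ⟨⟨f, α⟩, h⟩ (mem_sigma.2 ⟨mem_sigma.2 ⟨hf, hα⟩, hh⟩)
      exact hu (hbox u)
  · intro u
    have step1 : ∀ i ∈ J, (∏ v ∈ rcSupp A i.1.1 i.2,
        ((rcBox L A i.1.1 i.1.2 i.2 v).card : ℝ) / ((L v).offDiag.card : ℝ)) *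
        β⁻¹ ^ ((rcSupp A i.1.1 i.2).card - 1) ≤ β * W i.1.1 i.2 := by
      rintro ⟨⟨f, α⟩, h⟩ hi
      obtain ⟨hi, hh⟩ := mem_sigma.1 hi
      obtain ⟨hf, hα⟩ := mem_sigma.1 hi
      dsimp only at hf hα hh ⊢
      simp only [W, ht]
      refine rc_weight_le L A r H.two_le H.card_list β hβ f ⟨_, H.sink_mem f hf⟩ α h ?_
      intro v₁ hv₁ v₂ hv₂ hne y₁ y₂ hy₁ hy₂
      have s₁ := rcPattern_spec hf hh v₁ y₁ hy₁
      have s₂ := rcPattern_spec hf hh v₂ y₂ hy₂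
      by_cases e₁ : y₁.1 = f
      · rw [e₁, sdiff_self]; exact disjoint_bot_left
      by_cases e₂ : y₂.1 = f
      · rw [e₂, sdiff_self]; exact disjoint_bot_right
      exact (H.triangle_free f hf y₁.1 s₁.1 y₂.1 s₂.1 e₁ e₂ v₁ hv₁ v₂ hv₂ hne
        (s₁.2.1 ▸ H.sink_mem _ s₁.1) (s₂.2.1 ▸ H.sink_mem _ s₂.1)).mono sdiff_subset sdiff_subset
    have step2 : ∀ f ∈ 𝓔, ∀ α ∈ Γ f, ∑ h ∈ P f α, (if u ∈ rcSupp A f h then W f h else 0) ≤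
        (if u ∈ A f then ∑ h ∈ P f α, W f h else 0) +
          ∑ e ∈ (𝓔.filter fun e => u ∈ A e).filter (fun e => e ≠ f ∧ s e ∈ A f),
            ∑ h ∈ (P f α).filter (fun h => ∃ γ, h (s e) = some (e, γ)), W f h := by
      intro f hf α hα
      simp_rw [sum_filter (s := P f α)]
      rw [sum_comm]
      have : (if u ∈ A f then ∑ h ∈ P f α, W f h else 0) =
          ∑ h ∈ P f α, if u ∈ A f then W f h else 0 := by
        split_ifs <;> simp
      rw [this, ← sum_add_distrib]
      refine sum_le_sum fun h hh => ?_
      have hnn : 0 ≤ ∑ e ∈ (𝓔.filter fun e => u ∈ A e).filter (fun e => e ≠ f ∧ s e ∈ A f),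
          if ∃ γ, h (s e) = some (e, γ) then W f h else 0 :=
        sum_nonneg fun e _ => by split_ifs; exacts [hW f h, le_rfl]
      by_cases hu : u ∈ A f
      · rw [if_pos hu, if_pos (show u ∈ rcSupp A f h from mem_union_left _ hu)]
        linarith
      · rw [if_neg hu, zero_add]
        split_ifs with hu'
        · rcases mem_union.1 hu' with h' | h'
          · exact absurd h' hu
          · obtain ⟨v, hv, hv'⟩ := mem_biUnion.1 h'
            rcases e₁ : h v with _ | y
            · rw [e₁] at hv'; simp at hv'
            · rw [e₁] at hv'
              simp only [Option.elim, Finset.mem_sdiff] at hv'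
              have s₁ := rcPattern_spec hf hh v y e₁
              refine le_trans (le_of_eq ?_) (single_le_sum (f := fun e =>
                if ∃ γ, h (s e) = some (e, γ) then W f h else 0)
                (fun e _ => by split_ifs; exacts [hW f h, le_rfl])
                (mem_filter.2 ⟨mem_filter.2 ⟨s₁.1, hv'.1⟩, ?_, s₁.2.1.symm ▸ hv⟩))
              · rw [if_pos ⟨y.2, by rw [s₁.2.1, e₁]⟩]
              · intro hef
                rw [hef] at hv'
                exact hu hv'.1
        · exact hnn
    have step3 : ∑ f ∈ 𝓔, ∑ α ∈ Γ f, (if u ∈ A f then ∑ h ∈ P f α, W f h else 0) ≤ D * X₁ := by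
      calc _ = ∑ f ∈ 𝓔.filter (fun f => u ∈ A f), ∑ α ∈ Γ f, ∑ h ∈ P f α, W f h := by
            rw [sum_filter]
            refine sum_congr rfl fun f _ => ?_
            split_ifs <;> simp
        _ ≤ ∑ f ∈ 𝓔.filter (fun f => u ∈ A f), X₁ := by
            refine sum_le_sum fun f hf => sum_le_of_card_mul_le _ _ _ hX₁0 fun α hα => ?_
            rw [hX₁]
            exact H.card_mul_sum_le hβ hβ1 hL₀ hL₀' ht hG hρ hg' (mem_filter.1 hf).1 hα
        _ ≤ _ := by
            rw [sum_const, nsmul_eq_mul]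
            have := hD u
            gcongr
    have step4 : ∑ f ∈ 𝓔, ∑ α ∈ Γ f,
        ∑ e ∈ (𝓔.filter fun e => u ∈ A e).filter (fun e => e ≠ f ∧ s e ∈ A f),
            ∑ h ∈ (P f α).filter (fun h => ∃ γ, h (s e) = some (e, γ)), W f h ≤
          D * (D * X₂) := by
      calc _ = ∑ f ∈ 𝓔,
            ∑ e ∈ (𝓔.filter fun e => u ∈ A e).filter (fun e => e ≠ f ∧ s e ∈ A f), ∑ α ∈ Γ f,
            ∑ h ∈ (P f α).filter (fun h => ∃ γ, h (s e) = some (e, γ)), W f h :=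
            sum_congr rfl fun f _ => sum_comm
        _ ≤ ∑ f ∈ 𝓔,
            ∑ e ∈ (𝓔.filter fun e => u ∈ A e).filter (fun e => e ≠ f ∧ s e ∈ A f), X₂ := by
            refine sum_le_sum fun f hf => sum_le_sum fun e he =>
              sum_le_of_card_mul_le _ _ _ hX₂0 fun α hα => ?_
            simp only [mem_filter] at he
            rw [hX₂]
            exact H.card_mul_sum_through_le hβ hβ1 hL₀ hL₀' ht hG hρ hg' hf he.1.1 he.2.1
              he.2.2 hα
        _ = ∑ e ∈ 𝓔.filter (fun e => u ∈ A e), ∑ f ∈ 𝓔.filter (fun f => e ≠ f ∧ s e ∈ A f), X₂ := by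
            simp_rw [sum_filter (p := fun e => e ≠ _ ∧ s e ∈ A _)]
            rw [sum_comm]
            refine sum_congr rfl fun e _ => ?_
            rw [sum_filter]
        _ ≤ ∑ e ∈ 𝓔.filter (fun e => u ∈ A e), D * X₂ := by
            refine sum_le_sum fun e _ => ?_
            rw [sum_const, nsmul_eq_mul]
            have : (𝓔.filter (fun f => e ≠ f ∧ s e ∈ A f)).card ≤ D :=
              (card_le_card fun f hf => by
                rw [mem_filter] at hf ⊢
                exact ⟨hf.1, hf.2.2⟩).trans (hD (s e))
            gcongr
        _ ≤ _ := by
            rw [sum_const, nsmul_eq_mul]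
            have := hD u
            gcongr
    calc _ ≤ ∑ i ∈ J.filter (fun i => u ∈ rcSupp A i.1.1 i.2), β * W i.1.1 i.2 :=
          sum_le_sum fun i hi => step1 i (mem_filter.1 hi).1
      _ = β * ∑ f ∈ 𝓔, ∑ α ∈ Γ f, ∑ h ∈ P f α, (if u ∈ rcSupp A f h then W f h else 0) := by
          rw [← mul_sum, sum_filter, sum_sigma, sum_sigma]
      _ ≤ β * (D * X₁ + D * (D * X₂)) := by
          gcongr
          refine le_trans (sum_le_sum fun f hf => sum_le_sum fun α hα => step2 f hf α hα) ?_
          simp_rw [sum_add_distrib]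
          exact add_le_add step3 step4
      _ = D * T * ((1 + g) ^ k - 1 + g ^ (k - 1)) +
          (D * T) ^ 2 * L₀ * ((1 + g) ^ (k - 1) + g ^ (k - 2)) := by
          have e1 : β * X₁ = T * ((1 + g) ^ k - 1 + g ^ (k - 1)) := by
            rw [hX₁, ← hTt]; ring
          have e2 : β * X₂ = T * (L₀ * T) * ((1 + g) ^ (k - 1) + g ^ (k - 2)) := by
            rw [hX₂, ← hGT, ← hTt]; ring
          calc _ = D * (β * X₁) + D * D * (β * X₂) := by ring
            _ = _ := by rw [e1, e2]; ring
      _ ≤ 1 - β := hnum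

end Recolor

section Degenerate

variable {V ι : Type*}

theorem exists_coloring_of_degenerate (𝓔 : Finset ι) (A : ι → Finset V) (L : V → Finset ℕ) {r : ℕ}
    (hL : ∀ v, (L v).card = r) (hr : 0 < r) (S : Finset V)
    (hS : ∀ S' ⊆ S, S'.Nonempty →
      ∃ v ∈ S', (𝓔.filter fun i => v ∈ A i ∧ 2 ≤ (A i ∩ S').card).card < r) :
    ∃ c : V → ℕ, (∀ v, c v ∈ L v) ∧
      ∀ i ∈ 𝓔, 2 ≤ (A i ∩ S).card → ∃ x ∈ A i ∩ S, ∃ y ∈ A i ∩ S, c x ≠ c y := by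
  induction S using Finset.strongInduction with
  | H S ih =>
    rcases S.eq_empty_or_nonempty with rfl | hne
    · have : ∀ v, ∃ a, a ∈ L v := fun v => card_pos.1 (by rw [hL]; exact hr)
      choose c hc using this
      exact ⟨c, hc, fun i _ h => by simp at h⟩
    · obtain ⟨v, hv, hcard⟩ := hS S (Subset.refl _) hne
      obtain ⟨c, hc, hc'⟩ := ih (S.erase v) (erase_ssubset hv)
        fun S' hS' => hS S' (hS'.trans (erase_subset _ _))
      obtain ⟨a, haL, ha⟩ := exists_mem_notMem_of_card_lt_card
        (s := (𝓔.filter fun i => v ∈ A i ∧ 2 ≤ (A i ∩ S).card).image fun i =>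
          if h : ((A i ∩ S).erase v).Nonempty then c h.choose else 0) (t := L v)
        (by rw [hL]; exact card_image_le.trans_lt hcard)
      refine ⟨Function.update c v a, fun u => ?_, fun i hi h2 => ?_⟩
      · by_cases hu : u = v
        · subst hu; simpa using haL
        · rw [Function.update_of_ne hu]; exact hc u
      · by_cases hvi : v ∈ A i
        · have hne' : ((A i ∩ S).erase v).Nonempty := by
            rw [← card_pos, card_erase_of_mem (mem_inter.2 ⟨hvi, hv⟩)]; omega
          have hx := hne'.choose_spec
          refine ⟨v, mem_inter.2 ⟨hvi, hv⟩, hne'.choose, (mem_erase.1 hx).2, ?_⟩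
          rw [Function.update_self, Function.update_of_ne (mem_erase.1 hx).1]
          rintro rfl
          refine ha (mem_image.2 ⟨i, mem_filter.2 ⟨hi, hvi, h2⟩, ?_⟩)
          rw [dif_pos hne']
        · have hs : A i ∩ S.erase v = A i ∩ S := by
            ext u
            simp only [mem_inter, mem_erase]
            constructor
            · rintro ⟨a, -, b⟩; exact ⟨a, b⟩
            · rintro ⟨a, b⟩; exact ⟨a, fun h => hvi (h ▸ a), b⟩
          obtain ⟨x, hx, y, hy, hxy⟩ := hc' i hi (by rw [hs]; exact h2)
          rw [hs] at hx hy
          refine ⟨x, hx, y, hy, ?_⟩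
          have h1 : ∀ z ∈ A i ∩ S, z ≠ v := fun z hz h => hvi (h ▸ (mem_inter.1 hz).1)
          rwa [Function.update_of_ne (h1 x hx), Function.update_of_ne (h1 y hy)]

theorem exists_sink_of_hall [Nonempty V] (𝓔 : Finset ι) (A : ι → Finset V) (ρ : ℕ)
    (h : ∀ F ⊆ 𝓔, F.card ≤ ρ * (F.biUnion A).card) :
    ∃ s : ι → V, (∀ i ∈ 𝓔, s i ∈ A i) ∧ ∀ v, (𝓔.filter fun i => s i = v).card ≤ ρ := by
  obtain ⟨f, hf, hfA⟩ := (Finset.all_card_le_biUnion_card_iff_exists_injective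
    (fun i : 𝓔 => A i ×ˢ (univ : Finset (Fin ρ)))).1 fun F => by
      have e : (F.biUnion fun i : 𝓔 => A i ×ˢ (univ : Finset (Fin ρ))) =
          ((F.map (Function.Embedding.subtype _)).biUnion A) ×ˢ univ := by
        ext ⟨v, j⟩
        simp
      rw [e, card_product, card_univ, Fintype.card_fin, mul_comm,
        ← card_map (Function.Embedding.subtype _)]
      exact h _ fun i hi => by
        obtain ⟨j, -, rfl⟩ := Finset.mem_map.1 hi
        exact j.2
  obtain ⟨s, hs⟩ : ∃ s : ι → V, ∀ i : 𝓔, s i = (f i).1 :=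
    ⟨fun i => if hi : i ∈ 𝓔 then (f ⟨i, hi⟩).1 else Classical.arbitrary V, fun i => by simp⟩
  refine ⟨s, fun i hi => ?_, fun v => ?_⟩
  · rw [hs ⟨i, hi⟩]
    exact (mem_product.1 (hfA ⟨i, hi⟩)).1
  · have hmem : ∀ i : (𝓔.filter fun i => s i = v), i.1 ∈ 𝓔 := fun i => (mem_filter.1 i.2).1
    have := Fintype.card_le_of_injective
      (fun i : (𝓔.filter fun i => s i = v) => (f ⟨i.1, hmem i⟩).2) fun i j hij => by
        have h1 := (mem_filter.1 i.2).2
        have h2 := (mem_filter.1 j.2).2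
        have h3 := hf (Prod.ext ((hs ⟨i.1, hmem i⟩).symm.trans (h1.trans
          (h2.symm.trans (hs ⟨j.1, hmem j⟩)))) hij)
        exact Subtype.ext (congrArg (fun x : 𝓔 => x.1) h3)
    rwa [Fintype.card_coe, Fintype.card_fin] at this

lemma card_filter_mem_comm (𝓔 : Finset ι) (A : ι → Finset V) (S : Finset V) :
    ∑ v ∈ S, (𝓔.filter fun i => v ∈ A i).card = ∑ i ∈ 𝓔, (A i ∩ S).card := by
  have := sum_card_bipartiteAbove_eq_sum_card_bipartiteBelow (fun (v : V) i => v ∈ A i)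
    (s := S) (t := 𝓔)
  simp only [bipartiteAbove, bipartiteBelow] at this
  rw [this]
  refine sum_congr rfl fun i _ => ?_
  rw [filter_mem_eq_inter, inter_comm]

lemma card_le_mul_card_biUnion {𝓔 : Finset ι} {A : ι → Finset V} {a D ρ : ℕ} (ha : 0 < a)
    (hA : ∀ i ∈ 𝓔, a ≤ (A i).card) (hD : ∀ v, (𝓔.filter fun i => v ∈ A i).card ≤ D)
    (hρ : D ≤ ρ * a) {F : Finset ι} (hF : F ⊆ 𝓔) : F.card ≤ ρ * (F.biUnion A).card := by
  have h1 : ∑ i ∈ F, (A i).card ≤ (F.biUnion A).card * D := by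
    calc ∑ i ∈ F, (A i).card = ∑ i ∈ F, (A i ∩ F.biUnion A).card :=
          sum_congr rfl fun i hi => by
            rw [inter_eq_left.2 (subset_biUnion_of_mem A hi)]
      _ = _ := (card_filter_mem_comm F A _).symm
      _ ≤ ∑ v ∈ F.biUnion A, D := sum_le_sum fun v _ =>
          (card_le_card (filter_subset_filter _ hF)).trans (hD v)
      _ = _ := by rw [sum_const, smul_eq_mul]
  have h2 : F.card * a ≤ ∑ i ∈ F, (A i).card := by
    rw [← smul_eq_mul]
    exact card_nsmul_le_sum _ _ _ fun i hi => hA i (hF hi)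
  have h3 : F.card * a ≤ ρ * (F.biUnion A).card * a := by
    calc _ ≤ _ := h2.trans h1
      _ ≤ (F.biUnion A).card * (ρ * a) := Nat.mul_le_mul_left _ hρ
      _ = _ := by ring
  exact Nat.le_of_mul_le_mul_right h3 ha

theorem rchoosable_of_hall [Nonempty V] {E : Finset (Finset V)} {ρ r : ℕ}
    (hE : ∀ e ∈ E, 2 ≤ e.card) (h : ∀ F ⊆ E, F.card ≤ ρ * (F.biUnion id).card)
    (hr : 2 * ρ < r) : RChoosable r E := by
  intro L hL
  obtain ⟨s, hs, hsρ⟩ := exists_sink_of_hall E id ρ h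
  have : ∀ e : Finset V, ∃ w, e ∈ E → w ∈ e ∧ w ≠ s e := by
    intro e
    by_cases he : e ∈ E
    · obtain ⟨w, hw, hne⟩ := exists_mem_ne (show 1 < e.card from hE e he) (s e)
      exact ⟨w, fun _ => ⟨hw, hne⟩⟩
    · exact ⟨s e, fun h => absurd h he⟩
  choose w hw using this
  obtain ⟨c, hc, hc'⟩ := exists_coloring_of_degenerate E (fun e => {s e, w e}) L hL
    (by omega) (E.biUnion id) fun S' _ hne => by
      by_contra! hcon
      have hB : (E.filter fun e => 2 ≤ (({s e, w e} : Finset V) ∩ S').card).card ≤ ρ * S'.card := by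
        have hmaps : ∀ e ∈ E.filter fun e => 2 ≤ (({s e, w e} : Finset V) ∩ S').card,
            s e ∈ S' := by
          intro e he
          have h2 := (mem_filter.1 he).2
          have h3 : ({s e, w e} : Finset V) ∩ S' = {s e, w e} :=
            eq_of_subset_of_card_le inter_subset_left (card_le_two.trans h2)
          exact inter_eq_left.1 h3 (mem_insert_self _ _)
        rw [card_eq_sum_card_fiberwise hmaps, mul_comm, ← smul_eq_mul]
        exact sum_le_card_nsmul _ _ _ fun v _ => (card_le_card fun e he => by
          rw [mem_filter] at he ⊢
          exact ⟨(mem_filter.1 he.1).1, he.2⟩).trans (hsρ v)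
      have h1 : ∑ v ∈ S', ((E.filter fun e => 2 ≤ (({s e, w e} : Finset V) ∩ S').card).filter
          fun e => v ∈ ({s e, w e} : Finset V)).card ≤ (ρ * S'.card) * 2 := by
        rw [card_filter_mem_comm _ fun e => ({s e, w e} : Finset V)]
        refine (sum_le_card_nsmul _ _ 2 fun e _ =>
          (card_le_card inter_subset_left).trans card_le_two).trans ?_
        rw [smul_eq_mul]
        exact Nat.mul_le_mul_right _ hB
      have h2 : S'.card * r ≤ ∑ v ∈ S', ((E.filter fun e =>
          2 ≤ (({s e, w e} : Finset V) ∩ S').card).filter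
          fun e => v ∈ ({s e, w e} : Finset V)).card := by
        rw [← smul_eq_mul]
        refine card_nsmul_le_sum _ _ _ fun v hv => (hcon v hv).trans (le_of_eq ?_)
        rw [filter_filter]
        congr 1
        ext e
        simp only [mem_filter]
        tauto
      have h3 := card_pos.2 hne
      have h4 := h2.trans h1
      have : S'.card * (2 * ρ) < S'.card * r := Nat.mul_lt_mul_of_pos_left hr h3
      nlinarith
  refine ⟨c, hc, fun e he hm => ?_⟩
  have hs' := hs e he
  have hw' := hw e he
  have hss : ({s e, w e} : Finset V) ∩ E.biUnion id = {s e, w e} := by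
    rw [inter_eq_left]
    refine Subset.trans ?_ (subset_biUnion_of_mem id he)
    intro x hx
    rcases mem_insert.1 hx with rfl | hx
    · exact hs'
    · rw [mem_singleton.1 hx]; exact hw'.1
  obtain ⟨x, hx, y, hy, hxy⟩ := hc' e he (by
    rw [hss, card_pair hw'.2.symm])
  rw [hss] at hx hy
  have hsub : ∀ z ∈ ({s e, w e} : Finset V), z ∈ e := by
    intro z hz
    rcases mem_insert.1 hz with rfl | hz
    · exact hs'
    · rw [mem_singleton.1 hz]; exact hw'.1
  exact hxy (hm x (hsub x hx) y (hsub y hy))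

end Degenerate

section Structure

variable {V : Type*}

/-- `v` lies in two edges sharing another vertex, or in two edges of a triangle. -/
def InShortCycle (E : Finset (Finset V)) (v : V) : Prop :=
  (∃ e ∈ E, ∃ f ∈ E, e ≠ f ∧ v ∈ e ∧ v ∈ f ∧ ∃ w, w ≠ v ∧ w ∈ e ∧ w ∈ f) ∨
  ∃ e ∈ E, ∃ f ∈ E, ∃ h ∈ E, e ≠ f ∧ e ≠ h ∧ f ≠ h ∧ v ∈ e ∧ v ∈ f ∧
    ∃ a b, a ≠ v ∧ b ≠ v ∧ a ≠ b ∧ a ∈ e ∧ a ∈ h ∧ b ∈ f ∧ b ∈ h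

theorem rchoosable_of_structure [Fintype V] [Nonempty V] {E : Finset (Finset V)} {k r D ρ : ℕ}
    (hk : 3 ≤ k) (hr : 3 ≤ r) (hE : ∀ e ∈ E, e.card = k) (S : Finset V)
    (hdeg : ∀ v ∉ S, (E.filter fun e => v ∈ e).card ≤ D)
    (hcyc : ∀ v ∉ S, ¬ InShortCycle E v)
    (hdegen : ∀ S' ⊆ S, S'.Nonempty →
      ∃ v ∈ S', (E.filter fun e => v ∈ e ∧ 2 ≤ (e ∩ S').card).card < 3)
    (hρ : D ≤ ρ * (k - 1))
    {β L₀ T g : ℝ} (hβ : 0 < β) (hβ1 : β ≤ 1) (hL₀ : 1 ≤ L₀) (hL₀' : β * r / (r - 1) ≤ L₀)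
    (hT : T = (β⁻¹ / r) ^ (k - 1)) (hg : g = ρ * (L₀ * T))
    (hnum : D * T * ((1 + g) ^ k - 1 + g ^ (k - 1)) +
      (D * T) ^ 2 * L₀ * ((1 + g) ^ (k - 1) + g ^ (k - 2)) ≤ 1 - β) :
    RChoosable r E := by
  intro L hL
  obtain ⟨c₀, hc₀, hc₀'⟩ := exists_coloring_of_degenerate E id L hL (by omega) S
    fun S' h1 h2 => by
      obtain ⟨v, hv, hlt⟩ := hdegen S' h1 h2
      exact ⟨v, hv, hlt.trans_le hr⟩
  obtain ⟨𝓔, h𝓔⟩ : ∃ 𝓔, 𝓔 = E.filter fun e => (e ∩ S).card ≤ 1 := ⟨_, rfl⟩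
  have hmem : ∀ {e}, e ∈ 𝓔 ↔ e ∈ E ∧ (e ∩ S).card ≤ 1 := by
    intro e; rw [h𝓔, mem_filter]
  have hcardA : ∀ e ∈ 𝓔, (e \ S).card + (e ∩ S).card = k := by
    intro e he
    rw [card_sdiff_add_card_inter, hE e (hmem.1 he).1]
  have hdegA : ∀ v, (𝓔.filter fun e => v ∈ e \ S).card ≤ D := by
    intro v
    by_cases hv : v ∈ S
    · rw [filter_false_of_mem, card_empty]
      · exact Nat.zero_le _
      · intro e _ h
        exact (Finset.mem_sdiff.1 h).2 hv
    · refine (card_le_card fun e he => ?_).trans (hdeg v hv)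
      rw [mem_filter] at he ⊢
      exact ⟨(hmem.1 he.1).1, (Finset.mem_sdiff.1 he.2).1⟩
  obtain ⟨s, hs, hsρ⟩ := exists_sink_of_hall 𝓔 (fun e => e \ S) ρ fun F hF =>
    card_le_mul_card_biUnion (show 0 < k - 1 by omega) (fun e he => by
      have := hcardA e he
      have := (hmem.1 he).2
      omega) hdegA hρ hF
  have hlin : ∀ v ∉ S, ∀ e ∈ E, ∀ f ∈ E, e ≠ f → v ∈ e → v ∈ f → ∀ w ∈ e, w ∈ f → w = v := by
    intro v hv e he f hf hef hve hvf w hwe hwf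
    by_contra hne
    exact hcyc v hv (Or.inl ⟨e, he, f, hf, hef, hve, hvf, w, hne, hwe, hwf⟩)
  obtain ⟨Γ, hΓ⟩ : ∃ Γ : Finset V → Finset ℕ, Γ = fun e => (L (s e)).filter fun γ =>
    ∀ w ∈ e ∩ S, c₀ w = γ := ⟨_, rfl⟩
  have H : RcSystem 𝓔 (fun e => e \ S) Γ s L k r := {
    three_le := hk
    two_le := by omega
    card_list := hL
    sink_mem := hs
    colors := fun e _ => by rw [hΓ]; exact filter_subset _ _
    card_trace := fun e he => by
      have h1 := hcardA e he
      rcases Nat.le_one_iff_eq_zero_or_eq_one.1 (hmem.1 he).2 with h | h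
      · left; omega
      · right
        refine ⟨by omega, ?_⟩
        obtain ⟨w, hw⟩ := card_eq_one.1 h
        rw [card_le_one_iff_subset_singleton]
        refine ⟨c₀ w, fun γ hγ => ?_⟩
        rw [hΓ] at hγ
        rw [mem_singleton]
        exact ((mem_filter.1 hγ).2 w (hw ▸ mem_singleton_self w)).symm
    linear := fun e he f hf hef v hve hvf => by
      rw [Finset.mem_sdiff] at hve hvf
      ext w
      simp only [mem_inter, Finset.mem_sdiff, mem_singleton]
      constructor
      · rintro ⟨h1, h2⟩
        exact hlin v hve.2 e (hmem.1 he).1 f (hmem.1 hf).1 hef hve.1 hvf.1 w h1.1 h2.1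
      · rintro rfl
        exact ⟨hve, hvf⟩
    triangle_free := fun f hf e₁ he₁ e₂ he₂ h₁ h₂ v₁ hv₁ v₂ hv₂ hne hv₁' hv₂' => by
      rw [Finset.mem_sdiff] at hv₁ hv₂ hv₁' hv₂'
      rw [Finset.disjoint_left]
      intro x hx₁ hx₂
      rw [Finset.mem_sdiff] at hx₁ hx₂
      have hf := (hmem.1 hf).1
      have he₁ := (hmem.1 he₁).1
      have he₂ := (hmem.1 he₂).1
      by_cases h12 : e₁ = e₂
      · subst h12
        exact hne.symm (hlin v₁ hv₁.2 e₁ he₁ f hf h₁ hv₁'.1 hv₁.1 v₂ hv₂'.1 hv₂.1)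
      · refine hcyc x hx₁.2 (Or.inr ⟨e₁, he₁, e₂, he₂, f, hf, h12, h₁, h₂, hx₁.1, hx₂.1,
          v₁, v₂, ?_, ?_, hne, hv₁'.1, hv₁.1, hv₂'.1, hv₂.1⟩)
        · rintro rfl
          exact hne (hlin v₂ hv₂.2 e₂ he₂ f hf h₂ hv₂'.1 hv₂.1 _ hx₂.1 hv₁.1)
        · rintro rfl
          exact hne.symm (hlin v₁ hv₁.2 e₁ he₁ f hf h₁ hv₁'.1 hv₁.1 _ hx₁.1 hv₂.1) }
  obtain ⟨c, hc, hc'⟩ := H.exists_coloring hdegA hsρ hβ hβ1 hL₀ hL₀' hT hg hnum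
  refine ⟨fun v => if v ∈ S then c₀ v else c v, fun v => ?_, fun e he hm => ?_⟩
  · dsimp only
    split_ifs
    exacts [hc₀ v, hc v]
  · by_cases h2 : 2 ≤ (e ∩ S).card
    · obtain ⟨x, hx, y, hy, hxy⟩ := hc₀' e he h2
      simp only [id, mem_inter] at hx hy
      have := hm x hx.1 y hy.1
      simp only [hx.2, hy.2, if_true] at this
      exact hxy this
    · have he' : e ∈ 𝓔 := hmem.2 ⟨he, by omega⟩
      have hse := Finset.mem_sdiff.1 (hs e he')
      obtain ⟨x, hx, hxy⟩ := hc' e he' (c (s e)) (by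
        rw [hΓ]
        refine mem_filter.2 ⟨hc _, fun w hw => ?_⟩
        rw [mem_inter] at hw
        have := hm w hw.1 (s e) hse.1
        simpa only [hw.2, hse.2, if_true, if_false] using this)
      rw [Finset.mem_sdiff] at hx
      have := hm x hx.1 (s e) hse.1
      simp only [hx.2, hse.2, if_false] at this
      exact hxy this

end Structure

section BinomialSubset

variable {κ : Type*}

/-- Weight of the subset `E` of `K` when elements are kept independently with probability `p`. -/
noncomputable def binWt (K : Finset κ) (p : ℝ) (E : Finset κ) : ℝ :=
  p ^ E.card * (1 - p) ^ (K.card - E.card)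

/-- Probability that the binomial random subset of `K` satisfies `P`. -/
noncomputable def binPr (K : Finset κ) (p : ℝ) (P : Finset κ → Prop) : ℝ :=
  ∑ E ∈ K.powerset, if P E then binWt K p E else 0

variable {K : Finset κ} {p : ℝ}

lemma binWt_nonneg (hp0 : 0 ≤ p) (hp1 : p ≤ 1) (E : Finset κ) : 0 ≤ binWt K p E :=
  mul_nonneg (pow_nonneg hp0 _) (pow_nonneg (sub_nonneg.2 hp1) _)

lemma sum_binWt_mul_prod (K : Finset κ) (p : ℝ) (x : κ → ℝ) :
    ∑ E ∈ K.powerset, binWt K p E * ∏ e ∈ E, x e = ∏ e ∈ K, (1 - p + p * x e) := by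
  have := prod_add (fun e => p * x e) (fun _ => 1 - p) K
  simp_rw [add_comm (1 - p)]
  rw [this]
  refine sum_congr rfl fun E hE => ?_
  rw [prod_mul_distrib, prod_const, prod_const, card_sdiff_of_subset (mem_powerset.1 hE), binWt]
  ring

lemma sum_binWt (K : Finset κ) (p : ℝ) : ∑ E ∈ K.powerset, binWt K p E = 1 := by
  simpa using sum_binWt_mul_prod K p fun _ => 1

lemma binPr_nonneg (hp0 : 0 ≤ p) (hp1 : p ≤ 1) (P : Finset κ → Prop) : 0 ≤ binPr K p P :=
  sum_nonneg fun E _ => by split_ifs; exacts [binWt_nonneg hp0 hp1 E, le_rfl]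

lemma binPr_mono (hp0 : 0 ≤ p) (hp1 : p ≤ 1) {P Q : Finset κ → Prop}
    (h : ∀ E ⊆ K, P E → Q E) : binPr K p P ≤ binPr K p Q :=
  sum_le_sum fun E hE => by
    by_cases hP : P E
    · rw [if_pos hP, if_pos (h E (mem_powerset.1 hE) hP)]
    · rw [if_neg hP]
      split_ifs
      exacts [binWt_nonneg hp0 hp1 E, le_rfl]

lemma binPr_add_not (P : Finset κ → Prop) :
    binPr K p P + binPr K p (fun E => ¬ P E) = 1 := by
  rw [binPr, binPr, ← sum_add_distrib, ← sum_binWt K p]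
  refine sum_congr rfl fun E _ => ?_
  by_cases h : P E <;> simp [h]

lemma binPr_le_one (hp0 : 0 ≤ p) (hp1 : p ≤ 1) (P : Finset κ → Prop) : binPr K p P ≤ 1 := by
  have h1 := binPr_add_not (K := K) (p := p) P
  have h2 := binPr_nonneg (K := K) hp0 hp1 fun E => ¬ P E
  linarith

lemma binPr_or_le (hp0 : 0 ≤ p) (hp1 : p ≤ 1) (P Q : Finset κ → Prop) :
    binPr K p (fun E => P E ∨ Q E) ≤ binPr K p P + binPr K p Q := by
  rw [binPr, binPr, binPr, ← sum_add_distrib]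
  refine sum_le_sum fun E _ => ?_
  have := binWt_nonneg (K := K) hp0 hp1 E
  by_cases h1 : P E <;> by_cases h2 : Q E <;> simp [h1, h2, this]

lemma binPr_exists_le (hp0 : 0 ≤ p) (hp1 : p ≤ 1) {ι : Type*} (I : Finset ι)
    (P : ι → Finset κ → Prop) :
    binPr K p (fun E => ∃ i ∈ I, P i E) ≤ ∑ i ∈ I, binPr K p (P i) := by
  simp only [binPr]
  rw [sum_comm]
  refine sum_le_sum fun E _ => ?_
  have hw := binWt_nonneg (K := K) hp0 hp1 E
  have hn : ∀ i ∈ I, 0 ≤ if P i E then binWt K p E else 0 := fun i _ => by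
    split_ifs; exacts [hw, le_rfl]
  split_ifs with h
  · obtain ⟨i, hi, hP⟩ := h
    exact (le_of_eq (if_pos hP).symm).trans (single_le_sum (f := fun i =>
      if P i E then binWt K p E else 0) hn hi)
  · exact sum_nonneg hn

lemma binPr_exists_le_card_mul (hp0 : 0 ≤ p) (hp1 : p ≤ 1) {ι : Type*} (I : Finset ι)
    (P : ι → Finset κ → Prop) (b : ℝ) (h : ∀ i ∈ I, binPr K p (P i) ≤ b) :
    binPr K p (fun E => ∃ i ∈ I, P i E) ≤ I.card * b := by
  refine (binPr_exists_le hp0 hp1 I P).trans ?_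
  rw [← nsmul_eq_mul]
  exact sum_le_card_nsmul _ _ _ h

/-- Markov's inequality for the number of events that occur. -/
lemma mul_binPr_card_le (hp0 : 0 ≤ p) (hp1 : p ≤ 1) {ι : Type*} (I : Finset ι)
    (P : ι → Finset κ → Prop) (M : ℕ) :
    M * binPr K p (fun E => M ≤ (I.filter fun i => P i E).card) ≤ ∑ i ∈ I, binPr K p (P i) := by
  simp only [binPr]
  rw [sum_comm, mul_sum]
  refine sum_le_sum fun E _ => ?_
  have hw := binWt_nonneg (K := K) hp0 hp1 E
  rw [← sum_filter, sum_const, nsmul_eq_mul]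
  split_ifs with h
  · have : (M : ℝ) ≤ (I.filter fun i => P i E).card := by exact_mod_cast h
    gcongr
  · rw [mul_zero]; positivity

/-- The exponential Markov inequality. -/
lemma binPr_le_of_prod (hp0 : 0 ≤ p) (hp1 : p ≤ 1) (P : Finset κ → Prop) (x : κ → ℝ)
    (hx : ∀ e ∈ K, 0 ≤ x e) {B : ℝ} (hB : 0 ≤ B)
    (h : ∀ E ⊆ K, P E → 1 ≤ B * ∏ e ∈ E, x e) :
    binPr K p P ≤ B * Real.exp (p * ∑ e ∈ K, (x e - 1)) := by
  calc binPr K p P ≤ ∑ E ∈ K.powerset, B * (binWt K p E * ∏ e ∈ E, x e) := by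
        refine sum_le_sum fun E hE => ?_
        have hw := binWt_nonneg (K := K) hp0 hp1 E
        have hsub := mem_powerset.1 hE
        have hx' : 0 ≤ ∏ e ∈ E, x e := prod_nonneg fun e he => hx e (hsub he)
        split_ifs with hP
        · have := mul_le_mul_of_nonneg_left (h E hsub hP) hw
          linarith
        · positivity
    _ = B * ∏ e ∈ K, (1 - p + p * x e) := by rw [← mul_sum, sum_binWt_mul_prod]
    _ ≤ B * ∏ e ∈ K, Real.exp (p * (x e - 1)) := by
        refine mul_le_mul_of_nonneg_left (prod_le_prod (fun e he => ?_) fun e he => ?_) hB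
        · have := mul_nonneg hp0 (hx e he); linarith
        · have := Real.add_one_le_exp (p * (x e - 1)); linarith
    _ = _ := by rw [← Real.exp_sum, mul_sum]

lemma binPr_subset_le (hp0 : 0 ≤ p) (hp1 : p ≤ 1) {T : Finset κ} (hT : T ⊆ K) :
    binPr K p (fun E => T ⊆ E) ≤ p ^ T.card := by
  have := prod_add (fun _ => p) (fun e => if e ∈ T then 0 else 1 - p) K
  have h2 : ∏ e ∈ K, (p + if e ∈ T then 0 else 1 - p) = p ^ T.card := by
    rw [← prod_sdiff hT, prod_congr rfl (g := fun _ => (1:ℝ)), prod_const_one, one_mul,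
      prod_congr rfl (g := fun _ => p), prod_const]
    · intro e he; rw [if_pos he, add_zero]
    · intro e he; rw [if_neg (Finset.mem_sdiff.1 he).2]; ring
  rw [← h2, this, binPr]
  refine sum_le_sum fun E hE => ?_
  have hE := mem_powerset.1 hE
  split_ifs with h
  · rw [binWt, prod_const, prod_congr rfl (g := fun _ => 1 - p), prod_const,
      card_sdiff_of_subset hE]
    intro e he
    rw [if_neg fun h' => (Finset.mem_sdiff.1 he).2 (h h')]
  · exact mul_nonneg (prod_nonneg fun _ _ => hp0) (prod_nonneg fun e _ => by
      split_ifs; exacts [le_rfl, sub_nonneg.2 hp1])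

end BinomialSubset

section Counting

lemma choose_sub_sub_le {n k : ℕ} (hk : k ≤ n) (j : ℕ) (hj : j ≤ k) :
    ((n - j).choose (k - j) : ℝ) ≤ n.choose k * ((k : ℝ) / n) ^ j := by
  induction j with
  | zero => simp
  | succ j ih =>
    have ih := ih (by omega)
    have hn0 : (0:ℝ) < n := by exact_mod_cast (by omega : 0 < n)
    have h1 := Nat.add_one_mul_choose_eq (n - (j + 1)) (k - (j + 1))
    rw [show n - (j + 1) + 1 = n - j by omega, show k - (j + 1) + 1 = k - j by omega] at h1
    have h2 : ((n:ℝ) - j) * (n - (j + 1)).choose (k - (j + 1)) =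
        (n - j).choose (k - j) * ((k:ℝ) - j) := by
      have := congrArg (Nat.cast : ℕ → ℝ) h1
      push_cast [Nat.cast_sub (show j ≤ n by omega), Nat.cast_sub (show j ≤ k by omega)] at this
      exact this
    have hkj : (j:ℝ) + 1 ≤ k := by exact_mod_cast hj
    have hkn : (k:ℝ) ≤ n := by exact_mod_cast hk
    have hj0 : (0:ℝ) ≤ j := Nat.cast_nonneg j
    have hnj : (0:ℝ) < n - j := by linarith
    have h3 : ((n - (j + 1)).choose (k - (j + 1)) : ℝ) =
        (n - j).choose (k - j) * (((k:ℝ) - j) / (n - j)) := by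
      field_simp
      linarith
    rw [h3, pow_succ, ← mul_assoc]
    refine mul_le_mul ih ?_ (div_nonneg (by linarith) hnj.le) (by positivity)
    rw [div_le_div_iff₀ hnj hn0]
    nlinarith

lemma choose_le_choose_mul_pow {n s : ℕ} (hs : s ≤ n) (hn : 0 < n) (k : ℕ) :
    (s.choose k : ℝ) ≤ n.choose k * ((s : ℝ) / n) ^ k := by
  have hn0 : (0:ℝ) < n := by exact_mod_cast hn
  induction k with
  | zero => simp
  | succ k ih =>
    by_cases hks : s < k + 1
    · rw [Nat.choose_eq_zero_of_lt hks]
      simp only [Nat.cast_zero]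
      positivity
    · have h1 := Nat.choose_succ_right_eq s k
      have h2 := Nat.choose_succ_right_eq n k
      have e1 : (s.choose (k + 1) : ℝ) * (k + 1) = s.choose k * ((s:ℝ) - k) := by
        have := congrArg (Nat.cast : ℕ → ℝ) h1
        push_cast [Nat.cast_sub (show k ≤ s by omega)] at this
        exact this
      have e2 : (n.choose (k + 1) : ℝ) * (k + 1) = n.choose k * ((n:ℝ) - k) := by
        have := congrArg (Nat.cast : ℕ → ℝ) h2
        push_cast [Nat.cast_sub (show k ≤ n by omega)] at this
        exact this
      have hks' : (k:ℝ) ≤ s := by exact_mod_cast (by omega : k ≤ s)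
      have hsn : (s:ℝ) ≤ n := by exact_mod_cast hs
      have hk0 : (0:ℝ) ≤ k := Nat.cast_nonneg k
      have h3 : (s:ℝ) - k ≤ (s / n) * (n - k) := by
        rw [div_mul_eq_mul_div, le_div_iff₀ hn0]
        nlinarith
      have h4 : (s.choose (k + 1) : ℝ) * (k + 1) ≤
          (n.choose (k + 1) * ((s : ℝ) / n) ^ (k + 1)) * (k + 1) := by
        calc _ = s.choose k * ((s:ℝ) - k) := e1
          _ ≤ (n.choose k * ((s : ℝ) / n) ^ k) * ((s / n) * (n - k)) :=
              mul_le_mul ih h3 (by linarith) (by positivity)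
          _ = (n.choose k * ((n:ℝ) - k)) * ((s : ℝ) / n) ^ (k + 1) := by ring
          _ = _ := by rw [← e2]; ring
      exact le_of_mul_le_mul_right h4 (by positivity)

variable {V : Type*} [Fintype V]

lemma card_filter_subset_le {k : ℕ} (hk : k ≤ Fintype.card V) (T : Finset V) :
    ((((univ : Finset V).powersetCard k).filter fun e => T ⊆ e).card : ℝ) ≤
      (Fintype.card V).choose k * ((k : ℝ) / Fintype.card V) ^ T.card := by
  by_cases hT : T.card ≤ k
  · rw [card_filter_powersetCard_subset _ _ _ (subset_univ T) hT, card_univ]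
    exact choose_sub_sub_le hk _ hT
  · rw [filter_false_of_mem, card_empty, Nat.cast_zero]
    · positivity
    · intro e he h
      exact hT ((card_le_card h).trans_eq (mem_powersetCard.1 he).2)

lemma sum_powersetCard_card_inter_le {k : ℕ} (hk : k ≤ Fintype.card V) (S : Finset V) :
    ∑ e ∈ (univ : Finset V).powersetCard k, ((e ∩ S).card : ℝ) ≤
      S.card * ((Fintype.card V).choose k * ((k : ℝ) / Fintype.card V)) := by
  have := card_filter_mem_comm ((univ : Finset V).powersetCard k) id S
  rw [← Nat.cast_sum, ← show _ = ∑ e ∈ (univ : Finset V).powersetCard k, (e ∩ S).card from this,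
    Nat.cast_sum, ← nsmul_eq_mul]
  refine sum_le_card_nsmul _ _ _ fun v _ => ?_
  simpa using card_filter_subset_le hk {v}

/-- Weighted count of the `k`-sets through `P`, each vertex of `S \ P` having weight `w`. -/
lemma sum_filter_subset_pow_le {k : ℕ} (hk : k ≤ Fintype.card V) (P S : Finset V) {w : ℝ}
    (hw : 1 ≤ w) :
    ∑ e ∈ ((univ : Finset V).powersetCard k).filter (fun e => P ⊆ e),
        w ^ (e ∩ (S \ P)).card ≤
      (Fintype.card V).choose k * ((k : ℝ) / Fintype.card V) ^ P.card *
        Real.exp ((w - 1) * (k / Fintype.card V) * S.card) := by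
  have hw0 : 0 ≤ w - 1 := sub_nonneg.2 hw
  have h1 : ∀ e : Finset V, w ^ (e ∩ (S \ P)).card =
      ∑ U ∈ (S \ P).powerset, if U ⊆ e then (w - 1) ^ U.card else 0 := by
    intro e
    rw [← sum_filter]
    have : (S \ P).powerset.filter (fun U => U ⊆ e) = (e ∩ (S \ P)).powerset := by
      ext U
      simp only [mem_filter, mem_powerset, subset_inter_iff]
      tauto
    rw [this]
    have := sum_pow_mul_eq_add_pow (w - 1) 1 (e ∩ (S \ P))
    simp only [one_pow, mul_one, sub_add_cancel] at this
    exact this.symm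
  simp_rw [h1]
  rw [sum_comm]
  have hq : (0:ℝ) ≤ (k : ℝ) / Fintype.card V := by positivity
  have hN : (0:ℝ) ≤ (Fintype.card V).choose k * ((k : ℝ) / Fintype.card V) ^ P.card := by positivity
  calc _ ≤ ∑ U ∈ (S \ P).powerset, (Fintype.card V).choose k *
        ((k : ℝ) / Fintype.card V) ^ P.card * ((w - 1) * (k / Fintype.card V)) ^ U.card := by
        refine sum_le_sum fun U hU => ?_
        rw [← sum_filter, sum_const, nsmul_eq_mul, filter_filter]
        have hd : Disjoint P U := by
          rw [Finset.disjoint_left]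
          intro v hv hvU
          exact (Finset.mem_sdiff.1 (mem_powerset.1 hU hvU)).2 hv
        have h2 := card_filter_subset_le hk (P ∪ U)
        rw [card_union_of_disjoint hd, pow_add] at h2
        simp_rw [union_subset_iff] at h2
        calc _ ≤ _ := mul_le_mul_of_nonneg_right h2 (pow_nonneg hw0 U.card)
          _ = _ := by rw [mul_pow]; ring
    _ = _ * (1 + (w - 1) * (k / Fintype.card V)) ^ (S \ P).card := by
        rw [← mul_sum]
        congr 1
        have := sum_pow_mul_eq_add_pow ((w - 1) * ((k:ℝ) / Fintype.card V)) 1 (S \ P)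
        simp only [one_pow, mul_one] at this
        rw [this, add_comm]
    _ ≤ _ := by
        refine mul_le_mul_of_nonneg_left ?_ hN
        have h3 : (0:ℝ) ≤ (w - 1) * ((k:ℝ) / Fintype.card V) := mul_nonneg hw0 hq
        calc _ ≤ (1 + (w - 1) * ((k:ℝ) / Fintype.card V)) ^ S.card :=
              pow_le_pow_right₀ (by linarith) (card_le_card sdiff_subset)
          _ ≤ Real.exp ((w - 1) * (k / Fintype.card V)) ^ S.card := by
              refine pow_le_pow_left₀ (by linarith) ?_ _
              rw [add_comm]
              exact Real.add_one_le_exp _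
          _ = _ := by rw [← Real.exp_nat_mul, mul_comm]

lemma sum_two_le_card_inter_pow_le {k : ℕ} (hk : k ≤ Fintype.card V) (S : Finset V) {w : ℝ}
    (hw : 1 ≤ w) :
    ∑ e ∈ ((univ : Finset V).powersetCard k).filter (fun e => 2 ≤ (e ∩ S).card),
        w ^ (e ∩ S).card ≤
      (Fintype.card V).choose k * ((k : ℝ) / Fintype.card V) ^ 2 * ((S.card : ℝ) ^ 2 / 2) * w ^ 2 *
        Real.exp ((w - 1) * (k / Fintype.card V) * S.card) := by
  have hw0 : 0 ≤ w := by linarith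
  have key : ∀ e : Finset V, (if 2 ≤ (e ∩ S).card then w ^ (e ∩ S).card else 0) ≤
      w ^ 2 / 2 * ∑ x ∈ S.offDiag, if ({x.1, x.2} : Finset V) ⊆ e then
        w ^ (e ∩ (S \ {x.1, x.2})).card else 0 := by
    intro e
    split_ifs with h
    · have h1 : ∑ x ∈ S.offDiag, (if ({x.1, x.2} : Finset V) ⊆ e then
          w ^ (e ∩ (S \ {x.1, x.2})).card else 0) =
          ∑ x ∈ (e ∩ S).offDiag, w ^ ((e ∩ S).card - 2) := by
        rw [← sum_filter]
        refine sum_congr ?_ fun x hx => ?_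
        · ext x
          simp only [mem_filter, mem_offDiag, insert_subset_iff, singleton_subset_iff, mem_inter]
          tauto
        · rw [mem_offDiag, mem_inter, mem_inter] at hx
          congr 1
          rw [← inter_sdiff_assoc, card_sdiff_of_subset, card_pair hx.2.2]
          simp [insert_subset_iff, hx]
      rw [h1, sum_const, offDiag_card, nsmul_eq_mul]
      have h2 : (2:ℝ) ≤ (((e ∩ S).card * (e ∩ S).card - (e ∩ S).card : ℕ) : ℝ) := by
        have : (e ∩ S).card * 2 ≤ (e ∩ S).card * (e ∩ S).card := Nat.mul_le_mul_left _ h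
        exact_mod_cast (by omega : 2 ≤ (e ∩ S).card * (e ∩ S).card - (e ∩ S).card)
      have h3 : w ^ (e ∩ S).card = w ^ 2 * w ^ ((e ∩ S).card - 2) := by
        rw [← pow_add]; congr 1; omega
      rw [h3]
      have h4 : 0 ≤ w ^ 2 * w ^ ((e ∩ S).card - 2) := by positivity
      nlinarith
    · refine mul_nonneg (by positivity) (sum_nonneg fun x _ => ?_)
      split_ifs
      exacts [by positivity, le_rfl]
  rw [sum_filter]
  refine (sum_le_sum fun e _ => key e).trans ?_
  rw [← mul_sum, sum_comm]
  have h5 : ∀ x ∈ S.offDiag, ∑ e ∈ (univ : Finset V).powersetCard k,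
      (if ({x.1, x.2} : Finset V) ⊆ e then w ^ (e ∩ (S \ {x.1, x.2})).card else 0) ≤
      (Fintype.card V).choose k * ((k : ℝ) / Fintype.card V) ^ 2 *
        Real.exp ((w - 1) * (k / Fintype.card V) * S.card) := by
    intro x hx
    rw [← sum_filter]
    have := sum_filter_subset_pow_le hk {x.1, x.2} S hw
    rwa [card_pair (mem_offDiag.1 hx).2.2] at this
  refine (mul_le_mul_of_nonneg_left (sum_le_card_nsmul _ _ _ h5) (by positivity)).trans ?_
  rw [nsmul_eq_mul]
  have h6 : (S.offDiag.card : ℝ) ≤ (S.card : ℝ) ^ 2 := by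
    rw [offDiag_card, pow_two]
    exact_mod_cast Nat.sub_le _ _
  have h7 : 0 ≤ (Fintype.card V).choose k * ((k : ℝ) / Fintype.card V) ^ 2 *
        Real.exp ((w - 1) * (k / Fintype.card V) * S.card) := by positivity
  calc _ ≤ w ^ 2 / 2 * ((S.card : ℝ) ^ 2 * ((Fintype.card V).choose k *
        ((k : ℝ) / Fintype.card V) ^ 2 *
        Real.exp ((w - 1) * (k / Fintype.card V) * S.card))) := by gcongr
    _ = _ := by ring

end Counting

section RandomHypergraph

variable {V : Type*} [Fintype V] {k : ℕ} {p d : ℝ}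

lemma mul_card_filter_pair_le (hk : k ≤ Fintype.card V) (hp0 : 0 ≤ p)
    (hd : p * ((Fintype.card V).choose k * ((k : ℝ) / Fintype.card V)) ≤ d) {v w : V}
    (hvw : v ≠ w) :
    p * (((univ : Finset V).powersetCard k).filter fun e => {v, w} ⊆ e).card ≤
      d * ((k : ℝ) / Fintype.card V) := by
  have h1 := card_filter_subset_le hk {v, w}
  rw [card_pair hvw, pow_two, ← mul_assoc] at h1
  calc _ ≤ p * _ := mul_le_mul_of_nonneg_left h1 hp0
    _ = p * ((Fintype.card V).choose k * ((k : ℝ) / Fintype.card V)) *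
        ((k : ℝ) / Fintype.card V) := by ring
    _ ≤ _ := mul_le_mul_of_nonneg_right hd (by positivity)

lemma binPr_and_subset_le {κ : Type*} {K : Finset κ} (hp0 : 0 ≤ p) (hp1 : p ≤ 1) {Q : Prop}
    {T : Finset κ} {j : ℕ} (hT : T ⊆ K) (h : Q → T.card = j) :
    binPr K p (fun E => Q ∧ T ⊆ E) ≤ p ^ j := by
  by_cases hQ : Q
  · rw [← h hQ]
    exact (binPr_mono hp0 hp1 fun E _ h => h.2).trans (binPr_subset_le hp0 hp1 hT)
  · have : binPr K p (fun E => Q ∧ T ⊆ E) = 0 := by simp [binPr, hQ]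
    rw [this]; positivity

lemma binPr_inShortCycle_le (hk : k ≤ Fintype.card V) (hp0 : 0 ≤ p) (hp1 : p ≤ 1)
    (hd : p * ((Fintype.card V).choose k * ((k : ℝ) / Fintype.card V)) ≤ d) (v : V) :
    binPr ((univ : Finset V).powersetCard k) p (fun E => InShortCycle E v) ≤
      Fintype.card V * (d * ((k : ℝ) / Fintype.card V)) ^ 2 +
      (Fintype.card V) ^ 2 * (d * ((k : ℝ) / Fintype.card V)) ^ 3 := by
  obtain ⟨K, hK⟩ : ∃ K, K = (univ : Finset V).powersetCard k := ⟨_, rfl⟩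
  obtain ⟨a, ha⟩ : ∃ a, a = d * ((k : ℝ) / Fintype.card V) := ⟨_, rfl⟩
  rw [← hK, ← ha]
  have ha0 : 0 ≤ a := by
    rw [ha]
    exact mul_nonneg (le_trans (by positivity) hd) (by positivity)
  have hN : ∀ u w : V, u ≠ w → p * (K.filter fun e => {u, w} ⊆ e).card ≤ a := fun u w h => by
    rw [hK, ha]; exact mul_card_filter_pair_le hk hp0 hd h
  have hpN : ∀ u w : V, 0 ≤ p * (K.filter fun e => {u, w} ⊆ e).card := fun u w => by positivity
  have hVne : (univ.erase v : Finset V).card ≤ Fintype.card V := card_le_univ _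
  have hmem : ∀ {u w e}, e ∈ K.filter (fun e => {u, w} ⊆ e) ↔ e ∈ K ∧ u ∈ e ∧ w ∈ e := by
    intro u w e
    rw [mem_filter, insert_subset_iff, singleton_subset_iff]
  have h1 : binPr K p (fun E => ∃ w ∈ univ.erase v, ∃ e ∈ K.filter (fun e => {v, w} ⊆ e),
      ∃ f ∈ K.filter (fun e => {v, w} ⊆ e), e ≠ f ∧ {e, f} ⊆ E) ≤ Fintype.card V * a ^ 2 := by
    refine (binPr_exists_le_card_mul hp0 hp1 _ _ (a ^ 2) fun w hw => ?_).trans ?_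
    · have hw' := (mem_erase.1 hw).1.symm
      refine (binPr_exists_le_card_mul hp0 hp1 _ _ _ fun e he =>
        binPr_exists_le_card_mul hp0 hp1 _ _ (p ^ 2) fun f hf => ?_).trans ?_
      · refine binPr_and_subset_le hp0 hp1 ?_ card_pair
        simp [insert_subset_iff, (mem_filter.1 he).1, (mem_filter.1 hf).1]
      · calc _ = (p * (K.filter fun e => {v, w} ⊆ e).card) ^ 2 := by ring
          _ ≤ _ := pow_le_pow_left₀ (hpN v w) (hN v w hw') 2
    · have : ((univ.erase v : Finset V).card : ℝ) ≤ Fintype.card V := by exact_mod_cast hVne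
      gcongr
  have h2 : binPr K p (fun E => ∃ x ∈ univ.erase v, ∃ y ∈ (univ.erase v).erase x,
      ∃ e ∈ K.filter (fun e => {v, x} ⊆ e), ∃ f ∈ K.filter (fun e => {v, y} ⊆ e),
      ∃ h ∈ K.filter (fun e => {x, y} ⊆ e), (e ≠ f ∧ e ≠ h ∧ f ≠ h) ∧ {e, f, h} ⊆ E) ≤
      (Fintype.card V) ^ 2 * a ^ 3 := by
    have hcard : ((univ.erase v : Finset V).card : ℝ) ≤ Fintype.card V := by exact_mod_cast hVne
    refine (binPr_exists_le_card_mul hp0 hp1 _ _ (Fintype.card V * a ^ 3) fun x hx => ?_).trans ?_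
    · have hx' := (mem_erase.1 hx).1.symm
      refine (binPr_exists_le_card_mul hp0 hp1 _ _ (a ^ 3) fun y hy => ?_).trans ?_
      · have hy' := (mem_erase.1 (mem_erase.1 hy).2).1.symm
        have hxy := (mem_erase.1 hy).1.symm
        refine (binPr_exists_le_card_mul hp0 hp1 _ _ _ fun e he =>
          binPr_exists_le_card_mul hp0 hp1 _ _ _ fun f hf =>
          binPr_exists_le_card_mul hp0 hp1 _ _ (p ^ 3) fun h hh => ?_).trans ?_
        · refine binPr_and_subset_le hp0 hp1 ?_ fun hne =>
            card_eq_three.2 ⟨e, f, h, hne.1, hne.2.1, hne.2.2, rfl⟩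
          simp [insert_subset_iff, (mem_filter.1 he).1, (mem_filter.1 hf).1, (mem_filter.1 hh).1]
        · calc _ = (p * (K.filter fun e => {v, x} ⊆ e).card) *
                (p * (K.filter fun e => {v, y} ⊆ e).card) *
                (p * (K.filter fun e => {x, y} ⊆ e).card) := by ring
            _ ≤ a * a * a := by
                refine mul_le_mul (mul_le_mul (hN v x hx') (hN v y hy') (hpN v y) ha0)
                  (hN x y hxy) (hpN x y) (by positivity)
            _ = _ := by ring
      · have : (((univ.erase v : Finset V).erase x).card : ℝ) ≤ Fintype.card V := by
          exact_mod_cast card_le_univ _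
        gcongr
    · calc _ ≤ (Fintype.card V : ℝ) * (Fintype.card V * a ^ 3) := by gcongr
        _ = _ := by ring
  refine (binPr_mono hp0 hp1 fun E hE h => ?_).trans
    ((binPr_or_le hp0 hp1 _ _).trans (add_le_add h1 h2))
  rcases h with ⟨e, he, f, hf, hef, hve, hvf, w, hwv, hwe, hwf⟩ |
    ⟨e, he, f, hf, h, hh, hef, heh, hfh, hve, hvf, x, y, hxv, hyv, hxy, hxe, hxh, hyf, hyh⟩
  · left
    refine ⟨w, mem_erase.2 ⟨hwv, mem_univ _⟩, e, hmem.2 ⟨hE he, hve, hwe⟩, f,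
      hmem.2 ⟨hE hf, hvf, hwf⟩, hef, ?_⟩
    simp [insert_subset_iff, he, hf]
  · right
    refine ⟨x, mem_erase.2 ⟨hxv, mem_univ _⟩, y, mem_erase.2 ⟨hxy.symm, mem_erase.2 ⟨hyv,
      mem_univ _⟩⟩, e, hmem.2 ⟨hE he, hve, hxe⟩, f, hmem.2 ⟨hE hf, hvf, hyf⟩, h,
      hmem.2 ⟨hE hh, hxh, hyh⟩, ⟨hef, heh, hfh⟩, ?_⟩
    simp [insert_subset_iff, he, hf, hh]

/-- Vertices in short cycles are few: the first moment bound. -/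
lemma mul_binPr_card_inShortCycle_le (hk : k ≤ Fintype.card V) (hV : 0 < Fintype.card V)
    (hp0 : 0 ≤ p) (hp1 : p ≤ 1)
    (hd : p * ((Fintype.card V).choose k * ((k : ℝ) / Fintype.card V)) ≤ d) (M : ℕ) :
    M * binPr ((univ : Finset V).powersetCard k) p
      (fun E => M ≤ ((univ : Finset V).filter fun v => InShortCycle E v).card) ≤
      (d * k) ^ 2 + (d * k) ^ 3 := by
  refine (mul_binPr_card_le hp0 hp1 univ (fun v E => InShortCycle E v) M).trans ?_
  refine (sum_le_card_nsmul _ _ _ fun v _ => binPr_inShortCycle_le hk hp0 hp1 hd v).trans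
    (le_of_eq ?_)
  have : (0:ℝ) < Fintype.card V := by exact_mod_cast hV
  rw [nsmul_eq_mul, card_univ]
  field_simp

/-- Upper tail for the degrees into and inside a fixed vertex set. -/
lemma binPr_degrees_le (hk : k ≤ Fintype.card V) (hp0 : 0 ≤ p) (hp1 : p ≤ 1)
    (hd : p * ((Fintype.card V).choose k * ((k : ℝ) / Fintype.card V)) ≤ d) (S : Finset V)
    {z y : ℝ} (hz : 1 ≤ z) (hy : 1 ≤ y) (t m : ℕ) :
    binPr ((univ : Finset V).powersetCard k) p (fun E =>
      m ≤ ∑ v ∈ S, (E.filter fun e => v ∈ e ∧ 2 ≤ (e ∩ S).card).card ∧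
      t ≤ ∑ v ∈ S, (E.filter fun e => v ∈ e).card) ≤
      (z ^ t)⁻¹ * (y ^ m)⁻¹ * Real.exp (d * S.card * (z - 1) +
        d * k / 2 * (S.card ^ 2 / Fintype.card V) * (z * y) ^ 2 *
          Real.exp ((z * y - 1) * (k / Fintype.card V) * S.card)) := by
  have hz0 : 0 < z := by linarith
  have hy0 : 0 < y := by linarith
  have hw1 : 1 ≤ z * y := one_le_mul_of_one_le_of_one_le hz hy
  refine (binPr_le_of_prod hp0 hp1 _
    (fun e => z ^ (e ∩ S).card * if 2 ≤ (e ∩ S).card then y ^ (e ∩ S).card else 1)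
    (fun e _ => ?_) (by positivity) (B := (z ^ t)⁻¹ * (y ^ m)⁻¹) ?_).trans ?_
  · split_ifs <;> positivity
  · rintro E - ⟨hm, ht⟩
    have e1 : ∑ v ∈ S, (E.filter fun e => v ∈ e).card = ∑ e ∈ E, (e ∩ S).card :=
      card_filter_mem_comm E id S
    have e2 : ∑ v ∈ S, (E.filter fun e => v ∈ e ∧ 2 ≤ (e ∩ S).card).card =
        ∑ e ∈ E.filter (fun e => 2 ≤ (e ∩ S).card), (e ∩ S).card := by
      rw [← card_filter_mem_comm _ (fun e => e) S]
      refine sum_congr rfl fun v _ => ?_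
      rw [filter_filter]
      congr 1
      ext e
      simp only [mem_filter]
      tauto
    rw [prod_mul_distrib, prod_pow_eq_pow_sum, ← prod_filter, prod_pow_eq_pow_sum, ← e1, ← e2]
    have h1 := pow_le_pow_right₀ hz ht
    have h2 := pow_le_pow_right₀ hy hm
    have h3 : 0 < z ^ t := by positivity
    have h4 : 0 < y ^ m := by positivity
    calc (1:ℝ) = (z ^ t)⁻¹ * (y ^ m)⁻¹ * (z ^ t * y ^ m) := by field_simp
      _ ≤ _ := by gcongr
  · have hpt : ∀ e ∈ (univ : Finset V).powersetCard k,
        z ^ (e ∩ S).card * (if 2 ≤ (e ∩ S).card then y ^ (e ∩ S).card else 1) - 1 ≤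
        (e ∩ S).card * (z - 1) + if 2 ≤ (e ∩ S).card then (z * y) ^ (e ∩ S).card else 0 := by
      intro e _
      have hz1 : 0 ≤ z - 1 := by linarith
      split_ifs with h
      · rw [mul_pow]
        have : 0 ≤ ((e ∩ S).card : ℝ) * (z - 1) := by positivity
        linarith
      · rcases (by omega : (e ∩ S).card = 0 ∨ (e ∩ S).card = 1) with h' | h' <;> rw [h'] <;> simp
    refine mul_le_mul_of_nonneg_left (Real.exp_le_exp.2 ?_) (by positivity)
    calc _ ≤ p * ∑ e ∈ (univ : Finset V).powersetCard k, (((e ∩ S).card * (z - 1) +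
          if 2 ≤ (e ∩ S).card then (z * y) ^ (e ∩ S).card else 0)) :=
          mul_le_mul_of_nonneg_left (sum_le_sum hpt) hp0
      _ = (z - 1) * (p * ∑ e ∈ (univ : Finset V).powersetCard k, ((e ∩ S).card : ℝ)) +
          p * ∑ e ∈ ((univ : Finset V).powersetCard k).filter (fun e => 2 ≤ (e ∩ S).card),
            (z * y) ^ (e ∩ S).card := by
          rw [sum_add_distrib, ← sum_mul, ← sum_filter]; ring
      _ ≤ (z - 1) * (p * (S.card * ((Fintype.card V).choose k * ((k : ℝ) / Fintype.card V)))) +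
          p * ((Fintype.card V).choose k * ((k : ℝ) / Fintype.card V) ^ 2 *
            ((S.card : ℝ) ^ 2 / 2) * (z * y) ^ 2 *
            Real.exp ((z * y - 1) * (k / Fintype.card V) * S.card)) := by
          refine add_le_add (mul_le_mul_of_nonneg_left (mul_le_mul_of_nonneg_left
            (sum_powersetCard_card_inter_le hk S) hp0) (by linarith))
            (mul_le_mul_of_nonneg_left (sum_two_le_card_inter_pow_le hk S hw1) hp0)
      _ = (p * ((Fintype.card V).choose k * ((k : ℝ) / Fintype.card V))) *
          (S.card * (z - 1) + k / 2 * (S.card ^ 2 / Fintype.card V) * (z * y) ^ 2 *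
          Real.exp ((z * y - 1) * (k / Fintype.card V) * S.card)) := by ring
      _ ≤ d * _ := mul_le_mul_of_nonneg_right hd (by
          have : 0 ≤ z - 1 := by linarith
          positivity)
      _ = _ := by ring

end RandomHypergraph

section BadSets

variable {V : Type*} [Fintype V]

lemma mul_card_sub_le_sum_degree {E : Finset (Finset V)} {D M : ℕ} {S : Finset V}
    (hS : ∀ v ∈ S, D < (E.filter fun e => v ∈ e).card ∨ InShortCycle E v)
    (hM : ((univ : Finset V).filter fun v => InShortCycle E v).card < M) :
    (D + 1) * (S.card - M) ≤ ∑ v ∈ S, (E.filter fun e => v ∈ e).card := by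
  have h1 : S.card - M ≤ (S.filter fun v => D < (E.filter fun e => v ∈ e).card).card := by
    have h2 : S ⊆ (S.filter fun v => D < (E.filter fun e => v ∈ e).card) ∪
        (univ : Finset V).filter fun v => InShortCycle E v := by
      intro v hv
      rw [mem_union, mem_filter, mem_filter]
      rcases hS v hv with h | h
      · exact Or.inl ⟨hv, h⟩
      · exact Or.inr ⟨mem_univ _, h⟩
    have h3 := (card_le_card h2).trans (card_union_le _ _)
    omega
  calc _ ≤ (D + 1) * (S.filter fun v => D < (E.filter fun e => v ∈ e).card).card :=
        Nat.mul_le_mul_left _ h1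
    _ = (S.filter fun v => D < (E.filter fun e => v ∈ e).card).card • (D + 1) := by
        rw [smul_eq_mul, mul_comm]
    _ ≤ ∑ v ∈ S.filter fun v => D < (E.filter fun e => v ∈ e).card,
          (E.filter fun e => v ∈ e).card :=
        card_nsmul_le_sum _ _ _ fun v hv => (mem_filter.1 hv).2
    _ ≤ _ := sum_le_sum_of_subset (filter_subset _ _)

lemma exists_bad_set {E : Finset (Finset V)} {r D M s₀ : ℕ}
    (hdet : ∀ S : Finset V, (∀ v ∉ S, (E.filter fun e => v ∈ e).card ≤ D) →
      (∀ v ∉ S, ¬ InShortCycle E v) →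
      (∀ S' ⊆ S, S'.Nonempty →
        ∃ v ∈ S', (E.filter fun e => v ∈ e ∧ 2 ≤ (e ∩ S').card).card < 3) → RChoosable r E)
    (hE : ¬ RChoosable r E)
    (hM : ((univ : Finset V).filter fun v => InShortCycle E v).card < M) :
    (∃ s ∈ Icc 1 s₀, ∃ S ∈ (univ : Finset V).powersetCard s,
      3 * s ≤ ∑ v ∈ S, (E.filter fun e => v ∈ e ∧ 2 ≤ (e ∩ S).card).card ∧
      (D + 1) * (s - M) ≤ ∑ v ∈ S, (E.filter fun e => v ∈ e).card) ∨
    ∃ S ∈ (univ : Finset V).powersetCard s₀,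
      0 ≤ ∑ v ∈ S, (E.filter fun e => v ∈ e ∧ 2 ≤ (e ∩ S).card).card ∧
      (D + 1) * (s₀ - M) ≤ ∑ v ∈ S, (E.filter fun e => v ∈ e).card := by
  by_contra hcon
  rw [not_or] at hcon
  refine hE (hdet (univ.filter fun v => D < (E.filter fun e => v ∈ e).card ∨ InShortCycle E v)
    (fun v hv => ?_) (fun v hv => ?_) fun S' hS' hne => ?_)
  · by_contra h
    exact hv (mem_filter.2 ⟨mem_univ _, Or.inl (not_le.1 h)⟩)
  · exact fun h => hv (mem_filter.2 ⟨mem_univ _, Or.inr h⟩)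
  · by_contra! h
    have hS'' : ∀ v ∈ S', D < (E.filter fun e => v ∈ e).card ∨ InShortCycle E v :=
      fun v hv => (mem_filter.1 (hS' hv)).2
    by_cases hs : S'.card ≤ s₀
    · refine hcon.1 ⟨S'.card, mem_Icc.2 ⟨hne.card_pos, hs⟩, S', mem_powersetCard.2
        ⟨subset_univ _, rfl⟩, ?_, mul_card_sub_le_sum_degree hS'' hM⟩
      rw [mul_comm, ← smul_eq_mul]
      exact card_nsmul_le_sum _ _ _ h
    · obtain ⟨S, hS, hcard⟩ := exists_subset_card_eq (not_le.1 hs).le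
      refine hcon.2 ⟨S, mem_powersetCard.2 ⟨subset_univ _, hcard⟩, Nat.zero_le _, ?_⟩
      rw [← hcard]
      exact mul_card_sub_le_sum_degree (fun v hv => hS'' v (hS hv)) hM

end BadSets

section Analytic

lemma choose_le_exp_mul_pow (n s : ℕ) (hs : 0 < s) :
    (n.choose s : ℝ) ≤ (Real.exp 1 * (n / s)) ^ s := by
  have hs0 : (0:ℝ) < s := by exact_mod_cast hs
  have h1 : (n.choose s : ℝ) ≤ n ^ s / s.factorial := Nat.choose_le_pow_div s n
  have h2 : (s:ℝ) ^ s / s.factorial ≤ Real.exp s := Real.pow_div_factorial_le_exp s hs0.le s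
  have hf : (0:ℝ) < s.factorial := by exact_mod_cast s.factorial_pos
  calc (n.choose s : ℝ) ≤ n ^ s / s.factorial := h1
    _ = (n / s) ^ s * (s ^ s / s.factorial) := by rw [div_pow]; field_simp
    _ ≤ (n / s) ^ s * Real.exp s := by gcongr
    _ = _ := by rw [mul_pow, ← Real.exp_nat_mul, mul_one, mul_comm]

variable {V : Type*} [Fintype V] {k : ℕ} {p d : ℝ}

/-- First moment bound over all `s`-sets with large inner degrees. -/
lemma binPr_exists_inner_le (hk : k ≤ Fintype.card V) (hk0 : 0 < k) (hp0 : 0 ≤ p) (hp1 : p ≤ 1)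
    (hd0 : 0 < d)
    (hd : p * ((Fintype.card V).choose k * ((k : ℝ) / Fintype.card V)) ≤ d)
    {z a u : ℝ} (hz : 1 ≤ z) {s : ℕ} (hs : 0 < s) (t : ℕ) (ha : a = d * k / 2)
    (hu : u = Real.sqrt (a * s / Fintype.card V)) (huz : u * z ≤ 1) :
    binPr ((univ : Finset V).powersetCard k) p (fun E =>
      ∃ S ∈ (univ : Finset V).powersetCard s,
      3 * s ≤ ∑ v ∈ S, (E.filter fun e => v ∈ e ∧ 2 ≤ (e ∩ S).card).card ∧
      t ≤ ∑ v ∈ S, (E.filter fun e => v ∈ e).card) ≤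
      (z ^ t)⁻¹ * (Real.exp (d * (z - 1)) *
        (Real.exp 1 * (a * z ^ 3 * u) * Real.exp (Real.exp (2 * u / d)))) ^ s := by
  have hs0 : (0:ℝ) < s := by exact_mod_cast hs
  have hn0 : (0:ℝ) < Fintype.card V := by exact_mod_cast hk0.trans_le hk
  have hk0' : (0:ℝ) < k := by exact_mod_cast hk0
  have ha0 : 0 < a := by rw [ha]; positivity
  have hu0 : 0 < u := by rw [hu]; positivity
  have hu2 : u ^ 2 = a * s / Fintype.card V := by rw [hu, Real.sq_sqrt (by positivity)]
  have hz0 : 0 < z := by linarith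
  have hy : 1 ≤ 1 / (u * z) := (one_le_div (by positivity)).2 huz
  have hzy : z * (1 / (u * z)) = 1 / u := by field_simp
  refine (binPr_exists_le_card_mul hp0 hp1 _ _ ((z ^ t)⁻¹ * ((u * z) ^ (3 * s)) *
    Real.exp (s * (d * (z - 1) + Real.exp (2 * u / d)))) fun S hS => ?_).trans ?_
  · have hS' := (mem_powersetCard.1 hS).2
    refine (binPr_degrees_le hk hp0 hp1 hd S hz hy t (3 * s)).trans ?_
    rw [hS', hzy, one_div_pow, one_div, inv_inv]
    refine mul_le_mul_of_nonneg_left (Real.exp_le_exp.2 ?_) (by positivity)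
    have e1 : d * k / 2 * ((s:ℝ) ^ 2 / Fintype.card V) * (1 / u) ^ 2 = s := by
      rw [one_div, inv_pow, hu2, ← ha]
      field_simp
    rw [e1]
    have e2 : (1 / u - 1) * ((k:ℝ) / Fintype.card V) * s ≤ 2 * u / d := by
      have : ((k:ℝ) / Fintype.card V) * s = 2 * u ^ 2 / d := by
        rw [hu2, ha]; field_simp
      rw [mul_assoc, this]
      have : (1 / u - 1) * (2 * u ^ 2 / d) = 2 * u / d - 2 * u ^ 2 / d := by field_simp
      rw [this]
      have : 0 ≤ 2 * u ^ 2 / d := by positivity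
      linarith
    have := Real.exp_le_exp.2 e2
    nlinarith
  · rw [card_powersetCard, card_univ]
    calc _ ≤ (Real.exp 1 * (Fintype.card V / s)) ^ s * ((z ^ t)⁻¹ * ((u * z) ^ (3 * s)) *
          Real.exp (s * (d * (z - 1) + Real.exp (2 * u / d)))) :=
          mul_le_mul_of_nonneg_right (choose_le_exp_mul_pow _ _ hs) (by positivity)
      _ = (z ^ t)⁻¹ * (Real.exp (d * (z - 1)) *
          (Real.exp 1 * ((Fintype.card V / s) * (u * z) ^ 3) *
            Real.exp (Real.exp (2 * u / d)))) ^ s := by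
          rw [Real.exp_nat_mul, Real.exp_add]
          simp only [mul_pow, pow_mul]
          ring
      _ = _ := by
          have : (Fintype.card V / s) * (u * z) ^ 3 = a * z ^ 3 * u := by
            have : (u * z) ^ 3 = u ^ 2 * u * z ^ 3 := by ring
            rw [this, hu2]; field_simp
          rw [this]

/-- First moment bound over all `s`-sets with large total degree. -/
lemma binPr_exists_degree_le (hk : k ≤ Fintype.card V) (hk0 : 0 < k) (hp0 : 0 ≤ p) (hp1 : p ≤ 1)
    (hd0 : 0 < d)
    (hd : p * ((Fintype.card V).choose k * ((k : ℝ) / Fintype.card V)) ≤ d)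
    {z a b : ℝ} (hz : 1 ≤ z) {s : ℕ} (hs : 0 < s) (t : ℕ) (ha : a = d * k / 2)
    (hs₁ : a * z ^ 2 * s ≤ Fintype.card V) (hs₂ : Fintype.card V ≤ b * s) :
    binPr ((univ : Finset V).powersetCard k) p (fun E =>
      ∃ S ∈ (univ : Finset V).powersetCard s,
      0 ≤ ∑ v ∈ S, (E.filter fun e => v ∈ e ∧ 2 ≤ (e ∩ S).card).card ∧
      t ≤ ∑ v ∈ S, (E.filter fun e => v ∈ e).card) ≤
      (z ^ t)⁻¹ * (Real.exp (d * (z - 1)) *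
        (Real.exp 1 * b * Real.exp (Real.exp (2 / (d * z))))) ^ s := by
  have hs0 : (0:ℝ) < s := by exact_mod_cast hs
  have hn0 : (0:ℝ) < Fintype.card V := by exact_mod_cast hk0.trans_le hk
  have hk0' : (0:ℝ) < k := by exact_mod_cast hk0
  have ha0 : 0 < a := by rw [ha]; positivity
  have hz0 : 0 < z := by linarith
  refine (binPr_exists_le_card_mul hp0 hp1 _ _ ((z ^ t)⁻¹ *
    Real.exp (s * (d * (z - 1) + Real.exp (2 / (d * z))))) fun S hS => ?_).trans ?_
  · have hS' := (mem_powersetCard.1 hS).2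
    refine (binPr_degrees_le hk hp0 hp1 hd S hz le_rfl t 0).trans ?_
    rw [hS', mul_one, pow_zero, inv_one, mul_one]
    refine mul_le_mul_of_nonneg_left (Real.exp_le_exp.2 ?_) (by positivity)
    have e1 : d * k / 2 * ((s:ℝ) ^ 2 / Fintype.card V) * z ^ 2 ≤ (s:ℝ) := by
      rw [← ha]
      calc a * ((s:ℝ) ^ 2 / Fintype.card V) * z ^ 2 =
            (a * z ^ 2 * (s:ℝ)) / Fintype.card V * (s:ℝ) := by
            ring
        _ ≤ 1 * (s:ℝ) := by
            refine mul_le_mul_of_nonneg_right ((div_le_one hn0).2 hs₁) hs0.le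
        _ = (s:ℝ) := one_mul _
    have e2 : (z - 1) * ((k:ℝ) / Fintype.card V) * s ≤ 2 / (d * z) := by
      have h3 : z * ((k:ℝ) / Fintype.card V) * s ≤ 2 / (d * z) := by
        rw [le_div_iff₀ (by positivity)]
        have : z * ((k:ℝ) / Fintype.card V) * s * (d * z) =
            2 * ((a * z ^ 2 * s) / Fintype.card V) := by rw [ha]; ring
        rw [this]
        have := (div_le_one hn0).2 hs₁
        linarith
      have h4 : 0 ≤ ((k:ℝ) / Fintype.card V) * s := by positivity
      nlinarith
    have h5 := Real.exp_le_exp.2 e2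
    have h6 := mul_le_mul e1 h5 (Real.exp_nonneg _) hs0.le
    nlinarith
  · rw [card_powersetCard, card_univ]
    calc _ ≤ (Real.exp 1 * b) ^ s * ((z ^ t)⁻¹ *
          Real.exp (s * (d * (z - 1) + Real.exp (2 / (d * z))))) := by
          refine mul_le_mul_of_nonneg_right ((choose_le_exp_mul_pow _ _ hs).trans ?_)
            (by positivity)
          gcongr
          rwa [div_le_iff₀ hs0]
      _ = _ := by
          rw [Real.exp_nat_mul, Real.exp_add]
          simp only [mul_pow]
          ring

end Analytic

/-- `E` is `r`-choosable as soon as the vertices of degree above `D` and those on short cycles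
lie in a degenerate set. -/
def DegreeCriterion {V : Type*} (r D : ℕ) (E : Finset (Finset V)) : Prop :=
  ∀ S : Finset V, (∀ v ∉ S, (E.filter fun e => v ∈ e).card ≤ D) →
    (∀ v ∉ S, ¬ InShortCycle E v) →
    (∀ S' ⊆ S, S'.Nonempty →
      ∃ v ∈ S', (E.filter fun e => v ∈ e ∧ 2 ≤ (e ∩ S').card).card < 3) → RChoosable r E

section Total

variable {V : Type*} [Fintype V] {k : ℕ} {p d : ℝ}

lemma inv_pow_mul_sub_le {z : ℝ} (hz : 1 ≤ z) (m s M : ℕ) :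
    (z ^ (m * (s - M)))⁻¹ ≤ z ^ (m * M) * ((z ^ m)⁻¹) ^ s := by
  have hz0 : 0 < z := by linarith
  rw [inv_pow, ← pow_mul, ← div_eq_mul_inv, le_div_iff₀ (by positivity),
    inv_mul_le_iff₀ (by positivity), ← pow_add]
  refine pow_le_pow_right₀ hz ?_
  rw [← mul_add]
  exact Nat.mul_le_mul_left _ (by omega)

lemma sum_Icc_pow_le_two_mul {X : ℝ} (hX0 : 0 ≤ X) (hX : X ≤ 1 / 2) (m : ℕ) :
    ∑ s ∈ Icc 1 m, X ^ s ≤ 2 * X := by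
  have h : ∀ m : ℕ, ∑ s ∈ Icc 1 m, X ^ s ≤ 2 * X - 2 * X * X ^ m := by
    intro m
    induction m with
    | zero => simp
    | succ m ih =>
      rw [sum_Icc_succ_top (by omega)]
      have : 0 ≤ X ^ m := by positivity
      have h2 : X * X ^ m * X ≤ X * X ^ m * (1 / 2) := by gcongr
      have h3 : 0 ≤ X * X ^ m := by positivity
      rw [pow_succ]
      nlinarith
  have := h m
  have h0 : 0 ≤ 2 * X * X ^ m := by positivity
  linarith

/-- Union bound for the failure of list coloring. -/
lemma binPr_not_rchoosable_le (hk : k ≤ Fintype.card V) (hk0 : 0 < k) (hp0 : 0 ≤ p) (hp1 : p ≤ 1)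
    (hd0 : 1 ≤ d)
    (hd : p * ((Fintype.card V).choose k * ((k : ℝ) / Fintype.card V)) ≤ d)
    {r D M s₀ s₁ : ℕ} {a z A : ℝ} (hz : 1 ≤ z) (ha : a = d * k / 2) (hA : A = a * z ^ 2)
    (hM : 0 < M) (hs₁ : 0 < s₁) (hs₁₀ : s₁ ≤ s₀)
    (hs₀ : A * s₀ ≤ Fintype.card V) (hs₀' : Fintype.card V ≤ 1.05 * A * s₀)
    (hX : Real.exp 1 * Real.exp (Real.exp 2) * a * Real.sqrt (a * s₁ / Fintype.card V) ≤ 1 / 2)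
    (hdel : (z ^ (D + 1))⁻¹ * (Real.exp (d * (z - 1)) * (Real.exp 1 * A *
      Real.exp (Real.exp (2 / (d * z))))) ≤ 0.9)
    (hdet : ∀ E ⊆ (univ : Finset V).powersetCard k,
      DegreeCriterion r D E) :
    binPr ((univ : Finset V).powersetCard k) p (fun E => ¬ RChoosable r E) ≤
      ((d * k) ^ 2 + (d * k) ^ 3) / M +
      2 * (Real.exp 1 * Real.exp (Real.exp 2) * a * Real.sqrt (a * s₁ / Fintype.card V)) +
      z ^ ((D + 1) * M) * ((s₀ + 1) * 0.945 ^ s₁) := by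
  have hn0 : (0:ℝ) < Fintype.card V := by exact_mod_cast hk0.trans_le hk
  have hk0' : (0:ℝ) < k := by exact_mod_cast hk0
  have hM0 : (0:ℝ) < M := by exact_mod_cast hM
  have hd1 : 0 < d := by linarith
  have ha0 : 0 < a := by rw [ha]; positivity
  have hz0 : 0 < z := by linarith
  have hA0 : 0 < A := by rw [hA]; positivity
  set K := (univ : Finset V).powersetCard k with hK
  set P : ℕ → ℕ → Finset (Finset V) → Prop := fun s t E =>
      ∃ S ∈ (univ : Finset V).powersetCard s,
      3 * s ≤ ∑ v ∈ S, (E.filter fun e => v ∈ e ∧ 2 ≤ (e ∩ S).card).card ∧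
      t ≤ ∑ v ∈ S, (E.filter fun e => v ∈ e).card with hP
  set X := Real.exp 1 * Real.exp (Real.exp 2) * a * Real.sqrt (a * s₁ / Fintype.card V) with hXdef
  set δ := (z ^ (D + 1))⁻¹ * (Real.exp (d * (z - 1)) * (Real.exp 1 * A *
      Real.exp (Real.exp (2 / (d * z))))) with hδ
  have hδ0 : 0 ≤ δ := by positivity
  have hX0 : 0 ≤ X := by positivity
  have hLam0 : 0 ≤ z ^ ((D + 1) * M) := by positivity
  -- vertices on short cycles
  have hcyc : binPr K p (fun E =>
      M ≤ ((univ : Finset V).filter fun v => InShortCycle E v).card) ≤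
      ((d * k) ^ 2 + (d * k) ^ 3) / M := by
    rw [le_div_iff₀ hM0, mul_comm]
    exact mul_binPr_card_inShortCycle_le hk (hk0.trans_le hk) hp0 hp1 hd M
  -- small sets
  have hsmall : ∀ s ∈ Icc 1 s₁, binPr K p (P s ((D + 1) * (s - M))) ≤ X ^ s := by
    intro s hs
    obtain ⟨hs1, hs2⟩ := mem_Icc.1 hs
    have hss : (s:ℝ) ≤ s₁ := by exact_mod_cast hs2
    have hs0 : (1:ℝ) ≤ s := by exact_mod_cast hs1
    have hu : Real.sqrt (a * s / Fintype.card V) ≤ Real.sqrt (a * s₁ / Fintype.card V) := by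
      gcongr
    have hu1 : Real.sqrt (a * s / Fintype.card V) ≤ 1 := by
      rw [Real.sqrt_le_one, div_le_one hn0]
      have h1 : (s₁:ℝ) ≤ s₀ := by exact_mod_cast hs₁₀
      have h2 : a * 1 ≤ a * z ^ 2 := by gcongr; exact one_le_pow₀ hz
      calc a * s ≤ A * s₀ := by
            rw [hA]; exact mul_le_mul (by linarith) (hss.trans h1) (by linarith) (by positivity)
        _ ≤ _ := hs₀
    have h1 := binPr_exists_inner_le hk hk0 hp0 hp1 hd1 hd le_rfl (s := s) hs1 0 ha rfl
      (by rwa [mul_one])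
    refine (binPr_mono hp0 hp1 fun E _ h => ?_).trans (h1.trans ?_)
    · obtain ⟨S, hS, h, -⟩ := h
      exact ⟨S, hS, h, Nat.zero_le _⟩
    · rw [pow_zero, inv_one, one_mul, sub_self, mul_zero, Real.exp_zero, one_mul, one_pow, mul_one]
      refine pow_le_pow_left₀ (by positivity) ?_ s
      have h2 : 2 * Real.sqrt (a * s / Fintype.card V) / d ≤ 2 := by
        rw [div_le_iff₀ hd1]; nlinarith
      calc Real.exp 1 * (a * Real.sqrt (a * s / Fintype.card V)) *
            Real.exp (Real.exp (2 * Real.sqrt (a * s / Fintype.card V) / d)) ≤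
            Real.exp 1 * (a * Real.sqrt (a * s₁ / Fintype.card V)) *
            Real.exp (Real.exp 2) := by gcongr
        _ = X := by rw [hXdef]; ring
  -- sets of moderate size
  have hmid : ∀ s ∈ Ioc s₁ s₀, binPr K p (P s ((D + 1) * (s - M))) ≤
      z ^ ((D + 1) * M) * 0.945 ^ s₁ := by
    intro s hs
    obtain ⟨hs1, hs2⟩ := mem_Ioc.1 hs
    have hss : (s:ℝ) ≤ s₀ := by exact_mod_cast hs2
    have hs0 : (0:ℝ) < s := by exact_mod_cast hs₁.trans hs1
    have huz : Real.sqrt (a * s / Fintype.card V) * z ≤ 1 := by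
      have : Real.sqrt (a * s / Fintype.card V) * z =
          Real.sqrt (a * s / Fintype.card V * z ^ 2) := by
        rw [Real.sqrt_mul (by positivity), Real.sqrt_sq hz0.le]
      rw [this, Real.sqrt_le_one]
      have : a * s / Fintype.card V * z ^ 2 = A * s / Fintype.card V := by rw [hA]; ring
      rw [this, div_le_one hn0]
      exact (mul_le_mul_of_nonneg_left hss hA0.le).trans hs₀
    have h1 := binPr_exists_inner_le hk hk0 hp0 hp1 hd1 hd hz (s := s) (by omega)
      ((D + 1) * (s - M)) ha rfl huz
    refine h1.trans ?_
    have h2 : 2 * Real.sqrt (a * s / Fintype.card V) / d ≤ 2 / (d * z) := by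
      rw [div_le_div_iff₀ hd1 (by positivity)]
      nlinarith
    have h3 : a * z ^ 3 * Real.sqrt (a * s / Fintype.card V) ≤ A := by
      calc _ = a * z ^ 2 * (Real.sqrt (a * s / Fintype.card V) * z) := by ring
        _ ≤ a * z ^ 2 * 1 := by gcongr
        _ = A := by rw [hA, mul_one]
    calc _ ≤ (z ^ ((D + 1) * M) * ((z ^ (D + 1))⁻¹) ^ s) * (Real.exp (d * (z - 1)) *
          (Real.exp 1 * A * Real.exp (Real.exp (2 / (d * z))))) ^ s := by
          gcongr
          exact inv_pow_mul_sub_le hz _ _ _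
      _ = z ^ ((D + 1) * M) * δ ^ s := by rw [hδ, mul_pow _ _ s]; ring
      _ ≤ z ^ ((D + 1) * M) * 0.945 ^ s := by
          gcongr
          exact hdel.trans (by norm_num)
      _ ≤ _ := by
          refine mul_le_mul_of_nonneg_left ?_ hLam0
          exact pow_le_pow_of_le_one (by norm_num) (by norm_num) hs1.le
  -- large sets
  have hbig : binPr K p (fun E => ∃ S ∈ (univ : Finset V).powersetCard s₀,
      0 ≤ ∑ v ∈ S, (E.filter fun e => v ∈ e ∧ 2 ≤ (e ∩ S).card).card ∧
      (D + 1) * (s₀ - M) ≤ ∑ v ∈ S, (E.filter fun e => v ∈ e).card) ≤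
      z ^ ((D + 1) * M) * 0.945 ^ s₁ := by
    refine (binPr_exists_degree_le hk hk0 hp0 hp1 hd1 hd hz (s := s₀) (by omega)
      ((D + 1) * (s₀ - M)) ha (by rwa [← hA]) hs₀').trans ?_
    calc _ ≤ (z ^ ((D + 1) * M) * ((z ^ (D + 1))⁻¹) ^ s₀) * (Real.exp (d * (z - 1)) *
          (Real.exp 1 * (1.05 * A) * Real.exp (Real.exp (2 / (d * z))))) ^ s₀ := by
          gcongr
          exact inv_pow_mul_sub_le hz _ _ _
      _ = z ^ ((D + 1) * M) * (1.05 * δ) ^ s₀ := by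
          have : 1.05 * δ = (z ^ (D + 1))⁻¹ * (Real.exp (d * (z - 1)) *
            (Real.exp 1 * (1.05 * A) * Real.exp (Real.exp (2 / (d * z))))) := by rw [hδ]; ring
          rw [this, mul_pow _ _ s₀]; ring
      _ ≤ z ^ ((D + 1) * M) * 0.945 ^ s₀ := by
          gcongr
          linarith
      _ ≤ _ := by
          refine mul_le_mul_of_nonneg_left ?_ hLam0
          exact pow_le_pow_of_le_one (by norm_num) (by norm_num) hs₁₀
  have hunion : Icc 1 s₀ = Icc 1 s₁ ∪ Ioc s₁ s₀ := by
    ext s; simp only [mem_union, mem_Icc, mem_Ioc]; omega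
  have hdisj : Disjoint (Icc 1 s₁) (Ioc s₁ s₀) := by
    rw [Finset.disjoint_left]; intro s; simp only [mem_Icc, mem_Ioc]; omega
  have hsum : binPr K p (fun E => ∃ s ∈ Icc 1 s₀, P s ((D + 1) * (s - M)) E) ≤
      2 * X + z ^ ((D + 1) * M) * (s₀ * 0.945 ^ s₁) := by
    refine (binPr_exists_le hp0 hp1 _ _).trans ?_
    rw [hunion, sum_union hdisj]
    refine add_le_add ((sum_le_sum hsmall).trans (sum_Icc_pow_le_two_mul hX0 hX _)) ?_
    refine (sum_le_sum hmid).trans ?_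
    rw [sum_const, Nat.card_Ioc, nsmul_eq_mul]
    have : ((s₀ - s₁ : ℕ) : ℝ) ≤ s₀ := by exact_mod_cast Nat.sub_le _ _
    calc _ ≤ (s₀:ℝ) * (z ^ ((D + 1) * M) * 0.945 ^ s₁) := by gcongr
      _ = _ := by ring
  calc _ ≤ binPr K p (fun E =>
        M ≤ ((univ : Finset V).filter fun v => InShortCycle E v).card ∨
        ((∃ s ∈ Icc 1 s₀, P s ((D + 1) * (s - M)) E) ∨
        ∃ S ∈ (univ : Finset V).powersetCard s₀,
          0 ≤ ∑ v ∈ S, (E.filter fun e => v ∈ e ∧ 2 ≤ (e ∩ S).card).card ∧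
          (D + 1) * (s₀ - M) ≤ ∑ v ∈ S, (E.filter fun e => v ∈ e).card)) := by
        refine binPr_mono hp0 hp1 fun E hE h => ?_
        by_cases hC : M ≤ ((univ : Finset V).filter fun v => InShortCycle E v).card
        · exact Or.inl hC
        · exact Or.inr (exists_bad_set (hdet E hE) h (not_le.1 hC))
    _ ≤ _ := binPr_or_le hp0 hp1 _ _
    _ ≤ _ := add_le_add hcyc (binPr_or_le hp0 hp1 _ _)
    _ ≤ _ := add_le_add le_rfl (add_le_add hsum hbig)
    _ = _ := by ring

end Total

section Asymptotics

lemma eventually_log_pow_le_sqrt (m : ℕ) {c : ℝ} (hc : 0 < c) :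
    ∀ᶠ n : ℕ in atTop, Real.log n ^ m ≤ c * Real.sqrt n := by
  have h := (isLittleO_log_rpow_rpow_atTop (m : ℝ) (show (0:ℝ) < 1 / 2 by norm_num)).bound hc
  filter_upwards [tendsto_natCast_atTop_atTop.eventually h, eventually_ge_atTop 1] with n hn h1
  have h1' : (1:ℝ) ≤ n := by exact_mod_cast h1
  rw [Real.rpow_natCast, Real.norm_of_nonneg (pow_nonneg (Real.log_nonneg h1') _),
    Real.norm_of_nonneg (by positivity), ← Real.sqrt_eq_rpow] at hn
  exact hn

lemma tendsto_log_natCast : Tendsto (fun n : ℕ => Real.log n) atTop atTop :=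
  Real.tendsto_log_atTop.comp tendsto_natCast_atTop_atTop

lemma tendsto_sqrt_natCast : Tendsto (fun n : ℕ => Real.sqrt n) atTop atTop :=
  Real.tendsto_sqrt_atTop.comp tendsto_natCast_atTop_atTop

set_option maxHeartbeats 1000000 in
/-- For polylogarithmic parameters satisfying the deterministic coloring criterion, the
failure probability is uniformly small. -/
lemma eventually_binPr_not_rchoosable_le {ε : ℝ} (hε : 0 < ε) :
    ∀ᶠ n : ℕ in atTop, ∀ (k r D : ℕ) (p d z : ℝ), 3 ≤ k → 1 ≤ d → (k:ℝ) ≤ Real.log n ^ 2 →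
      (D:ℝ) + 1 ≤ Real.log n ^ 2 → d ≤ Real.log n ^ 2 → 0 ≤ p → p ≤ 1 →
      p * (n.choose k * ((k : ℝ) / n)) ≤ d → 1 ≤ z → z ≤ 3 →
      (z ^ (D + 1))⁻¹ * (Real.exp (d * (z - 1)) * (Real.exp 1 * (d * k / 2 * z ^ 2) *
        Real.exp (Real.exp (2 / (d * z))))) ≤ 0.9 →
      (∀ E ⊆ (univ : Finset (Fin n)).powersetCard k, DegreeCriterion r D E) →
      binPr ((univ : Finset (Fin n)).powersetCard k) p (fun E => ¬ RChoosable r E) ≤ ε := by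
  set K₀ := Real.exp 1 * Real.exp (Real.exp 2) with hK₀
  have hK₀0 : 0 < K₀ := by positivity
  set η := min (1 / 2) (ε / 6) / K₀ with hη
  have hη0 : 0 < η := by positivity
  set c := min 0.005 (η ^ 2) with hc
  have hc0 : 0 < c := by
    rw [hc]; exact lt_min (by norm_num) (by positivity)
  have hexp : ∀ᶠ n : ℕ in atTop, Real.exp (0.055 - 0.025 * Real.sqrt n) ≤ ε / 3 := by
    have : Tendsto (fun n : ℕ => Real.exp (0.055 - 0.025 * Real.sqrt n)) atTop (nhds 0) := by
      refine Real.tendsto_exp_atBot.comp ?_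
      simp only [sub_eq_add_neg]
      exact tendsto_atBot_add_const_left _ _ (tendsto_neg_atTop_atBot.comp
        (tendsto_sqrt_natCast.const_mul_atTop (by norm_num)))
    exact (this.eventually (gt_mem_nhds (by positivity))).mono fun _ h => h.le
  filter_upwards [eventually_log_pow_le_sqrt 18 hc0, hexp,
    tendsto_log_natCast.eventually_ge_atTop (max 1 (6 / ε)),
    tendsto_sqrt_natCast.eventually_ge_atTop 21, eventually_ge_atTop 1] with
    n h18 hexp hlog h21 hn1
  intro k r D p d z hk hd1 hkl hDl hdl hp0 hp1 hd hz1 hz3 hdel hdet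
  set l := Real.log n with hl
  set q := Real.sqrt n with hq
  have hl1 : 1 ≤ l := (le_max_left _ _).trans hlog
  have hl6 : 6 / ε ≤ l := (le_max_right _ _).trans hlog
  have hl0 : 0 < l := by linarith
  have hq0 : 0 < q := by linarith
  have hn0 : (0:ℝ) < n := by exact_mod_cast hn1
  have hqq : q * q = n := Real.mul_self_sqrt hn0.le
  have hpow : ∀ m : ℕ, m ≤ 18 → l ^ m ≤ c * q := fun m hm =>
    (pow_le_pow_right₀ hl1 hm).trans h18
  have hc5 : c ≤ 0.005 := min_le_left _ _
  have hcq : c * q ≤ 0.005 * q := mul_le_mul_of_nonneg_right hc5 hq0.le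
  have hk3 : (3:ℝ) ≤ k := by exact_mod_cast hk
  have hkn : k ≤ n := by
    have : (k:ℝ) ≤ n := by
      have := hpow 2 (by norm_num)
      nlinarith
    exact_mod_cast this
  set a := d * k / 2 with ha
  set A := a * z ^ 2 with hA
  have ha1 : 1 ≤ a := by rw [ha]; nlinarith
  have hal : a ≤ l ^ 4 / 2 := by
    rw [ha]
    have : d * k ≤ l ^ 2 * l ^ 2 := by gcongr
    nlinarith
  have hA1 : 1 ≤ A := by
    rw [hA]; exact one_le_mul_of_one_le_of_one_le ha1 (one_le_pow₀ hz1)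
  have hA0 : 0 < A := by linarith
  have hAl : A ≤ q := by
    have h1 : A ≤ l ^ 4 / 2 * 3 ^ 2 := by rw [hA]; gcongr
    have := hpow 4 (by norm_num)
    linarith
  have hqA : q ≤ n / A := by
    rw [le_div_iff₀ hA0, ← hqq]; gcongr
  set s₀ := ⌊(n:ℝ) / A⌋₊ with hs₀
  set s₁ := ⌊q⌋₊ with hs₁
  have hs₀le : (s₀:ℝ) ≤ n / A := Nat.floor_le (by positivity)
  have hs₀lt : (n:ℝ) / A < s₀ + 1 := Nat.lt_floor_add_one _
  have hs₁le : (s₁:ℝ) ≤ q := Nat.floor_le hq0.le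
  have hs₁lt : q < s₁ + 1 := Nat.lt_floor_add_one _
  set M := ⌊l ^ 13⌋₊ + 1 with hM
  have hMge : l ^ 13 ≤ M := by rw [hM]; push_cast; exact (Nat.lt_floor_add_one _).le
  have hMle : (M:ℝ) ≤ l ^ 13 + 1 := by
    rw [hM]; push_cast
    have := Nat.floor_le (show 0 ≤ l ^ 13 by positivity)
    linarith
  have hX : K₀ * a * Real.sqrt (a * s₁ / n) ≤ min (1 / 2) (ε / 6) := by
    have h1 : a * Real.sqrt (a * s₁ / n) ≤ η := by
      have h2 : a * Real.sqrt (a * s₁ / n) = Real.sqrt (a ^ 2 * (a * s₁ / n)) := by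
        rw [Real.sqrt_mul (by positivity), Real.sqrt_sq (by linarith)]
      rw [h2, Real.sqrt_le_left hη0.le]
      refine le_trans ?_ (min_le_right 0.005 (η ^ 2))
      rw [← hc, ← mul_div_assoc, div_le_iff₀ hn0]
      have h3 : a ≤ l ^ 4 := by
        have : 0 ≤ l ^ 4 := by positivity
        linarith
      calc a ^ 2 * (a * s₁) ≤ (l ^ 4) ^ 2 * (l ^ 4 * q) := by gcongr
        _ = l ^ 12 * q := by ring
        _ ≤ c * q * q := by gcongr; exact hpow 12 (by norm_num)
        _ = c * n := by rw [mul_assoc, hqq]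
    calc K₀ * a * Real.sqrt (a * s₁ / n) = K₀ * (a * Real.sqrt (a * s₁ / n)) := by ring
      _ ≤ K₀ * η := by gcongr
      _ = _ := by rw [hη]; field_simp
  have hmain := binPr_not_rchoosable_le (V := Fin n) (k := k) (p := p) (d := d) (r := r)
    (D := D) (M := M) (s₀ := s₀) (s₁ := s₁) (a := a) (z := z) (A := A)
    (by rwa [Fintype.card_fin]) (by omega) hp0 hp1 hd1 (by rwa [Fintype.card_fin]) hz1 ha hA
    (by omega) (Nat.floor_pos.2 (by linarith)) (Nat.floor_le_floor hqA)
    (by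
      rw [Fintype.card_fin, mul_comm]
      exact (le_div_iff₀ hA0).1 hs₀le)
    (by
      rw [Fintype.card_fin]
      have : (n:ℝ) / A ≤ 1.05 * s₀ := by linarith
      rw [div_le_iff₀ hA0] at this
      linarith)
    (by rw [Fintype.card_fin]; exact hX.trans (min_le_left _ _)) hdel hdet
  rw [Fintype.card_fin] at hmain
  refine hmain.trans ?_
  have hM0 : (0:ℝ) < M := by positivity
  have e1 : ((d * k) ^ 2 + (d * k) ^ 3) / M ≤ ε / 3 := by
    have h1 : d * k ≤ l ^ 4 := by
      have : d * k ≤ l ^ 2 * l ^ 2 := by gcongr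
      nlinarith
    rw [div_le_iff₀ hM0]
    have h2 : (l ^ 4) ^ 2 ≤ (l ^ 4) ^ 3 := pow_le_pow_right₀ (one_le_pow₀ hl1) (by norm_num)
    have h3 : 6 ≤ l * ε := (div_le_iff₀ hε).1 hl6
    calc (d * k) ^ 2 + (d * k) ^ 3 ≤ (l ^ 4) ^ 2 + (l ^ 4) ^ 3 := by gcongr
      _ ≤ 2 * l ^ 12 := by
        have : (l ^ 4) ^ 3 = l ^ 12 := by ring
        linarith
      _ ≤ l * ε / 3 * l ^ 12 := by
        refine mul_le_mul_of_nonneg_right ?_ (by positivity)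
        linarith
      _ = ε / 3 * l ^ 13 := by ring
      _ ≤ _ := by gcongr
  have e2 : 2 * (K₀ * a * Real.sqrt (a * s₁ / n)) ≤ ε / 3 := by
    have := hX.trans (min_le_right _ _)
    linarith
  have e3 : z ^ ((D + 1) * M) * ((s₀ + 1) * 0.945 ^ s₁) ≤ ε / 3 := by
    refine le_trans ?_ hexp
    have h1 : z ^ ((D + 1) * M) ≤ Real.exp (4 * l ^ 15) := by
      have h3 : (3:ℝ) ≤ Real.exp 2 := by
        have := Real.add_one_le_exp (2:ℝ)
        linarith
      calc z ^ ((D + 1) * M) ≤ (Real.exp 2) ^ ((D + 1) * M) := by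
            gcongr; exact hz3.trans h3
        _ = Real.exp (((D:ℝ) + 1) * M * 2) := by
            rw [← Real.exp_nat_mul]; push_cast; ring_nf
        _ ≤ _ := by
            refine Real.exp_le_exp.2 ?_
            have h4 : (M:ℝ) ≤ 2 * l ^ 13 := by
              have : 1 ≤ l ^ 13 := one_le_pow₀ hl1
              linarith
            calc ((D:ℝ) + 1) * M * 2 ≤ l ^ 2 * (2 * l ^ 13) * 2 := by gcongr
              _ = _ := by ring
    have h2 : (s₀:ℝ) + 1 ≤ Real.exp (2 * l ^ 15) := by
      have h3 : (s₀:ℝ) ≤ n := hs₀le.trans (div_le_self hn0.le hA1)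
      have h4 : (1:ℝ) ≤ n := by exact_mod_cast hn1
      have h5 : (2:ℝ) ≤ Real.exp 1 := by
        have := Real.add_one_le_exp (1:ℝ)
        linarith
      calc (s₀:ℝ) + 1 ≤ 2 * n := by linarith
        _ ≤ Real.exp 1 * Real.exp l := by
          rw [hl, Real.exp_log hn0]; gcongr
        _ = Real.exp (1 + l) := (Real.exp_add _ _).symm
        _ ≤ _ := by
          refine Real.exp_le_exp.2 ?_
          have : l ^ 1 ≤ l ^ 15 := pow_le_pow_right₀ hl1 (by norm_num)
          have : 1 ≤ l ^ 15 := one_le_pow₀ hl1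
          linarith
    have h3 : (0.945:ℝ) ^ s₁ ≤ Real.exp (-0.055 * (q - 1)) := by
      have h4 : (0.945:ℝ) ≤ Real.exp (-0.055) := by
        have := Real.add_one_le_exp (-0.055:ℝ)
        linarith
      calc (0.945:ℝ) ^ s₁ ≤ (Real.exp (-0.055)) ^ s₁ := by gcongr
        _ = Real.exp (s₁ * (-0.055)) := (Real.exp_nat_mul _ _).symm
        _ ≤ _ := by
          refine Real.exp_le_exp.2 ?_
          linarith
    calc z ^ ((D + 1) * M) * ((s₀ + 1) * 0.945 ^ s₁) ≤
          Real.exp (4 * l ^ 15) * (Real.exp (2 * l ^ 15) * Real.exp (-0.055 * (q - 1))) := by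
          gcongr
      _ = Real.exp (4 * l ^ 15 + (2 * l ^ 15 + -0.055 * (q - 1))) := by
          rw [Real.exp_add, Real.exp_add]
      _ ≤ _ := by
          refine Real.exp_le_exp.2 ?_
          have := hpow 15 (by norm_num)
          linarith
  linarith

end Asymptotics

section Criterion

lemma degreeCriterion_of_numeric {V : Type*} [Fintype V] [Nonempty V] {E : Finset (Finset V)}
    {k r D ρ : ℕ} (hk : 3 ≤ k) (hr : 3 ≤ r) (hE : ∀ e ∈ E, e.card = k) (hρ : D ≤ ρ * (k - 1))
    {β L₀ T g x y : ℝ} (hβ : 0 < β) (hβ1 : β ≤ 1) (hL₀ : 1 ≤ L₀) (hL₀' : β * r / (r - 1) ≤ L₀)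
    (hT : T = (β⁻¹ / r) ^ (k - 1)) (hg : g = ρ * (L₀ * T)) (hx : D * T ≤ x) (hy : g ≤ y)
    (hnum : x * ((1 + y) ^ k - 1 + y ^ (k - 1)) +
      x ^ 2 * L₀ * ((1 + y) ^ (k - 1) + y ^ (k - 2)) ≤ 1 - β) :
    DegreeCriterion r D E := by
  intro S h1 h2 h3
  have hT0 : 0 ≤ T := by rw [hT]; positivity
  have hg0 : 0 ≤ g := by rw [hg]; positivity
  have hDT : 0 ≤ D * T := by positivity
  have hx0 : 0 ≤ x := hDT.trans hx
  refine rchoosable_of_structure hk hr hE S h1 h2 h3 hρ hβ hβ1 hL₀ hL₀' hT hg ?_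
  refine le_trans ?_ hnum
  have h4 : 0 ≤ (1 + g) ^ k - 1 + g ^ (k - 1) := by
    have : 1 ≤ (1 + g) ^ k := one_le_pow₀ (by linarith)
    have : 0 ≤ g ^ (k - 1) := by positivity
    linarith
  gcongr

lemma degreeCriterion_floor {V : Type*} [Fintype V] [Nonempty V] {E : Finset (Finset V)}
    {k r : ℕ} (hk : 3 ≤ k) (hr : 3 ≤ r) (hE : ∀ e ∈ E, e.card = k)
    {α β L₀ B w q x y : ℝ} (hα : 0 < α) (hβ : 0 < β) (hβ1 : β ≤ 1) (hL₀ : 1 ≤ L₀)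
    (hL₀' : β * r / (r - 1) ≤ L₀) (hB : (β⁻¹) ^ (k - 1) ≤ B) (hw : 0 < w) (hwk : w ≤ Real.sqrt k)
    (hq : 0 < q) (hqr : q ≤ (r:ℝ) ^ (k - 1)) (hx : α * B / w ≤ x)
    (hy : L₀ * B * (α / (w * (k - 1)) + (k - 2) / (k - 1) / q) ≤ y)
    (hnum : x * ((1 + y) ^ k - 1 + y ^ (k - 1)) +
      x ^ 2 * L₀ * ((1 + y) ^ (k - 1) + y ^ (k - 2)) ≤ 1 - β) :
    DegreeCriterion r ⌊α * ((r:ℝ) ^ (k - 1) / Real.sqrt k)⌋₊ E := by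
  set R := (r:ℝ) ^ (k - 1) / Real.sqrt k with hR
  have hk0 : (3:ℝ) ≤ k := by exact_mod_cast hk
  have hr0 : (3:ℝ) ≤ r := by exact_mod_cast hr
  have hQ : 0 < (r:ℝ) ^ (k - 1) := by positivity
  have hsq : 0 < Real.sqrt k := by positivity
  have hR0 : 0 < R := by positivity
  have hB0 : 0 < B := lt_of_lt_of_le (by positivity) hB
  set D := ⌊α * R⌋₊ with hD
  have hDle : (D:ℝ) ≤ α * R := Nat.floor_le (by positivity)
  obtain ⟨j, hj⟩ : ∃ j, k = j + 2 := ⟨k - 2, by omega⟩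
  have hj1 : k - 1 = j + 1 := by omega
  have hjk : (k:ℝ) - 1 = j + 1 := by rw [hj]; push_cast; ring
  have hjk2 : (k:ℝ) - 2 = j := by rw [hj]; push_cast; ring
  have hT : (β⁻¹ / r) ^ (k - 1) ≤ B / (r:ℝ) ^ (k - 1) := by
    rw [div_pow]; gcongr
  refine degreeCriterion_of_numeric (ρ := (D + j) / (j + 1)) hk hr hE ?_ hβ hβ1 hL₀ hL₀' rfl rfl
    ?_ ?_ hnum
  · rw [hj1]
    have h1 := Nat.div_add_mod (D + j) (j + 1)
    have h2 := Nat.mod_lt (D + j) (Nat.succ_pos j)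
    have h3 : (D + j) / (j + 1) * (j + 1) = (j + 1) * ((D + j) / (j + 1)) := mul_comm _ _
    rw [Nat.succ_eq_add_one] at h2
    omega
  · refine le_trans ?_ hx
    calc (D:ℝ) * (β⁻¹ / r) ^ (k - 1) ≤ α * R * (B / (r:ℝ) ^ (k - 1)) := by gcongr
      _ = α * B / Real.sqrt k := by rw [hR]; field_simp
      _ ≤ α * B / w := by gcongr
  · refine le_trans ?_ hy
    have h1 : (((D + j) / (j + 1) : ℕ) : ℝ) ≤ (α * R + j) / (j + 1) := by
      refine Nat.cast_div_le.trans ?_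
      push_cast
      gcongr
    rw [hjk, hjk2]
    calc _ ≤ (α * R + j) / (j + 1) * (L₀ * (B / (r:ℝ) ^ (k - 1))) := by gcongr
      _ = L₀ * B * (α / (Real.sqrt k * (j + 1)) + j / (j + 1) / (r:ℝ) ^ (k - 1)) := by
        rw [hR]; field_simp
      _ ≤ _ := by gcongr

lemma mul_exp_neg_le {a x x₀ : ℝ} (hx₀ : 0 < x₀) (hx : x₀ ≤ x) (ha : 1 ≤ a * x₀) :
    x * Real.exp (-(a * x)) ≤ x₀ * Real.exp (-(a * x₀)) := by
  have h1 : Real.exp (-(a * x₀)) = Real.exp (-(a * x)) * Real.exp (a * (x - x₀)) := by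
    rw [← Real.exp_add]; ring_nf
  rw [h1]
  have h2 := Real.add_one_le_exp (a * (x - x₀))
  have h3 : x ≤ x₀ * (a * (x - x₀) + 1) := by nlinarith
  have h4 : x ≤ x₀ * Real.exp (a * (x - x₀)) := h3.trans (by gcongr)
  calc x * Real.exp (-(a * x)) ≤ x₀ * Real.exp (a * (x - x₀)) * Real.exp (-(a * x)) := by gcongr
    _ = _ := by ring

lemma exp_exp_le {y : ℝ} (hy : y ≤ 0.0832) : Real.exp (Real.exp y) ≤ 2.99 := by
  have h1 : Real.exp y ≤ 1 / (1 - 0.0832) :=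
    (Real.exp_le_exp.2 hy).trans
      (Real.exp_bound_div_one_sub_of_interval (by norm_num) (by norm_num))
  have h2 : Real.exp y ≤ 1 + 0.0908 := h1.trans (by norm_num)
  have h3 : Real.exp 0.0908 ≤ 1 / (1 - 0.0908) :=
    Real.exp_bound_div_one_sub_of_interval (by norm_num) (by norm_num)
  calc Real.exp (Real.exp y) ≤ Real.exp (1 + 0.0908) := Real.exp_le_exp.2 h2
    _ = Real.exp 1 * Real.exp 0.0908 := Real.exp_add _ _
    _ ≤ 2.7182818286 * (1 / (1 - 0.0908)) :=
      mul_le_mul Real.exp_one_lt_d9.le h3 (Real.exp_nonneg _) (by norm_num)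
    _ ≤ _ := by norm_num

/-- Bound for the growth rate in the first moment estimate. -/
lemma growth_le {k D : ℕ} {R d z α γ c : ℝ} (hR : 108 ≤ R) (hd : d = 3 * R / 32)
    (hz : 2.1 ≤ z) (hD : α * R ≤ D + 1) (hγ : 0 ≤ γ) (hzγ : Real.exp γ ≤ z)
    (hc : c ≤ α * γ - 3 * (z - 1) / 32) (hyz : 64 / (3 * R * z) ≤ 0.0832)
    (hfin : k * (z ^ 2 * (R * Real.exp (-(c * R)))) ≤ 2.36) :
    (z ^ (D + 1))⁻¹ * (Real.exp (d * (z - 1)) * (Real.exp 1 * (d * k / 2 * z ^ 2) *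
        Real.exp (Real.exp (2 / (d * z))))) ≤ 0.9 := by
  have hR0 : 0 < R := by linarith
  have hz0 : 0 < z := by linarith
  have hd0 : 0 < d := by rw [hd]; positivity
  have h1 : (z ^ (D + 1))⁻¹ ≤ Real.exp (-(α * γ * R)) := by
    rw [Real.exp_neg]
    refine inv_anti₀ (Real.exp_pos _) ?_
    calc Real.exp (α * γ * R) ≤ Real.exp (((D + 1 : ℕ) : ℝ) * γ) := by
          refine Real.exp_le_exp.2 ?_
          push_cast
          nlinarith
      _ = Real.exp γ ^ (D + 1) := Real.exp_nat_mul _ _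
      _ ≤ _ := by gcongr
  have h2 : 2 / (d * z) ≤ 0.0832 := by
    have : 2 / (d * z) = 64 / (3 * R * z) := by rw [hd]; field_simp; norm_num
    rwa [this]
  have h3 : Real.exp (-(α * γ * R)) * Real.exp (d * (z - 1)) ≤ Real.exp (-(c * R)) := by
    rw [← Real.exp_add]
    refine Real.exp_le_exp.2 ?_
    rw [hd]
    nlinarith
  calc _ ≤ Real.exp (-(α * γ * R)) * (Real.exp (d * (z - 1)) *
        (2.7182818286 * (d * k / 2 * z ^ 2) * 2.99)) := by
        gcongr
        · exact Real.exp_one_lt_d9.le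
        · exact exp_exp_le h2
    _ = Real.exp (-(α * γ * R)) * Real.exp (d * (z - 1)) *
        (2.7182818286 * (d * k / 2 * z ^ 2) * 2.99) := by ring
    _ ≤ Real.exp (-(c * R)) * (2.7182818286 * (d * k / 2 * z ^ 2) * 2.99) := by gcongr
    _ = k * (z ^ 2 * (R * Real.exp (-(c * R)))) * (2.7182818286 * 2.99 * 3 / 64) := by
        rw [hd]; ring
    _ ≤ 2.36 * (2.7182818286 * 2.99 * 3 / 64) := by gcongr
    _ ≤ _ := by norm_num

end Criterion

section Parameters

/-- A degree threshold and an exponential tilt adapted to `k` and `r` exist. -/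
def HasThreshold (k r : ℕ) : Prop :=
  ∃ (D : ℕ) (R d z : ℝ), R = (r:ℝ) ^ (k - 1) / Real.sqrt k ∧ d = 3 * R / 32 ∧
    99 ≤ R ∧ (D:ℝ) + 1 ≤ R ∧ 1 ≤ z ∧ z ≤ 3 ∧
    (z ^ (D + 1))⁻¹ * (Real.exp (d * (z - 1)) * (Real.exp 1 * (d * k / 2 * z ^ 2) *
        Real.exp (Real.exp (2 / (d * z))))) ≤ 0.9 ∧
    ∀ n : ℕ, 0 < n → ∀ E ⊆ (univ : Finset (Fin n)).powersetCard k, DegreeCriterion r D E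

lemma hasThreshold_of_bounds {k r : ℕ} (hk : 3 ≤ k) (hr : 3 ≤ r)
    {α β L₀ B w q x y R z γ c : ℝ} (hRdef : R = (r:ℝ) ^ (k - 1) / Real.sqrt k) (hR : 108 ≤ R)
    (hα : 0 < α) (hα1 : α ≤ 1 / 2) (hβ : 0 < β) (hβ1 : β ≤ 1) (hL₀ : 1 ≤ L₀)
    (hL₀' : β * r / (r - 1) ≤ L₀) (hB : (β⁻¹) ^ (k - 1) ≤ B) (hw : 0 < w) (hwk : w ≤ Real.sqrt k)
    (hq : 0 < q) (hqr : q ≤ (r:ℝ) ^ (k - 1)) (hx : α * B / w ≤ x)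
    (hy : L₀ * B * (α / (w * (k - 1)) + (k - 2) / (k - 1) / q) ≤ y)
    (hnum : x * ((1 + y) ^ k - 1 + y ^ (k - 1)) +
      x ^ 2 * L₀ * ((1 + y) ^ (k - 1) + y ^ (k - 2)) ≤ 1 - β)
    (hz : 2.1 ≤ z) (hz3 : z ≤ 3) (hγ : 0 ≤ γ) (hzγ : Real.exp γ ≤ z)
    (hc : c ≤ α * γ - 3 * (z - 1) / 32) (hyz : 64 / (3 * R * z) ≤ 0.0832)
    (hfin : k * (z ^ 2 * (R * Real.exp (-(c * R)))) ≤ 2.36) : HasThreshold k r := by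
  have h0 : 0 ≤ α * R := by nlinarith
  have hDle := Nat.floor_le h0
  refine ⟨⌊α * R⌋₊, R, 3 * R / 32, z, hRdef, rfl, by linarith, ?_, by linarith, hz3,
    growth_le hR rfl hz (Nat.lt_floor_add_one _).le hγ hzγ hc hyz hfin, fun n hn E hE => ?_⟩
  · nlinarith
  · have : Nonempty (Fin n) := ⟨⟨0, hn⟩⟩
    rw [hRdef]
    exact degreeCriterion_floor hk hr (fun e he => (mem_powersetCard.1 (hE he)).2) hα hβ hβ1 hL₀
      hL₀' hB hw hwk hq hqr hx hy hnum

lemma div_pred_le {r r₀ : ℝ} (hr₀ : 1 < r₀) (h : r₀ ≤ r) {β L : ℝ} (hβ : 0 ≤ β)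
    (hL : β * r₀ ≤ L * (r₀ - 1)) : β * r / (r - 1) ≤ L := by
  have h1 : β ≤ L := by
    by_contra! hlt
    nlinarith
  rw [div_le_iff₀ (by linarith)]
  nlinarith

lemma exp_le_of_pow_le {a b : ℕ} (hb : b ≠ 0) {γ z : ℝ} (hz : 0 ≤ z) (hγ : b * γ = a)
    (h : (2.7182818286:ℝ) ^ a ≤ z ^ b) : Real.exp γ ≤ z := by
  refine le_of_pow_le_pow_left₀ hb hz ?_
  rw [← Real.exp_nat_mul, hγ, ← mul_one (a:ℝ), Real.exp_nat_mul]
  exact (pow_le_pow_left₀ (Real.exp_nonneg _) Real.exp_one_lt_d9.le _).trans h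

lemma exp_neg_le_inv {m : ℕ} {x y : ℝ} (hy : 0 ≤ y) (hx : x = m + y) :
    Real.exp (-x) ≤ ((2.718:ℝ) ^ m * (1 + y + y ^ 2 / 2))⁻¹ := by
  rw [Real.exp_neg, hx, Real.exp_add, ← mul_one (m:ℝ), Real.exp_nat_mul]
  have h1 := Real.quadratic_le_exp_of_nonneg hy
  have h2 : (2.718:ℝ) ≤ Real.exp 1 := by
    have := Real.exp_one_gt_d9
    linarith
  gcongr

lemma sqrt_natCast_le {k : ℕ} {b : ℝ} (hb : 0 ≤ b) (h : (k:ℝ) ≤ b ^ 2) : Real.sqrt k ≤ b := by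
  rwa [Real.sqrt_le_left hb]

lemma le_sqrt_natCast {k : ℕ} {b : ℝ} (h : b ^ 2 ≤ (k:ℝ)) : b ≤ Real.sqrt k :=
  Real.le_sqrt_of_sq_le h

/-- The tilt `z = 12 / 5` with threshold `9 R / 40`. -/
lemma hasThreshold_of_bounds' {k r r₀ : ℕ} (hk : 3 ≤ k) (hr₀ : 3 ≤ r₀) (hr : r₀ ≤ r)
    {L₀ B w u x y R₀ : ℝ} (hB : ((1 - 1 / (2 * (k:ℝ)))⁻¹) ^ (k - 1) ≤ B)
    (hL₀ : 1 ≤ L₀) (hL₀' : (1 - 1 / (2 * (k:ℝ))) * r₀ ≤ L₀ * (r₀ - 1))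
    (hw : 0 < w) (hwk : w ^ 2 ≤ k) (hu : 0 < u) (hku : k ≤ u ^ 2)
    (hR₀ : 108 ≤ R₀) (hR₀' : R₀ * u ≤ (r₀:ℝ) ^ (k - 1)) (hx : 0.225 * B / w ≤ x)
    (hy : L₀ * B * (0.225 / (w * (k - 1)) + (k - 2) / (k - 1) / (r₀:ℝ) ^ (k - 1)) ≤ y)
    (hnum : x * ((1 + y) ^ k - 1 + y ^ (k - 1)) +
      x ^ 2 * L₀ * ((1 + y) ^ (k - 1) + y ^ (k - 2)) ≤ 1 / (2 * k))
    (hfin : k * (5.76 * (R₀ * Real.exp (-(0.065625 * R₀)))) ≤ 2.36) : HasThreshold k r := by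
  have hk0 : (3:ℝ) ≤ k := by exact_mod_cast hk
  have hr0 : (3:ℝ) ≤ r₀ := by exact_mod_cast hr₀
  have hrr : (r₀:ℝ) ≤ r := by exact_mod_cast hr
  have hpow : (r₀:ℝ) ^ (k - 1) ≤ (r:ℝ) ^ (k - 1) := by gcongr
  have hsq : 0 < Real.sqrt k := by positivity
  have hR : R₀ ≤ (r:ℝ) ^ (k - 1) / Real.sqrt k := by
    rw [le_div_iff₀ hsq]
    calc R₀ * Real.sqrt k ≤ R₀ * u := by
          gcongr
          exact sqrt_natCast_le hu.le hku
      _ ≤ _ := hR₀'.trans hpow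
  have h2k : 1 / (2 * (k:ℝ)) ≤ 1 / 2 := by
    rw [div_le_div_iff₀ (by positivity) (by norm_num)]; linarith
  have h2k0 : 0 < 1 / (2 * (k:ℝ)) := by positivity
  refine hasThreshold_of_bounds (α := 0.225) (β := 1 - 1 / (2 * k)) (L₀ := L₀) (B := B) (w := w)
    (q := (r₀:ℝ) ^ (k - 1)) (x := x) (y := y) (z := 2.4) (γ := 0.875) (c := 0.065625)
    hk (hr₀.trans hr) rfl (hR₀.trans hR) (by norm_num) (by norm_num) (by linarith) (by linarith)
    hL₀ (div_pred_le (by linarith) hrr (by linarith) hL₀') hB hw (le_sqrt_natCast hwk)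
    (by positivity) hpow hx hy (by linarith) (by norm_num) (by norm_num) (by norm_num) ?_
    (by norm_num) ?_ ?_
  · exact exp_le_of_pow_le (a := 7) (b := 8) (by norm_num) (by norm_num) (by norm_num)
      (by norm_num)
  · have h1 := hR₀.trans hR
    rw [div_le_iff₀ (by positivity)]
    linarith
  · refine le_trans ?_ hfin
    have := mul_exp_neg_le (a := 0.065625) (by linarith) hR (by linarith)
    norm_num at this ⊢
    gcongr

lemma hasThreshold_three {r : ℕ} (hr : 14 ≤ r) : HasThreshold 3 r := by
  refine hasThreshold_of_bounds' (r₀ := 14) (L₀ := 1) (B := 1.44) (w := 1.732) (u := 1.7321)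
    (x := 0.1871) (y := 0.0976) (R₀ := 113) (by norm_num) (by norm_num) hr (by norm_num) le_rfl
    (by norm_num) (by norm_num) (by norm_num) (by norm_num) (by norm_num) (by norm_num)
    (by norm_num) (by norm_num) (by norm_num) (by norm_num) ?_
  have := exp_neg_le_inv (m := 7) (x := 0.065625 * 113) (y := 0.415625) (by norm_num)
    (by norm_num)
  norm_num at this ⊢
  linarith

lemma hasThreshold_four {r : ℕ} (hr : 6 ≤ r) : HasThreshold 4 r := by
  refine hasThreshold_of_bounds' (r₀ := 6) (L₀ := 1.05) (B := 1.4928) (w := 2) (u := 2)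
    (x := 0.16794) (y := 0.0637) (R₀ := 108) (by norm_num) (by norm_num) hr (by norm_num)
    (by norm_num)
    (by norm_num) (by norm_num) (by norm_num) (by norm_num) (by norm_num) (by norm_num)
    (by norm_num) (by norm_num) (by norm_num) (by norm_num) ?_
  have := exp_neg_le_inv (m := 7) (x := 0.065625 * 108) (y := 0.0875) (by norm_num)
    (by norm_num)
  norm_num at this ⊢
  linarith

lemma hasThreshold_five {r : ℕ} (hr : 4 ≤ r) : HasThreshold 5 r := by
  refine hasThreshold_of_bounds' (r₀ := 4) (L₀ := 1.2) (B := 1.5242) (w := 2.236) (u := 2.2361)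
    (x := 0.1534) (y := 0.0515) (R₀ := 114) (by norm_num) (by norm_num) hr (by norm_num)
    (by norm_num)
    (by norm_num) (by norm_num) (by norm_num) (by norm_num) (by norm_num) (by norm_num)
    (by norm_num) (by norm_num) (by norm_num) (by norm_num) ?_
  have := exp_neg_le_inv (m := 7) (x := 0.065625 * 114) (y := 0.48125) (by norm_num)
    (by norm_num)
  norm_num at this ⊢
  linarith

lemma hasThreshold_six {r : ℕ} (hr : 4 ≤ r) : HasThreshold 6 r := by
  refine hasThreshold_of_bounds' (r₀ := 4) (L₀ := 1.2223) (B := 1.5451) (w := 2.449) (u := 2.4495)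
    (x := 0.142) (y := 0.0363) (R₀ := 120) (by norm_num) (by norm_num) hr (by norm_num)
    (by norm_num)
    (by norm_num) (by norm_num) (by norm_num) (by norm_num) (by norm_num) (by norm_num)
    (by norm_num) (by norm_num) (by norm_num) (by norm_num) ?_
  have := exp_neg_le_inv (m := 7) (x := 0.065625 * 120) (y := 0.875) (by norm_num)
    (by norm_num)
  norm_num at this ⊢
  linarith

end Parameters

section Parameters

lemma hasThreshold_six_three : HasThreshold 6 3 := by
  have h1 : (2.449:ℝ) ≤ Real.sqrt (6:ℕ) := le_sqrt_natCast (by norm_num)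
  have h2 : Real.sqrt (6:ℕ) ≤ 2.4495 := sqrt_natCast_le (by norm_num) (by norm_num)
  obtain ⟨R, hR⟩ : ∃ R, R = ((3:ℕ):ℝ) ^ (6 - 1) / Real.sqrt (6:ℕ) := ⟨_, rfl⟩
  have hR1 : 99.2 ≤ R := by
    rw [hR, le_div_iff₀ (by positivity)]
    norm_num at h2 ⊢
    linarith
  have hR2 : R ≤ 99.23 := by
    rw [hR, div_le_iff₀ (by positivity)]
    norm_num at h1 ⊢
    linarith
  refine ⟨23, R, 3 * R / 32, 2.5, hR, rfl, by linarith, by norm_num; linarith, by norm_num,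
    by norm_num, ?_, fun n hn E hE => ?_⟩
  · have hd1 : 9.299 ≤ 3 * R / 32 := by linarith
    have hd2 : 3 * R / 32 ≤ 9.303 := by linarith
    generalize 3 * R / 32 = d at hd1 hd2
    have hd0 : 0 < d := by linarith
    have e1 : Real.exp (d * (2.5 - 1)) ≤ 2.7182818286 ^ 14 := by
      calc Real.exp (d * (2.5 - 1)) ≤ Real.exp ((14:ℕ) * 1) := by
            refine Real.exp_le_exp.2 ?_
            push_cast
            linarith
        _ = Real.exp 1 ^ 14 := Real.exp_nat_mul _ _
        _ ≤ _ := pow_le_pow_left₀ (Real.exp_nonneg _) Real.exp_one_lt_d9.le _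
    have e2 : 2 / (d * 2.5) ≤ 0.0861 := by
      rw [div_le_iff₀ (by positivity)]; linarith
    have e3 : Real.exp (2 / (d * 2.5)) ≤ 1 + 0.0943 :=
      ((Real.exp_le_exp.2 e2).trans
        (Real.exp_bound_div_one_sub_of_interval (by norm_num) (by norm_num))).trans (by norm_num)
    have e4 : Real.exp (Real.exp (2 / (d * 2.5))) ≤ 3.002 := by
      calc _ ≤ Real.exp (1 + 0.0943) := Real.exp_le_exp.2 e3
        _ = Real.exp 1 * Real.exp 0.0943 := Real.exp_add _ _
        _ ≤ 2.7182818286 * (1 / (1 - 0.0943)) :=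
          mul_le_mul Real.exp_one_lt_d9.le
            (Real.exp_bound_div_one_sub_of_interval (by norm_num) (by norm_num))
            (Real.exp_nonneg _) (by norm_num)
        _ ≤ _ := by norm_num
    calc _ ≤ ((2.5:ℝ) ^ (23 + 1))⁻¹ * (2.7182818286 ^ 14 *
          (2.7182818286 * (9.303 * (6:ℕ) / 2 * 2.5 ^ 2) * 3.002)) := by
          gcongr
          exact Real.exp_one_lt_d9.le
      _ ≤ _ := by norm_num
  · have : Nonempty (Fin n) := ⟨⟨0, hn⟩⟩
    refine degreeCriterion_of_numeric (ρ := 5) (β := 0.92375) (L₀ := 1.3857)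
      (x := 23 * ((0.92375⁻¹ / 3) ^ 5)) (y := 5 * (1.3857 * ((0.92375⁻¹ / 3) ^ 5)))
      (by norm_num) le_rfl (fun e he => (mem_powersetCard.1 (hE he)).2) (by norm_num)
      (by norm_num) (by norm_num) (by norm_num) (by norm_num) rfl rfl (by norm_num) (by norm_num)
      (by norm_num)

lemma mul_cube_le_nine_pow {k : ℕ} (hk : 7 ≤ k) : 1521 * k ^ 3 ≤ 9 ^ (k - 1) := by
  induction k, hk using Nat.le_induction with
  | base => norm_num
  | succ k hk ih =>
    have h1 : k + 1 - 1 = (k - 1) + 1 := by omega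
    rw [h1, pow_succ 9]
    have : (k + 1) ^ 3 ≤ 9 * k ^ 3 := by
      calc (k + 1) ^ 3 ≤ (2 * k) ^ 3 := by gcongr; omega
        _ = 8 * k ^ 3 := by ring
        _ ≤ _ := by gcongr; norm_num
    omega

lemma inv_one_sub_pow_sq_le {k : ℕ} (hk : 1 ≤ k) :
    (((1 - 1 / (2 * (k:ℝ)))⁻¹) ^ (k - 1)) ^ 2 ≤ Real.exp 1 := by
  have hk0 : (1:ℝ) ≤ k := by exact_mod_cast hk
  have h1 : (1 - 1 / (2 * (k:ℝ)))⁻¹ = 1 / (2 * k - 1) + 1 := by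
    have : (2 * (k:ℝ) - 1) ≠ 0 := by linarith
    field_simp
    ring
  have hk2 : ((k - 1 : ℕ) : ℝ) = k - 1 := by push_cast [hk]; ring
  calc (((1 - 1 / (2 * (k:ℝ)))⁻¹) ^ (k - 1)) ^ 2 ≤
        (Real.exp (1 / (2 * k - 1)) ^ (k - 1)) ^ 2 := by
        have h0 : 0 < (2 * (k:ℝ) - 1) := by linarith
        rw [h1]
        gcongr
        exact Real.add_one_le_exp _
    _ = Real.exp (2 * (k - 1) / (2 * k - 1)) := by
        rw [← Real.exp_nat_mul, ← Real.exp_nat_mul, hk2]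
        congr 1
        push_cast
        ring
    _ ≤ _ := by
        refine Real.exp_le_exp.2 ?_
        rw [div_le_one (by linarith)]
        linarith

set_option maxHeartbeats 1000000 in
lemma hasThreshold_of_seven_le {k r : ℕ} (hk : 7 ≤ k) (hr : 3 ≤ r) : HasThreshold k r := by
  have hk0 : (7:ℝ) ≤ k := by exact_mod_cast hk
  have hr0 : (3:ℝ) ≤ r := by exact_mod_cast hr
  obtain ⟨w, hw⟩ : ∃ w, w = Real.sqrt k := ⟨_, rfl⟩
  have hw1 : 2.645 ≤ w := by rw [hw]; exact le_sqrt_natCast (by norm_num; linarith)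
  have hw0 : 0 < w := by linarith
  have hw2 : w ^ 2 = k := by rw [hw, Real.sq_sqrt (by positivity)]
  obtain ⟨Q, hQ⟩ : ∃ Q, Q = (r:ℝ) ^ (k - 1) := ⟨_, rfl⟩
  have hQ0 : 0 < Q := by rw [hQ]; positivity
  have hQ1 : 39 * (k * w) ≤ Q := by
    refine le_of_sq_le_sq ?_ hQ0.le
    calc (39 * (k * w)) ^ 2 = 1521 * (k:ℝ) ^ 3 := by rw [← hw2]; ring
      _ ≤ 9 ^ (k - 1) := by exact_mod_cast mul_cube_le_nine_pow hk
      _ = ((3:ℝ) ^ (k - 1)) ^ 2 := by rw [← pow_mul, mul_comm, pow_mul]; norm_num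
      _ ≤ Q ^ 2 := by rw [hQ]; gcongr
  obtain ⟨R, hR⟩ : ∃ R, R = Q / w := ⟨_, rfl⟩
  have hR1 : 39 * k ≤ R := by
    rw [hR, le_div_iff₀ hw0]; linarith
  have hR0 : 273 ≤ R := by linarith
  obtain ⟨B, hB⟩ : ∃ B, B = ((1 - 1 / (2 * (k:ℝ)))⁻¹) ^ (k - 1) := ⟨_, rfl⟩
  have h2k : 1 / (2 * (k:ℝ)) ≤ 1 / 2 := by
    rw [div_le_div_iff₀ (by positivity) (by norm_num)]; linarith
  have h2k0 : 0 < 1 / (2 * (k:ℝ)) := by positivity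
  have hB0 : 0 < B := by
    rw [hB]
    have : 0 < 1 - 1 / (2 * (k:ℝ)) := by linarith
    positivity
  have hB2 : B ^ 2 ≤ 2.71829 := by
    rw [hB]
    have := Real.exp_one_lt_d9
    exact (inv_one_sub_pow_sq_le (by omega)).trans (by linarith)
  have hB1 : B ≤ 1.6488 := by nlinarith
  obtain ⟨y, hy⟩ : ∃ y, y = 3 / 2 * B * (0.2 / (w * (k - 1)) + (k - 2) / (k - 1) / Q) := ⟨_, rfl⟩
  have hk1 : 0 < (k:ℝ) - 1 := by linarith
  have hk2 : 0 < (k:ℝ) - 2 := by linarith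
  have hy0 : 0 < y := by rw [hy]; positivity
  have hyw : w * (k * y) ≤ 0.3885 * B := by
    have e1 : 0.2 / (w * (k - 1)) ≤ 0.2 * (7 / 6) / (w * k) := by
      rw [div_le_div_iff₀ (by positivity) (by positivity)]
      nlinarith
    have e2 : ((k:ℝ) - 2) / (k - 1) / Q ≤ 1 / 39 / (w * k) := by
      have : ((k:ℝ) - 2) / (k - 1) ≤ 1 := by rw [div_le_one hk1]; linarith
      calc ((k:ℝ) - 2) / (k - 1) / Q ≤ 1 / (39 * (k * w)) := by gcongr
        _ = _ := by field_simp
    calc w * (k * y) ≤ w * (k * (3 / 2 * B * (0.2 * (7 / 6) / (w * k) + 1 / 39 / (w * k)))) := by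
          rw [hy]; gcongr
      _ = (3 / 2 * (0.2 * (7 / 6) + 1 / 39)) * B := by field_simp
      _ ≤ _ := by gcongr; norm_num
  have hs : k * y ≤ 0.2425 := by
    have : 2.645 * (k * y) ≤ w * (k * y) := by gcongr
    linarith
  have hy1 : y ≤ 0.035 := by
    have : 7 * y ≤ k * y := by gcongr
    linarith
  have hE : Real.exp (k * y) ≤ 1.275 := by
    refine (Real.exp_le_exp.2 hs).trans ?_
    refine le_of_pow_le_pow_left₀ (n := 4) (by norm_num) (by norm_num) ?_
    rw [← Real.exp_nat_mul]
    have : ((4:ℕ):ℝ) * 0.2425 = 1 + -0.03 := by norm_num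
    rw [this, Real.exp_add, Real.exp_neg]
    have h3 := Real.add_one_le_exp (0.03:ℝ)
    calc Real.exp 1 * (Real.exp 0.03)⁻¹ ≤ 2.7182818286 * (0.03 + 1)⁻¹ := by
          gcongr
          exact Real.exp_one_lt_d9.le
      _ ≤ _ := by norm_num
  have hpk : (1 + y) ^ k ≤ Real.exp (k * y) := by
    rw [Real.exp_nat_mul]
    gcongr
    linarith [Real.add_one_le_exp y]
  have hpk1 : (1 + y) ^ k - 1 ≤ k * y * 1.275 := by
    have h4 := Real.add_one_le_exp (-(k * y))
    have h5 : Real.exp (k * y) * Real.exp (-(k * y)) = 1 := by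
      rw [← Real.exp_add, add_neg_cancel, Real.exp_zero]
    have h6 := mul_le_mul_of_nonneg_left h4 (Real.exp_nonneg (k * y))
    have h7 : Real.exp (k * y) * (k * y) ≤ 1.275 * (k * y) := by gcongr
    nlinarith
  have hpk2 : (1 + y) ^ (k - 1) ≤ 1.275 :=
    (pow_le_pow_right₀ (by linarith) (Nat.sub_le _ _)).trans (hpk.trans hE)
  have hyk1 : y ^ (k - 1) ≤ y ^ 2 := pow_le_pow_of_le_one hy0.le (by linarith) (by omega)
  have hyk2 : y ^ (k - 2) ≤ y := by
    calc y ^ (k - 2) ≤ y ^ 1 := pow_le_pow_of_le_one hy0.le (by linarith) (by omega)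
      _ = y := pow_one y
  have hnum : 0.2 * B / w * ((1 + y) ^ k - 1 + y ^ (k - 1)) +
      (0.2 * B / w) ^ 2 * (3 / 2) * ((1 + y) ^ (k - 1) + y ^ (k - 2)) ≤ 1 / (2 * k) := by
    have e1 : 0.2 * B / w * ((1 + y) ^ k - 1 + y ^ (k - 1)) +
        (0.2 * B / w) ^ 2 * (3 / 2) * ((1 + y) ^ (k - 1) + y ^ (k - 2)) ≤
        0.2 * B / w * (k * y * 1.275 + y ^ 2) +
        (0.2 * B / w) ^ 2 * (3 / 2) * (1.275 + y) := by gcongr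
    refine e1.trans ?_
    rw [le_div_iff₀ (by positivity)]
    have e2 : (0.2 * B / w * (k * y * 1.275 + y ^ 2) +
        (0.2 * B / w) ^ 2 * (3 / 2) * (1.275 + y)) * (2 * k) =
        0.4 * B * (w * (k * y)) * 1.275 + 0.4 * B * (w * y) * y + 0.12 * B ^ 2 * (1.275 + y)
        := by
      rw [← hw2]; field_simp; ring
    rw [e2]
    have e3 : 0.4 * B * (w * (k * y)) ≤ 0.4 * B * (0.3885 * B) := by gcongr
    have e3' : 0.4 * B * (0.3885 * B) = 0.1554 * B ^ 2 := by ring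
    have e4 : 0.4 * B * (w * (k * y)) ≤ 0.4225 := by linarith
    have e5 : 0.4 * B * (w * y) * y ≤ 0.4225 * 0.035 := by
      have : y ≤ k * y := by nlinarith
      have : 0.4 * B * (w * y) ≤ 0.4 * B * (w * (k * y)) := by gcongr
      exact mul_le_mul (this.trans e4) hy1 hy0.le (by norm_num)
    have e6 : 0.12 * B ^ 2 * (1.275 + y) ≤ 0.12 * 2.71829 * (1.275 + 0.035) := by gcongr
    linarith
  refine hasThreshold_of_bounds (α := 0.2) (β := 1 - 1 / (2 * k)) (L₀ := 3 / 2) (B := B) (w := w)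
    (q := Q) (x := 0.2 * B / w) (y := y) (z := 2.1) (γ := 0.74) (c := 0.044875) (R := R)
    (by omega) hr (by rw [hR, hQ, hw]) (by linarith) (by norm_num) (by norm_num) (by linarith)
    (by linarith)
    (by norm_num) (div_pred_le (r₀ := 3) (by norm_num) hr0 (by linarith) (by linarith)) hB.ge hw0
    hw.le hQ0 hQ.le le_rfl hy.ge (by linarith) le_rfl (by norm_num) (by norm_num) ?_
    (by norm_num) ?_ ?_
  · exact exp_le_of_pow_le (a := 37) (b := 50) (by norm_num) (by norm_num) (by norm_num)
      (by norm_num)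
  · rw [div_le_iff₀ (by positivity)]
    linarith
  · have h1 := mul_exp_neg_le (a := 0.0224375) (by norm_num) hR0 (by norm_num)
    have h2 := exp_neg_le_inv (m := 6) (x := 0.0224375 * 273) (y := 0.1254375) (by norm_num)
      (by norm_num)
    have h3 : R * Real.exp (-(0.0224375 * R)) ≤ 0.61 := by
      refine h1.trans ((mul_le_mul_of_nonneg_left h2 (by norm_num)).trans ?_)
      norm_num
    have h4 : Real.exp (-(0.044875 * R)) = Real.exp (-(0.0224375 * R)) ^ 2 := by
      rw [← Real.exp_nat_mul]; congr 1; push_cast; ring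
    have hkR : (k:ℝ) ≤ R / 39 := by linarith
    rw [h4]
    calc (k:ℝ) * (2.1 ^ 2 * (R * Real.exp (-(0.0224375 * R)) ^ 2)) ≤
          R / 39 * (2.1 ^ 2 * (R * Real.exp (-(0.0224375 * R)) ^ 2)) := by gcongr
      _ = 2.1 ^ 2 / 39 * (R * Real.exp (-(0.0224375 * R))) ^ 2 := by ring
      _ ≤ 2.1 ^ 2 / 39 * 0.61 ^ 2 := by gcongr
      _ ≤ _ := by norm_num

end Parameters

section EdgeProbability

lemma edgeProb_mul_le {n k : ℕ} {p Q : ℝ} (hk : 0 < k) (hkn : k ≤ n)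
    (hp : p ≤ (3 / 32 : ℝ) * (Q / (k : ℝ) ^ ((3 : ℝ) / 2)) * ((n : ℝ) / (n.choose k : ℝ))) :
    p * (n.choose k * ((k : ℝ) / n)) ≤ 3 * (Q / Real.sqrt k) / 32 := by
  have hk0 : (0:ℝ) < k := by exact_mod_cast hk
  have hn0 : (0:ℝ) < n := by exact_mod_cast hk.trans_le hkn
  have hC : (0:ℝ) < n.choose k := by exact_mod_cast Nat.choose_pos hkn
  have hs : 0 < Real.sqrt k := by positivity
  have h1 : (k:ℝ) ^ ((3:ℝ) / 2) = k * Real.sqrt k := by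
    rw [Real.sqrt_eq_rpow, show (3:ℝ) / 2 = 1 + 1 / 2 by norm_num, Real.rpow_add hk0,
      Real.rpow_one]
  rw [h1] at hp
  calc p * (n.choose k * ((k : ℝ) / n)) ≤
        (3 / 32 : ℝ) * (Q / (k * Real.sqrt k)) * ((n : ℝ) / (n.choose k : ℝ)) *
          (n.choose k * ((k : ℝ) / n)) := by gcongr
    _ = _ := by field_simp

lemma edgeProb_le_one {n k : ℕ} {p d : ℝ} (hk : 2 ≤ k) (hkn : k ≤ n) (hp0 : 0 ≤ p)
    (hd : p * (n.choose k * ((k : ℝ) / n)) ≤ d) (hdk : d * k ≤ n) : p ≤ 1 := by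
  have hk0 : (0:ℝ) < k := by exact_mod_cast (by omega : 0 < k)
  have hn0 : (0:ℝ) < n := by exact_mod_cast (by omega : 0 < n)
  have h1 : (1:ℝ) ≤ (n - 2).choose (k - 2) := by
    exact_mod_cast Nat.choose_pos (by omega : k - 2 ≤ n - 2)
  have h2 := h1.trans (choose_sub_sub_le hkn 2 hk)
  calc p ≤ p * (n.choose k * ((k : ℝ) / n) ^ 2) := le_mul_of_one_le_right hp0 h2
    _ = p * (n.choose k * ((k : ℝ) / n)) * (k / n) := by ring
    _ ≤ d * (k / n) := by gcongr
    _ = d * k / n := by ring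
    _ ≤ 1 := by rwa [div_le_one hn0]

lemma cube_le_nine_pow {k : ℕ} (hk : 3 ≤ k) : k ^ 3 ≤ 9 ^ (k - 1) := by
  induction k, hk using Nat.le_induction with
  | base => norm_num
  | succ k hk ih =>
    have h1 : k + 1 - 1 = (k - 1) + 1 := by omega
    rw [h1, pow_succ 9]
    have : (k + 1) ^ 3 ≤ 9 * k ^ 3 := by
      calc (k + 1) ^ 3 ≤ (2 * k) ^ 3 := by gcongr; omega
        _ = 8 * k ^ 3 := by ring
        _ ≤ _ := by gcongr; norm_num
    omega

lemma natCast_le_pow_div_sqrt {k r : ℕ} (hk : 3 ≤ k) (hr : 3 ≤ r) :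
    (k:ℝ) ≤ (r:ℝ) ^ (k - 1) / Real.sqrt k := by
  have hr0 : (3:ℝ) ≤ r := by exact_mod_cast hr
  have hk0 : (0:ℝ) < k := by exact_mod_cast (by omega : 0 < k)
  have hs : 0 < Real.sqrt k := by positivity
  rw [le_div_iff₀ hs]
  refine le_of_sq_le_sq ?_ (by positivity)
  calc ((k:ℝ) * Real.sqrt k) ^ 2 = (k:ℝ) ^ 3 := by
        rw [mul_pow, Real.sq_sqrt hk0.le]; ring
    _ ≤ 9 ^ (k - 1) := by exact_mod_cast cube_le_nine_pow hk
    _ = ((3:ℝ) ^ (k - 1)) ^ 2 := by rw [← pow_mul, mul_comm, pow_mul]; norm_num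
    _ ≤ _ := by gcongr

lemma eventually_not_rchoosable_of_hasThreshold {ε : ℝ} (hε : 0 < ε) :
    ∀ᶠ n : ℕ in atTop, ∀ (k r : ℕ) (p : ℝ), 3 ≤ k → 3 ≤ r → HasThreshold k r →
      (r:ℝ) ^ (k - 1) / Real.sqrt k ≤ 43 * Real.log n → 0 ≤ p →
      p ≤ (3 / 32 : ℝ) * ((r:ℝ) ^ (k - 1) / (k : ℝ) ^ ((3 : ℝ) / 2)) *
        ((n : ℝ) / (n.choose k : ℝ)) →
      p ≤ 1 ∧
      binPr ((univ : Finset (Fin n)).powersetCard k) p (fun E => ¬ RChoosable r E) ≤ ε := by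
  filter_upwards [eventually_binPr_not_rchoosable_le hε, eventually_log_pow_le_sqrt 4 one_pos,
    tendsto_log_natCast.eventually_ge_atTop 43, eventually_ge_atTop 1] with n hn h4 h43 hn1
  intro k r p hk hr hthr hRl hp0 hp
  obtain ⟨D, R, d, z, hR, hd, hR99, hDR, hz1, hz3, hdel, hcrit⟩ := hthr
  have hkR := natCast_le_pow_div_sqrt hk hr
  rw [← hR] at hRl hkR
  have hn1' : (1:ℝ) ≤ n := by exact_mod_cast hn1
  have hRL : R ≤ Real.log n ^ 2 := hRl.trans (by nlinarith)
  have hL1 : 1 ≤ Real.log n := by linarith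
  have hsq : Real.sqrt n ≤ n := by
    rw [Real.sqrt_le_left (by linarith)]; nlinarith
  have hL2 : Real.log n ^ 2 * Real.log n ^ 2 ≤ n := by
    calc _ = Real.log n ^ 4 := by ring
      _ ≤ _ := h4
      _ ≤ _ := by linarith
  have hL0 : 1 ≤ Real.log n ^ 2 := one_le_pow₀ hL1
  have hkn : k ≤ n := by
    have : (k:ℝ) ≤ n := by nlinarith
    exact_mod_cast this
  have hdl : d ≤ Real.log n ^ 2 := by linarith
  have hd' : p * (n.choose k * ((k : ℝ) / n)) ≤ d := by
    rw [hd, hR]; exact edgeProb_mul_le (by omega) hkn hp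
  have hp1 : p ≤ 1 := by
    refine edgeProb_le_one (by omega) hkn hp0 hd' (le_trans ?_ hL2)
    have : (0:ℝ) ≤ k := by positivity
    exact mul_le_mul hdl (hkR.trans hRL) this (by linarith)
  exact ⟨hp1, hn k r D p d z hk (by linarith) (hkR.trans hRL) (hDR.trans hRL) hdl hp0 hp1 hd' hz1
    hz3 hdel (hcrit n hn1)⟩

end EdgeProbability

lemma prod_ite_subset {V : Type*} (E : Finset (Finset V)) (S : Finset V) (a b : ℝ) :
    ∏ e ∈ E, (if e ⊆ S then a else b) =
      a ^ (E.filter fun e => e ⊆ S).card * b ^ (E.card - (E.filter fun e => e ⊆ S).card) := by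
  rw [prod_ite, prod_const, prod_const]
  congr 2
  have := card_filter_add_card_filter_not (s := E) (fun e => e ⊆ S)
  omega

section SubsetCount

variable {V : Type*} [Fintype V] {k : ℕ} {p : ℝ}

lemma exists_dense_subset {E : Finset (Finset V)} {r ρ : ℕ} [Nonempty V]
    (hE : ∀ e ∈ E, 2 ≤ e.card) (hr : 2 * ρ < r) (h : ¬ RChoosable r E) :
    ∃ S : Finset V, 1 ≤ S.card ∧ ρ * S.card ≤ (E.filter fun e => e ⊆ S).card := by
  by_contra! hcon
  refine h (rchoosable_of_hall hE (fun F hF => ?_) hr)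
  rcases F.eq_empty_or_nonempty with rfl | ⟨e, he⟩
  · simp
  · have h1 : 1 ≤ (F.biUnion id).card := by
      have h2 : e ⊆ F.biUnion id := subset_biUnion_of_mem id he
      have := card_le_card h2
      have := hE e (hF he)
      omega
    have h3 : F ⊆ E.filter fun e => e ⊆ F.biUnion id := fun f hf =>
      mem_filter.2 ⟨hF hf, subset_biUnion_of_mem id hf⟩
    exact (card_le_card h3).trans (hcon _ h1).le

lemma card_powersetCard_filter_subset (S : Finset V) (k : ℕ) :
    (((univ : Finset V).powersetCard k).filter fun e => e ⊆ S).card = S.card.choose k := by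
  rw [← card_powersetCard]
  congr 1
  ext e
  simp only [mem_filter, mem_powersetCard]
  exact ⟨fun h => ⟨h.2, h.1.2⟩, fun h => ⟨⟨subset_univ _, h.2⟩, h.1⟩⟩

lemma sum_ite_sub_one (S : Finset V) (k : ℕ) (a b : ℝ) :
    ∑ e ∈ (univ : Finset V).powersetCard k, ((if e ⊆ S then a else b) - 1) =
      (a - b) * S.card.choose k + (b - 1) * (Fintype.card V).choose k := by
  have h : ∀ e : Finset V, (if e ⊆ S then a else b) - 1 =
      (if e ⊆ S then a - b else 0) + (b - 1) := by
    intro e; split_ifs <;> ring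
  simp only [h]
  rw [sum_add_distrib, ← sum_filter, sum_const, sum_const, card_powersetCard_filter_subset,
    card_powersetCard, card_univ, nsmul_eq_mul, nsmul_eq_mul]
  ring

lemma binPr_le_card (hp0 : 0 ≤ p) (hp1 : p ≤ 1) {c : ℝ}
    (hc : p * (Fintype.card V).choose k ≤ c * Fintype.card V) {y : ℝ} (hy : 1 ≤ y) (M : ℕ) :
    binPr ((univ : Finset V).powersetCard k) p (fun E => M ≤ E.card) ≤
      (y ^ M)⁻¹ * Real.exp (c * Fintype.card V * (y - 1)) := by
  have hy0 : 0 < y := by linarith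
  refine (binPr_le_of_prod hp0 hp1 _ (fun _ => y) (fun _ _ => hy0.le)
    (B := (y ^ M)⁻¹) (by positivity) fun E _ hE => ?_).trans ?_
  · rw [prod_const, inv_mul_eq_div, one_le_div (by positivity)]
    exact pow_le_pow_right₀ hy hE
  · rw [sum_const, card_powersetCard, card_univ, nsmul_eq_mul]
    refine mul_le_mul_of_nonneg_left (Real.exp_le_exp.2 ?_) (by positivity)
    calc p * ((Fintype.card V).choose k * (y - 1)) = p * (Fintype.card V).choose k * (y - 1) := by
          ring
      _ ≤ _ := mul_le_mul_of_nonneg_right hc (by linarith)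

lemma binPr_le_card_filter_subset (hV : 0 < Fintype.card V) (hp0 : 0 ≤ p) (hp1 : p ≤ 1) {c : ℝ}
    (hc : p * (Fintype.card V).choose k ≤ c * Fintype.card V) {X : ℝ} (hX : 1 ≤ X) (t : ℕ)
    (S : Finset V) :
    binPr ((univ : Finset V).powersetCard k) p (fun E => t ≤ (E.filter fun e => e ⊆ S).card) ≤
      (X ^ t)⁻¹ * Real.exp (c * Fintype.card V * (X * ((S.card : ℝ) / Fintype.card V) ^ k)) := by
  have hX0 : 0 < X := by linarith
  refine (binPr_le_of_prod hp0 hp1 _ (fun e => if e ⊆ S then X else 1)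
    (fun e _ => by split_ifs <;> positivity)
    (B := (X ^ t)⁻¹) (by positivity) fun E _ hE => ?_).trans ?_
  · rw [prod_ite_subset, one_pow, mul_one, inv_mul_eq_div, one_le_div (by positivity)]
    exact pow_le_pow_right₀ hX hE
  · rw [sum_ite_sub_one, sub_self, zero_mul, add_zero]
    refine mul_le_mul_of_nonneg_left (Real.exp_le_exp.2 ?_) (by positivity)
    have h1 := choose_le_choose_mul_pow (card_le_univ S) hV k
    calc p * ((X - 1) * S.card.choose k) ≤
          p * (X * ((Fintype.card V).choose k * ((S.card : ℝ) / Fintype.card V) ^ k)) := by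
          gcongr
          linarith
      _ = p * (Fintype.card V).choose k * (X * ((S.card : ℝ) / Fintype.card V) ^ k) := by ring
      _ ≤ _ := by gcongr

lemma binPr_le_card_filter_subset_and_card_le (hV : 0 < Fintype.card V) (hp0 : 0 ≤ p)
    (hp1 : p ≤ 1) {q : ℝ} (hq0 : 0 < q) (hq1 : q < 1) {t M : ℕ} (htM : t ≤ M)
    (S : Finset V) (hS : 0 < S.card) :
    binPr ((univ : Finset V).powersetCard k) p
      (fun E => t ≤ (E.filter fun e => e ⊆ S).card ∧ E.card ≤ M) ≤
      ((q * (((S.card : ℝ) / Fintype.card V) ^ k)⁻¹) ^ t)⁻¹ * ((1 - q) ^ (M - t))⁻¹ := by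
  have hV0 : (0:ℝ) < Fintype.card V := by exact_mod_cast hV
  have hS0 : (0:ℝ) < S.card := by exact_mod_cast hS
  set σ := (S.card : ℝ) / Fintype.card V with hσ
  have hσ0 : 0 < σ := by positivity
  have hq' : 0 < 1 - q := by linarith
  have hqq : 0 < q * (σ ^ k)⁻¹ := by positivity
  have hσ1 : σ ≤ 1 := by
    rw [hσ, div_le_one hV0]; exact_mod_cast card_le_univ S
  have hone : 1 ≤ (σ ^ k)⁻¹ := (one_le_inv₀ (by positivity)).2 (pow_le_one₀ hσ0.le hσ1)
  have hY1 : 1 ≤ 1 - q + q * (σ ^ k)⁻¹ := by nlinarith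
  have hY0 : 0 < 1 - q + q * (σ ^ k)⁻¹ := by linarith
  refine (binPr_le_of_prod hp0 hp1 _
    (fun e => if e ⊆ S then 1 - q + q * (σ ^ k)⁻¹ else 1 - q)
    (fun e _ => by split_ifs <;> linarith)
    (B := ((q * (σ ^ k)⁻¹) ^ t)⁻¹ * ((1 - q) ^ (M - t))⁻¹) (by positivity)
    fun E _ hE => ?_).trans ?_
  · obtain ⟨h1, h2⟩ := hE
    rw [prod_ite_subset, ← mul_inv, inv_mul_eq_div, one_le_div (by positivity)]
    refine mul_le_mul ?_ ?_ (by positivity) (by positivity)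
    · calc (q * (σ ^ k)⁻¹) ^ t ≤ (1 - q + q * (σ ^ k)⁻¹) ^ t := by
            gcongr; linarith
        _ ≤ _ := pow_le_pow_right₀ hY1 h1
    · exact pow_le_pow_of_le_one hq'.le (by linarith) (by omega)
  · have h1 := choose_le_choose_mul_pow (card_le_univ S) hV k
    refine mul_le_of_le_one_right (by positivity) ?_
    rw [Real.exp_le_one_iff, sum_ite_sub_one]
    refine mul_nonpos_of_nonneg_of_nonpos hp0 ?_
    have h2 : (σ ^ k)⁻¹ * S.card.choose k ≤ (Fintype.card V).choose k := by
      rw [inv_mul_le_iff₀ (by positivity), mul_comm]; exact h1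
    have h3 := mul_le_mul_of_nonneg_left h2 hq0.le
    linarith

lemma choose_mul_pow_le_one (n s : ℕ) (hs : s ≤ n) {x : ℝ} (hx0 : 0 < x) (hx1 : x < 1) :
    (n.choose s : ℝ) ≤ (x ^ s * (1 - x) ^ (n - s))⁻¹ := by
  have hx' : 0 < 1 - x := by linarith
  have h := add_pow x (1 - x) n
  rw [add_sub_cancel, one_pow] at h
  have h2 : x ^ s * (1 - x) ^ (n - s) * n.choose s ≤
      ∑ m ∈ range (n + 1), x ^ m * (1 - x) ^ (n - m) * n.choose m :=
    single_le_sum (f := fun m => x ^ m * (1 - x) ^ (n - m) * (n.choose m : ℝ))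
      (fun m _ => by positivity) (mem_range.2 (by omega))
  rw [← h] at h2
  rw [le_inv_comm₀, ← one_div, le_div_iff₀]
  · linarith
  · exact_mod_cast Nat.choose_pos hs
  · exact_mod_cast Nat.choose_pos hs
  · positivity

/-- First moment bound for small dense subsets. -/
lemma binPr_exists_dense_le (hV : 0 < Fintype.card V) (hp0 : 0 ≤ p) (hp1 : p ≤ 1) {c : ℝ}
    (hc0 : 0 < c) (hk : 2 ≤ k) (hc : p * (Fintype.card V).choose k ≤ c * Fintype.card V)
    {ρ s : ℕ} (hρ : 1 ≤ ρ) (hcρ : c ≤ ρ) (hs : 0 < s) (hsV : s ≤ Fintype.card V) :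
    binPr ((univ : Finset V).powersetCard k) p (fun E =>
      ∃ S ∈ (univ : Finset V).powersetCard s, ρ * s ≤ (E.filter fun e => e ⊆ S).card) ≤
      (Real.exp (1 + ρ) * (c / ρ) ^ ρ * ((s:ℝ) / Fintype.card V) ^ (ρ * (k - 1) - 1)) ^ s := by
  have hV0 : (0:ℝ) < Fintype.card V := by exact_mod_cast hV
  have hs0 : (0:ℝ) < s := by exact_mod_cast hs
  have hρ0 : (0:ℝ) < ρ := by exact_mod_cast hρ
  set σ := (s : ℝ) / Fintype.card V with hσ
  have hσ0 : 0 < σ := by positivity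
  have hσ1 : σ ≤ 1 := by
    rw [hσ, div_le_one hV0]; exact_mod_cast hsV
  have hX : 1 ≤ ρ / (c * σ ^ (k - 1)) := by
    rw [one_le_div (by positivity)]
    calc c * σ ^ (k - 1) ≤ c * 1 := by gcongr; exact pow_le_one₀ hσ0.le hσ1
      _ ≤ ρ := by linarith
  obtain ⟨j, hj⟩ : ∃ j, k = j + 1 := ⟨k - 1, by omega⟩
  obtain ⟨i, hi⟩ : ∃ i, ρ * (k - 1) = i + 1 := by
    have : 1 * 1 ≤ ρ * (k - 1) := Nat.mul_le_mul hρ (by omega)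
    exact ⟨ρ * (k - 1) - 1, by omega⟩
  refine (binPr_exists_le_card_mul hp0 hp1 _ _ (((ρ / (c * σ ^ (k - 1))) ^ (ρ * s))⁻¹ *
    Real.exp ((s:ℝ) * ρ)) fun S hS => ?_).trans ?_
  · have hS' := (mem_powersetCard.1 hS).2
    refine (binPr_le_card_filter_subset hV hp0 hp1 hc hX (ρ * s) S).trans ?_
    rw [hS', ← hσ]
    have : c * Fintype.card V * (ρ / (c * σ ^ (k - 1)) * σ ^ k) = s * ρ := by
      have h2 : σ ^ k = σ ^ (k - 1) * σ := by
        rw [hj, Nat.add_sub_cancel, pow_succ]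
      rw [h2]
      have h3 : (Fintype.card V : ℝ) * σ = s := by rw [hσ]; field_simp
      calc _ = (Fintype.card V : ℝ) * σ * ρ := by field_simp
        _ = _ := by rw [h3]
    rw [this]
  · rw [card_powersetCard, card_univ]
    calc _ ≤ (Real.exp 1 * (Fintype.card V / s)) ^ s *
          (((ρ / (c * σ ^ (k - 1))) ^ (ρ * s))⁻¹ * Real.exp ((s:ℝ) * ρ)) :=
          mul_le_mul_of_nonneg_right (choose_le_exp_mul_pow _ _ hs) (by positivity)
      _ = (Real.exp 1 * Real.exp ρ * (σ⁻¹ * ((c * σ ^ (k - 1) / ρ)) ^ ρ)) ^ s := by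
          rw [Real.exp_nat_mul, pow_mul, ← inv_pow, ← inv_pow, inv_div, hσ, inv_div]
          simp only [mul_pow]
          ring
      _ = _ := by
          congr 1
          rw [Real.exp_add, hi, Nat.add_sub_cancel]
          have : (c * σ ^ (k - 1) / ρ) ^ ρ = (c / ρ) ^ ρ * (σ ^ i * σ) := by
            rw [← pow_succ, ← hi, mul_comm ρ, pow_mul, ← mul_pow]; ring
          rw [this]
          field_simp

/-- First moment bound for linear-sized dense subsets, conditioned on few edges. -/
lemma binPr_exists_dense_and_card_le (hV : 0 < Fintype.card V) (hp0 : 0 ≤ p) (hp1 : p ≤ 1)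
    {ρ s M : ℕ} (hs : 0 < s) (hsV : s ≤ Fintype.card V) (hsM : ρ * s ≤ M) {m : ℝ}
    (hM : (M:ℝ) ≤ m * Fintype.card V) {σ : ℝ} (hσ : σ = (s:ℝ) / Fintype.card V) :
    binPr ((univ : Finset V).powersetCard k) p (fun E =>
      ∃ S ∈ (univ : Finset V).powersetCard s,
        ρ * s ≤ (E.filter fun e => e ⊆ S).card ∧ E.card ≤ M) ≤
      Real.exp (Fintype.card V * (σ * Real.log (5 / 3) + (1 - σ) * Real.log (5 / 2) +
        ρ * σ * Real.log (5 / 4) + k * ρ * (σ * Real.log σ) + (m - ρ * σ) * Real.log 5)) := by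
  have hV0 : (0:ℝ) < Fintype.card V := by exact_mod_cast hV
  have hs0 : (0:ℝ) < s := by exact_mod_cast hs
  have hσ0 : 0 < σ := by rw [hσ]; positivity
  have hsσ : (s:ℝ) = Fintype.card V * σ := by rw [hσ]; field_simp
  refine (binPr_exists_le_card_mul hp0 hp1 _ _ (((0.8 * (σ ^ k)⁻¹) ^ (ρ * s))⁻¹ *
    ((1 - 0.8) ^ (M - ρ * s))⁻¹) fun S hS => ?_).trans ?_
  · have hS' := (mem_powersetCard.1 hS).2
    have := binPr_le_card_filter_subset_and_card_le (k := k) hV hp0 hp1 (q := 0.8) (by norm_num)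
      (by norm_num) hsM S (by omega)
    rwa [hS', ← hσ] at this
  · rw [card_powersetCard, card_univ]
    have h1 := choose_mul_pow_le_one (Fintype.card V) s hsV (x := 0.6) (by norm_num) (by norm_num)
    have e1 : ((0.6:ℝ) ^ s * (1 - 0.6) ^ (Fintype.card V - s))⁻¹ =
        Real.exp (Fintype.card V * (σ * Real.log (5 / 3) + (1 - σ) * Real.log (5 / 2))) := by
      have : Fintype.card V * (σ * Real.log (5 / 3) + (1 - σ) * Real.log (5 / 2)) =
          s * Real.log (5 / 3) + ((Fintype.card V - s : ℕ) : ℝ) * Real.log (5 / 2) := by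
        rw [Nat.cast_sub hsV, hsσ]; ring
      rw [this, Real.exp_add, Real.exp_nat_mul, Real.exp_nat_mul, Real.exp_log (by norm_num),
        Real.exp_log (by norm_num), mul_inv, ← inv_pow, ← inv_pow]
      norm_num
    have e2 : ((0.8 * (σ ^ k)⁻¹) ^ (ρ * s))⁻¹ =
        Real.exp (Fintype.card V * (ρ * σ * Real.log (5 / 4) + k * ρ * (σ * Real.log σ))) := by
      have : Fintype.card V * (ρ * σ * Real.log (5 / 4) + k * ρ * (σ * Real.log σ)) =
          ((ρ * s : ℕ) : ℝ) * (Real.log (5 / 4) + k * Real.log σ) := by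
        push_cast
        rw [hsσ]; ring
      rw [this, Real.exp_nat_mul, Real.exp_add, Real.exp_nat_mul, Real.exp_log (by norm_num),
        Real.exp_log hσ0, ← inv_pow, mul_inv, inv_inv]
      norm_num
    have e3 : (((1 - 0.8 : ℝ)) ^ (M - ρ * s))⁻¹ ≤
        Real.exp (Fintype.card V * ((m - ρ * σ) * Real.log 5)) := by
      have h5 : 0 ≤ Real.log 5 := Real.log_nonneg (by norm_num)
      calc (((1 - 0.8 : ℝ)) ^ (M - ρ * s))⁻¹ = 5 ^ (M - ρ * s) := by
            rw [← inv_pow]; norm_num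
        _ = Real.exp (((M - ρ * s : ℕ) : ℝ) * Real.log 5) := by
            rw [Real.exp_nat_mul, Real.exp_log (by norm_num)]
        _ ≤ _ := by
            refine Real.exp_le_exp.2 ?_
            rw [← mul_assoc]
            refine mul_le_mul_of_nonneg_right ?_ h5
            rw [Nat.cast_sub hsM, Nat.cast_mul, hsσ]
            linarith
    calc _ ≤ Real.exp (Fintype.card V * (σ * Real.log (5 / 3) + (1 - σ) * Real.log (5 / 2))) *
          (Real.exp (Fintype.card V * (ρ * σ * Real.log (5 / 4) + k * ρ * (σ * Real.log σ))) *
          Real.exp (Fintype.card V * ((m - ρ * σ) * Real.log 5))) := by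
          rw [← e1, ← e2]
          gcongr
      _ = _ := by
          rw [← Real.exp_add, ← Real.exp_add]
          congr 1
          ring

end SubsetCount

/-- The exponential rate in the first moment bound for linear-sized dense subsets. -/
noncomputable def denseRate (k ρ : ℕ) (m σ : ℝ) : ℝ :=
  σ * Real.log (5 / 3) + (1 - σ) * Real.log (5 / 2) +
    ρ * σ * Real.log (5 / 4) + k * ρ * (σ * Real.log σ) + (m - ρ * σ) * Real.log 5

lemma binPr_not_rchoosable_le_sum_dense {V : Type*} [Fintype V] [Nonempty V] {k r ρ : ℕ} {p : ℝ}
    (hk : 2 ≤ k) (hr : 2 * ρ < r) (hp0 : 0 ≤ p) (hp1 : p ≤ 1) (M : ℕ) {B : ℕ → ℝ}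
    (hB : ∀ s ∈ Icc 1 (Fintype.card V), binPr ((univ : Finset V).powersetCard k) p (fun E =>
      ∃ S ∈ (univ : Finset V).powersetCard s,
        ρ * s ≤ (E.filter fun e => e ⊆ S).card ∧ E.card ≤ M) ≤ B s) :
    binPr ((univ : Finset V).powersetCard k) p (fun E => ¬ RChoosable r E) ≤
      binPr ((univ : Finset V).powersetCard k) p (fun E => M ≤ E.card) +
        ∑ s ∈ Icc 1 (Fintype.card V), B s := by
  refine (binPr_mono hp0 hp1 (Q := fun E => M ≤ E.card ∨
    ∃ s ∈ Icc 1 (Fintype.card V), ∃ S ∈ (univ : Finset V).powersetCard s,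
      ρ * s ≤ (E.filter fun e => e ⊆ S).card ∧ E.card ≤ M) fun E hE h => ?_).trans ?_
  · rcases le_total M E.card with h1 | h1
    · exact Or.inl h1
    · right
      obtain ⟨S, hS1, hS2⟩ := exists_dense_subset (fun e he => by
        rw [(mem_powersetCard.1 (hE he)).2]; exact hk) hr h
      exact ⟨S.card, mem_Icc.2 ⟨hS1, card_le_univ S⟩, S,
        mem_powersetCard.2 ⟨subset_univ _, rfl⟩, hS2, h1⟩
  · refine (binPr_or_le hp0 hp1 _ _).trans (add_le_add le_rfl ?_)
    exact (binPr_exists_le hp0 hp1 _ _).trans (sum_le_sum hB)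

lemma binPr_exists_dense_le_of_rates {V : Type*} [Fintype V] {k ρ s M : ℕ} {p c σ₁ l η : ℝ}
    (hV : 0 < Fintype.card V)
    (hk : 3 ≤ k) (hρ : 1 ≤ ρ) (hp0 : 0 ≤ p) (hp1 : p ≤ 1) (hc0 : 0 < c) (hcρ : c ≤ ρ)
    (hc : p * (Fintype.card V).choose k ≤ c * Fintype.card V)
    (hM : (M : ℝ) ≤ 1.02 * c * Fintype.card V) (hl : 0 ≤ l)
    (h1 : Real.exp (1 + ρ) * (c / ρ) ^ ρ * σ₁ ^ (ρ * (k - 1) - 1) ≤ Real.exp (-l))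
    (h2 : ∀ σ, σ₁ ≤ σ → σ ≤ 1 → ρ * σ ≤ 1.02 * c → denseRate k ρ (1.02 * c) σ ≤ -η)
    (hs : s ∈ Icc 1 (Fintype.card V)) :
    binPr ((univ : Finset V).powersetCard k) p (fun E =>
      ∃ S ∈ (univ : Finset V).powersetCard s,
        ρ * s ≤ (E.filter fun e => e ⊆ S).card ∧ E.card ≤ M) ≤
      (Real.exp (1 + ρ) * (c / ρ) ^ ρ / Real.sqrt (Fintype.card V)) ^ s +
        (Real.exp (-(l * Real.sqrt (Fintype.card V))) +
          Real.exp (-(η * Fintype.card V))) := by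
  obtain ⟨hs1, hsV⟩ := mem_Icc.1 hs
  have hV0 : (0:ℝ) < Fintype.card V := by exact_mod_cast hV
  have hs0 : (0:ℝ) < s := by exact_mod_cast hs1
  have hρ0 : (0:ℝ) < ρ := by exact_mod_cast hρ
  have hsq : 0 < Real.sqrt (Fintype.card V) := Real.sqrt_pos.2 hV0
  set K := Real.exp (1 + ρ) * (c / ρ) ^ ρ with hK
  have hK0 : 0 < K := by positivity
  have hσ0 : 0 < (s:ℝ) / Fintype.card V := by positivity
  have hσ1 : (s:ℝ) / Fintype.card V ≤ 1 := by
    rw [div_le_one hV0]; exact_mod_cast hsV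
  have hA : 0 ≤ (K / Real.sqrt (Fintype.card V)) ^ s := by positivity
  have hB := (Real.exp_pos (-(l * Real.sqrt (Fintype.card V)))).le
  have hC := (Real.exp_pos (-(η * Fintype.card V))).le
  have hi : 1 ≤ ρ * (k - 1) - 1 := by
    have : 1 * 2 ≤ ρ * (k - 1) := Nat.mul_le_mul hρ (by omega)
    omega
  have hsmall : binPr ((univ : Finset V).powersetCard k) p (fun E =>
      ∃ S ∈ (univ : Finset V).powersetCard s,
        ρ * s ≤ (E.filter fun e => e ⊆ S).card ∧ E.card ≤ M) ≤
      (K * ((s:ℝ) / Fintype.card V) ^ (ρ * (k - 1) - 1)) ^ s :=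
    (binPr_mono hp0 hp1 fun E _ ⟨S, hS, h, _⟩ => ⟨S, hS, h⟩).trans
      (binPr_exists_dense_le hV hp0 hp1 hc0 (by omega) hc hρ hcρ hs1 hsV)
  rcases le_total ((s:ℝ) / Fintype.card V) σ₁ with hσ | hσ
  · rcases le_total (s:ℝ) (Real.sqrt (Fintype.card V)) with h | h
    · refine hsmall.trans (le_add_of_le_of_nonneg ?_ (by linarith))
      refine pow_le_pow_left₀ (by positivity) ?_ s
      rw [div_eq_mul_inv K]
      refine mul_le_mul_of_nonneg_left ?_ hK0.le
      calc ((s:ℝ) / Fintype.card V) ^ (ρ * (k - 1) - 1) ≤ ((s:ℝ) / Fintype.card V) ^ 1 :=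
            pow_le_pow_of_le_one hσ0.le hσ1 hi
        _ ≤ Real.sqrt (Fintype.card V) / Fintype.card V := by rw [pow_one]; gcongr
        _ = _ := by rw [Real.sqrt_div_self]
    · refine hsmall.trans (le_add_of_nonneg_of_le hA (le_add_of_le_of_nonneg ?_ hC))
      calc (K * ((s:ℝ) / Fintype.card V) ^ (ρ * (k - 1) - 1)) ^ s ≤ (Real.exp (-l)) ^ s := by
            refine pow_le_pow_left₀ (by positivity) (le_trans ?_ h1) s
            gcongr
        _ = Real.exp (-(l * s)) := by rw [← Real.exp_nat_mul]; ring_nf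
        _ ≤ _ := by gcongr
  · rcases le_or_gt (ρ * s) M with h | h
    · refine le_add_of_nonneg_of_le hA (le_add_of_nonneg_of_le hB ?_)
      refine (binPr_exists_dense_and_card_le hV hp0 hp1 hs1 hsV h hM rfl).trans ?_
      refine Real.exp_le_exp.2 ?_
      have h3 : (ρ:ℝ) * (s / Fintype.card V) ≤ 1.02 * c := by
        rw [← mul_div_assoc, div_le_iff₀ hV0]
        exact le_trans (by exact_mod_cast h) hM
      have := mul_le_mul_of_nonneg_left (h2 _ hσ hσ1 h3) hV0.le
      unfold denseRate at this
      linarith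
    · refine le_trans (le_of_eq ?_) (add_nonneg hA (add_nonneg hB hC))
      unfold binPr
      refine sum_eq_zero fun E _ => if_neg ?_
      rintro ⟨S, _, h3, h4⟩
      have := card_filter_le E fun e => e ⊆ S
      omega

lemma tendsto_natCast_mul_exp_neg_sqrt {l : ℝ} (hl : 0 < l) :
    Tendsto (fun n : ℕ => (n : ℝ) * Real.exp (-(l * Real.sqrt n))) atTop (nhds 0) := by
  have h1 : Tendsto (fun n : ℕ => l * Real.sqrt n) atTop atTop :=
    tendsto_sqrt_natCast.const_mul_atTop hl
  have h2 := ((Real.tendsto_pow_mul_exp_neg_atTop_nhds_zero 2).comp h1).const_mul (l ^ 2)⁻¹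
  rw [mul_zero] at h2
  refine h2.congr fun n => ?_
  simp only [Function.comp]
  rw [mul_pow, Real.sq_sqrt n.cast_nonneg]
  field_simp

lemma tendsto_natCast_mul_exp_neg {η : ℝ} (hη : 0 < η) :
    Tendsto (fun n : ℕ => (n : ℝ) * Real.exp (-(η * n))) atTop (nhds 0) := by
  have h1 : Tendsto (fun n : ℕ => η * (n:ℝ)) atTop atTop :=
    tendsto_natCast_atTop_atTop.const_mul_atTop hη
  have h2 := ((Real.tendsto_pow_mul_exp_neg_atTop_nhds_zero 1).comp h1).const_mul η⁻¹
  rw [mul_zero] at h2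
  refine h2.congr fun n => ?_
  simp only [Function.comp]
  field_simp

lemma binPr_le_card_ceil_le {V : Type*} [Fintype V] {k : ℕ} {p c : ℝ} (hp0 : 0 ≤ p) (hp1 : p ≤ 1)
    (hc0 : 0 < c) (hc : p * (Fintype.card V).choose k ≤ c * Fintype.card V) :
    binPr ((univ : Finset V).powersetCard k) p
      (fun E => ⌈1.01 * c * (Fintype.card V : ℝ)⌉₊ ≤ E.card) ≤
      Real.exp (-(c / 50000 * Fintype.card V)) := by
  refine (binPr_le_card hp0 hp1 hc (y := 1.005) (by norm_num) _).trans ?_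
  have hcn : 0 ≤ c * (Fintype.card V : ℝ) := by positivity
  have hlog : 1 - (1.005:ℝ)⁻¹ ≤ Real.log 1.005 := Real.one_sub_inv_le_log_of_pos (by norm_num)
  have hM := Nat.le_ceil (1.01 * c * (Fintype.card V : ℝ))
  set M := ⌈1.01 * c * (Fintype.card V : ℝ)⌉₊
  have : ((1.005:ℝ) ^ M)⁻¹ = Real.exp (-(M * Real.log 1.005)) := by
    rw [Real.exp_neg, Real.exp_nat_mul, Real.exp_log (by norm_num)]
  rw [this, ← Real.exp_add]
  refine Real.exp_le_exp.2 ?_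
  have h1 : 1.01 * c * (Fintype.card V : ℝ) * (1 - (1.005:ℝ)⁻¹) ≤ M * Real.log 1.005 :=
    mul_le_mul hM hlog (by norm_num) (by positivity)
  norm_num at h1 ⊢
  linarith

/-- Sparse hypergraphs, in which every `s` vertices span fewer than `ρ * s` edges. -/
theorem eventually_not_rchoosable_of_dense {k r ρ : ℕ} {c σ₁ η : ℝ} (hk : 3 ≤ k) (hρ : 1 ≤ ρ)
    (hr : 2 * ρ < r) (hc0 : 0 < c) (hcρ : c ≤ ρ) (hσ : 0 < σ₁) (hη : 0 < η)
    (h1 : Real.exp (1 + ρ) * (c / ρ) ^ ρ * σ₁ ^ (ρ * (k - 1) - 1) < 1)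
    (h2 : ∀ σ, σ₁ ≤ σ → σ ≤ 1 → ρ * σ ≤ 1.02 * c → denseRate k ρ (1.02 * c) σ ≤ -η)
    {ε : ℝ} (hε : 0 < ε) :
    ∀ᶠ n : ℕ in atTop, ∀ p : ℝ, 0 ≤ p → p ≤ 1 → p * n.choose k ≤ c * n →
      binPr ((univ : Finset (Fin n)).powersetCard k) p (fun E => ¬ RChoosable r E) ≤ ε := by
  have hρ0 : (0:ℝ) < ρ := by exact_mod_cast hρ
  set K := Real.exp (1 + ρ) * (c / ρ) ^ ρ with hK
  have hK0 : 0 < K := by positivity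
  set l := -Real.log (K * σ₁ ^ (ρ * (k - 1) - 1)) with hl
  have hl0 : 0 < l := neg_pos.2 (Real.log_neg (by positivity) h1)
  have hle : K * σ₁ ^ (ρ * (k - 1) - 1) ≤ Real.exp (-l) := by
    rw [hl, neg_neg, Real.exp_log (by positivity)]
  have hX : Tendsto (fun n : ℕ => K / Real.sqrt n) atTop (nhds 0) :=
    tendsto_sqrt_natCast.const_div_atTop K
  have hE : Tendsto (fun n : ℕ => Real.exp (-(c / 50000 * n))) atTop (nhds 0) :=
    Real.tendsto_exp_neg_atTop_nhds_zero.comp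
      (tendsto_natCast_atTop_atTop.const_mul_atTop (by positivity : 0 < c / 50000))
  have hlim := hE.add ((hX.const_mul 2).add
    ((tendsto_natCast_mul_exp_neg_sqrt hl0).add (tendsto_natCast_mul_exp_neg hη)))
  simp only [mul_zero, add_zero] at hlim
  filter_upwards [hlim.eventually_le_const hε, hX.eventually_le_const (by norm_num : (0:ℝ) < 1 / 2),
    eventually_ge_atTop 1,
    (tendsto_natCast_atTop_atTop (R := ℝ)).eventually_ge_atTop (100 / c)] with n hn hXn hn1 hcn p
    hp0 hp1 hpc
  have : Nonempty (Fin n) := ⟨⟨0, hn1⟩⟩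
  have hn0 : (0:ℝ) < n := by exact_mod_cast hn1
  have hcard : Fintype.card (Fin n) = n := Fintype.card_fin n
  have hM : (⌈1.01 * c * (n : ℝ)⌉₊ : ℝ) ≤ 1.02 * c * n := by
    have h3 := (Nat.ceil_lt_add_one (by positivity : 0 ≤ 1.01 * c * (n:ℝ))).le
    rw [div_le_iff₀ hc0] at hcn
    linarith
  have hceil := binPr_le_card_ceil_le (V := Fin n) (k := k) hp0 hp1 hc0 (by rwa [hcard])
  have hsum := binPr_not_rchoosable_le_sum_dense (V := Fin n) (k := k) (r := r) (ρ := ρ)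
    (by omega) hr hp0 hp1 ⌈1.01 * c * (Fintype.card (Fin n) : ℝ)⌉₊ fun s hs =>
      binPr_exists_dense_le_of_rates (V := Fin n) (by omega) hk hρ hp0 hp1 hc0 hcρ
        (by rwa [hcard]) (by rwa [hcard]) hl0.le hle h2 hs
  rw [hcard] at hceil hsum
  refine hsum.trans ((add_le_add hceil ?_).trans hn)
  rw [sum_add_distrib, sum_const, Nat.card_Icc, Nat.add_sub_cancel, nsmul_eq_mul, mul_add]
  exact add_le_add (sum_Icc_pow_le_two_mul (by positivity) hXn n) le_rfl

/-- In the edge probability range of fixed `k` and `r`, `H(n,k,p)` is asymptotically almost surely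
`r`-choosable. -/
def EventuallyChoosable (k r : ℕ) : Prop :=
  ∀ ε : ℝ, 0 < ε → ∀ᶠ n : ℕ in atTop, ∀ p : ℝ, 0 ≤ p →
    p ≤ (3 / 32 : ℝ) * ((r:ℝ) ^ (k - 1) / (k : ℝ) ^ ((3 : ℝ) / 2)) *
      ((n : ℝ) / (n.choose k : ℝ)) →
    p ≤ 1 ∧ binPr ((univ : Finset (Fin n)).powersetCard k) p (fun E => ¬ RChoosable r E) ≤ ε

lemma eventuallyChoosable_of_denseRate {k r ρ : ℕ} {c w σ₁ η : ℝ} (hk : 3 ≤ k) (hρ : 1 ≤ ρ)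
    (hr : 2 * ρ < r) (hw : 0 < w) (hwk : w ^ 2 ≤ k)
    (hc : 3 * (r:ℝ) ^ (k - 1) ≤ 32 * (c * (k * w))) (hcρ : c ≤ ρ) (hσ : 0 < σ₁) (hη : 0 < η)
    (h1 : (2.7182818286:ℝ) ^ (1 + ρ) * (c / ρ) ^ ρ * σ₁ ^ (ρ * (k - 1) - 1) < 1)
    (h2 : ∀ σ, σ₁ ≤ σ → σ ≤ 1 → ρ * σ ≤ 1.02 * c → denseRate k ρ (1.02 * c) σ ≤ -η) :
    EventuallyChoosable k r := by
  intro ε hε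
  have hk0 : (0:ℝ) < k := by exact_mod_cast (by omega : 0 < k)
  have hr0 : (0:ℝ) < r := by exact_mod_cast (by omega : 0 < r)
  have hρ0 : (0:ℝ) < ρ := by exact_mod_cast hρ
  have hkw : 0 < k * w := by positivity
  have hc0 : 0 < c := by
    have : 0 < 3 * (r:ℝ) ^ (k - 1) := by positivity
    by_contra! h
    have := mul_nonpos_of_nonpos_of_nonneg h hkw.le
    linarith
  have hd : 3 * ((r:ℝ) ^ (k - 1) / Real.sqrt k) / 32 ≤ c * k := by
    have hs : w ≤ Real.sqrt k := le_sqrt_natCast hwk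
    have h3 : (r:ℝ) ^ (k - 1) / Real.sqrt k ≤ (r:ℝ) ^ (k - 1) / w := by gcongr
    have h4 : (r:ℝ) ^ (k - 1) / w ≤ 32 / 3 * (c * k) := by
      rw [div_le_iff₀ hw]; linarith
    linarith
  have h1' : Real.exp (1 + ρ) * (c / ρ) ^ ρ * σ₁ ^ (ρ * (k - 1) - 1) < 1 := by
    refine lt_of_le_of_lt ?_ h1
    gcongr
    rw [← mul_one (1 + (ρ:ℝ)), ← Nat.cast_one (R := ℝ), ← Nat.cast_add, Real.exp_nat_mul,
      Nat.cast_one]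
    exact pow_le_pow_left₀ (Real.exp_nonneg _) Real.exp_one_lt_d9.le _
  filter_upwards [eventually_not_rchoosable_of_dense hk hρ hr hc0 hcρ hσ hη h1' h2 hε,
    eventually_ge_atTop k,
    (tendsto_natCast_atTop_atTop (R := ℝ)).eventually_ge_atTop (c * k * k)] with n hn hkn hcn p
    hp0 hp
  have hn0 : (0:ℝ) < n := by exact_mod_cast (by omega : 0 < n)
  have hpd := (edgeProb_mul_le (by omega) hkn hp).trans hd
  have hp1 : p ≤ 1 := edgeProb_le_one (by omega) hkn hp0 hpd hcn
  refine ⟨hp1, hn p hp0 hp1 ?_⟩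
  rw [← mul_assoc, ← mul_div_assoc, div_le_iff₀ hn0] at hpd
  refine le_of_mul_le_mul_right ?_ hk0
  linarith

lemma eventuallyChoosable_of_lt {k r ρ : ℕ} {c w : ℝ} (hk : 3 ≤ k) (hρ : 1 ≤ ρ)
    (hr : 2 * ρ < r) (hw : 0 < w) (hwk : w ^ 2 ≤ k) (hc0 : 0 < c)
    (hc : 3 * (r:ℝ) ^ (k - 1) ≤ 32 * (c * (k * w))) (hcρ : c ≤ ρ)
    (h1 : (2.7182818286:ℝ) ^ (1 + ρ) * (c / ρ) ^ ρ * (1.021 * c / ρ) ^ (ρ * (k - 1) - 1) < 1) :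
    EventuallyChoosable k r := by
  have hρ0 : (0:ℝ) < ρ := by exact_mod_cast hρ
  refine eventuallyChoosable_of_denseRate hk hρ hr hw hwk hc hcρ (by positivity) one_pos h1
    fun σ hσ _ hσ2 => ?_
  rw [div_le_iff₀ hρ0] at hσ
  linarith

lemma eventuallyChoosable_three {r : ℕ} (h3 : 3 ≤ r) (h13 : r ≤ 13) :
    EventuallyChoosable 3 r := by
  interval_cases r
  · apply eventuallyChoosable_of_lt (ρ := 1) (c := 0.018043 * 3 ^ 2) (w := 1.73205) <;> norm_num
  · apply eventuallyChoosable_of_lt (ρ := 1) (c := 0.018043 * 4 ^ 2) (w := 1.73205) <;> norm_num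
  · apply eventuallyChoosable_of_lt (ρ := 2) (c := 0.018043 * 5 ^ 2) (w := 1.73205) <;> norm_num
  · apply eventuallyChoosable_of_lt (ρ := 2) (c := 0.018043 * 6 ^ 2) (w := 1.73205) <;> norm_num
  · apply eventuallyChoosable_of_lt (ρ := 3) (c := 0.018043 * 7 ^ 2) (w := 1.73205) <;> norm_num
  · apply eventuallyChoosable_of_lt (ρ := 3) (c := 0.018043 * 8 ^ 2) (w := 1.73205) <;> norm_num
  · apply eventuallyChoosable_of_lt (ρ := 4) (c := 0.018043 * 9 ^ 2) (w := 1.73205) <;> norm_num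
  · apply eventuallyChoosable_of_lt (ρ := 4) (c := 0.018043 * 10 ^ 2) (w := 1.73205) <;> norm_num
  · apply eventuallyChoosable_of_lt (ρ := 5) (c := 0.018043 * 11 ^ 2) (w := 1.73205) <;> norm_num
  · apply eventuallyChoosable_of_lt (ρ := 5) (c := 0.018043 * 12 ^ 2) (w := 1.73205) <;> norm_num
  · apply eventuallyChoosable_of_lt (ρ := 6) (c := 0.018043 * 13 ^ 2) (w := 1.73205) <;> norm_num

lemma eventuallyChoosable_four_three : EventuallyChoosable 4 3 :=
  eventuallyChoosable_of_lt (ρ := 1) (c := 0.3165) (w := 2)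
    (by norm_num) (by norm_num) (by norm_num) (by norm_num) (by norm_num) (by norm_num)
    (by norm_num) (by norm_num) (by norm_num)

lemma log_le_div_of_pow_le {a b : ℕ} (hb : b ≠ 0) {x : ℝ} (hx : 0 < x)
    (h : x ^ b ≤ (2.7182818283:ℝ) ^ a) : Real.log x ≤ a / b := by
  have hb0 : (0:ℝ) < b := by positivity
  rw [le_div_iff₀ hb0, mul_comm, ← Real.log_pow, Real.log_le_iff_le_exp (by positivity),
    ← mul_one (a:ℝ), Real.exp_nat_mul]
  exact h.trans (pow_le_pow_left₀ (by norm_num) Real.exp_one_gt_d9.le _)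

lemma log_le_neg_div_of_pow_mul_le {a b : ℕ} (hb : b ≠ 0) {x : ℝ} (hx : 0 < x)
    (h : x ^ b * (2.7182818286:ℝ) ^ a ≤ 1) : Real.log x ≤ -(a / b) := by
  have hb0 : (0:ℝ) < b := by positivity
  rw [← neg_div, le_div_iff₀ hb0, mul_comm, ← Real.log_pow, Real.log_le_iff_le_exp (by positivity),
    Real.exp_neg, ← mul_one (a:ℝ), Real.exp_nat_mul, le_inv_comm₀ (by positivity) (by positivity)]
  rw [← le_div_iff₀' (by positivity), one_div] at h
  exact (pow_le_pow_left₀ (Real.exp_nonneg _) Real.exp_one_lt_d9.le _).trans h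

lemma convexOn_denseRate (k ρ : ℕ) (m : ℝ) : ConvexOn ℝ (Set.Ici 0) (denseRate k ρ m) := by
  have h1 := Real.convexOn_mul_log.smul (c := (k * ρ : ℝ)) (by positivity)
  refine ⟨convex_Ici 0, fun x hx y hy a b ha hb hab => ?_⟩
  have h2 := h1.2 hx hy ha hb hab
  simp only [smul_eq_mul] at h2 ⊢
  unfold denseRate
  obtain rfl : b = 1 - a := by linarith
  linarith

lemma denseRate_le {k ρ : ℕ} {m σ u : ℝ} (hm : ρ * σ ≤ m) (hσ0 : 0 ≤ σ) (hσ1 : σ ≤ 1)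
    (hu : Real.log σ ≤ u) :
    denseRate k ρ m σ ≤ σ * (47 / 92) + (1 - σ) * (11 / 12) + ρ * σ * (21 / 94) +
      k * ρ * (σ * u) + (m - ρ * σ) * (66 / 41) := by
  have h1 : Real.log (5 / 3) ≤ 47 / 92 := by
    exact_mod_cast log_le_div_of_pow_le (a := 47) (b := 92) (by norm_num)
      (by norm_num : (0:ℝ) < 5 / 3) (by norm_num)
  have h2 : Real.log (5 / 2) ≤ 11 / 12 := by
    exact_mod_cast log_le_div_of_pow_le (a := 11) (b := 12) (by norm_num)
      (by norm_num : (0:ℝ) < 5 / 2) (by norm_num)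
  have h3 : Real.log (5 / 4) ≤ 21 / 94 := by
    exact_mod_cast log_le_div_of_pow_le (a := 21) (b := 94) (by norm_num)
      (by norm_num : (0:ℝ) < 5 / 4) (by norm_num)
  have h4 : Real.log 5 ≤ 66 / 41 := by
    exact_mod_cast log_le_div_of_pow_le (a := 66) (b := 41) (by norm_num)
      (by norm_num : (0:ℝ) < 5) (by norm_num)
  unfold denseRate
  have h5 : 0 ≤ 1 - σ := by linarith
  have h6 : 0 ≤ m - ρ * σ := by linarith
  gcongr

lemma eventuallyChoosable_of_endpoints {k r ρ : ℕ} {c w b u : ℝ} (hk : 3 ≤ k) (hρ : 1 ≤ ρ)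
    (hr : 2 * ρ < r) (hw : 0 < w) (hwk : w ^ 2 ≤ k)
    (hc : 3 * (r:ℝ) ^ (k - 1) ≤ 32 * (c * (k * w))) (hcρ : c ≤ ρ)
    (h1 : (2.7182818286:ℝ) ^ (1 + ρ) * (c / ρ) ^ ρ * 0.4 ^ (ρ * (k - 1) - 1) < 1)
    (hb : ρ * b = 1.02 * c) (hb4 : 0.4 ≤ b) (hb1 : b ≤ 1) (hu : Real.log b ≤ u)
    (h4 : 0.4 * (47 / 92) + 0.6 * (11 / 12) + ρ * 0.4 * (21 / 94) -
      k * ρ * (0.4 * (87 / 95)) + (1.02 * c - ρ * 0.4) * (66 / 41) ≤ -(0.03:ℝ))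
    (h5 : b * (47 / 92) + (1 - b) * (11 / 12) + ρ * b * (21 / 94) + k * ρ * (b * u) ≤ -0.03) :
    EventuallyChoosable k r := by
  have hρ0 : (0:ℝ) < ρ := by exact_mod_cast hρ
  refine eventuallyChoosable_of_denseRate (η := 0.03) hk hρ hr hw hwk hc hcρ (by norm_num)
    (by norm_num) h1 fun σ hσ _ hσ2 => ?_
  have hσb : σ ≤ b := by
    rw [← hb] at hσ2
    exact le_of_mul_le_mul_left hσ2 hρ0
  refine ((convexOn_denseRate k ρ _).le_max_of_mem_Icc (x := 0.4) (y := b)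
    (by simp; norm_num) (by simp; linarith) ⟨hσ, hσb⟩).trans (max_le ?_ ?_)
  · have hl : Real.log 0.4 ≤ -(87 / 95) := by
      exact_mod_cast log_le_neg_div_of_pow_mul_le (a := 87) (b := 95) (by norm_num)
        (by norm_num : (0:ℝ) < 0.4) (by norm_num)
    refine (denseRate_le (by rw [← hb]; gcongr) (by norm_num) (by norm_num) hl).trans ?_
    linarith
  · refine (denseRate_le hb.le (by linarith) hb1 hu).trans ?_
    rw [hb, sub_self]
    linarith

lemma eventuallyChoosable_four_four : EventuallyChoosable 4 4 := by
  have hu : Real.log 0.765 ≤ -(15 / 56) := by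
    exact_mod_cast log_le_neg_div_of_pow_mul_le (a := 15) (b := 56) (by norm_num)
      (by norm_num : (0:ℝ) < 0.765) (by norm_num)
  exact eventuallyChoosable_of_endpoints (ρ := 1) (c := 0.75) (w := 2) (by norm_num)
    (by norm_num) (by norm_num) (by norm_num) (by norm_num) (by norm_num) (by norm_num)
    (by norm_num) (by norm_num) (by norm_num) (by norm_num) hu (by norm_num) (by norm_num)

lemma eventuallyChoosable_four_five : EventuallyChoosable 4 5 := by
  have hu : Real.log 0.7470735 ≤ -(23 / 79) := by
    exact_mod_cast log_le_neg_div_of_pow_mul_le (a := 23) (b := 79) (by norm_num)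
      (by norm_num : (0:ℝ) < 0.7470735) (by norm_num)
  exact eventuallyChoosable_of_endpoints (ρ := 2) (c := 1.46485) (w := 2) (by norm_num)
    (by norm_num) (by norm_num) (by norm_num) (by norm_num) (by norm_num) (by norm_num)
    (by norm_num) (by norm_num) (by norm_num) (by norm_num) hu (by norm_num) (by norm_num)

lemma eventuallyChoosable_five_three : EventuallyChoosable 5 3 := by
  have hu : Real.log 0.6936 ≤ -(15 / 41) := by
    exact_mod_cast log_le_neg_div_of_pow_mul_le (a := 15) (b := 41) (by norm_num)
      (by norm_num : (0:ℝ) < 0.6936) (by norm_num)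
  exact eventuallyChoosable_of_endpoints (ρ := 1) (c := 0.68) (w := 2.236) (by norm_num)
    (by norm_num) (by norm_num) (by norm_num) (by norm_num) (by norm_num) (by norm_num)
    (by norm_num) (by norm_num) (by norm_num) (by norm_num) hu (by norm_num) (by norm_num)

lemma hasThreshold_or_eventuallyChoosable {k r : ℕ} (hk : 3 ≤ k) (hr : 3 ≤ r) :
    HasThreshold k r ∨ (k ≤ 5 ∧ r ≤ 13 ∧ EventuallyChoosable k r) := by
  rcases le_or_gt 7 k with h7 | h7
  · exact Or.inl (hasThreshold_of_seven_le h7 hr)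
  interval_cases k
  · rcases le_or_gt 14 r with h | h
    · exact Or.inl (hasThreshold_three h)
    · exact Or.inr ⟨by norm_num, by omega, eventuallyChoosable_three hr (by omega)⟩
  · rcases le_or_gt 6 r with h | h
    · exact Or.inl (hasThreshold_four h)
    · refine Or.inr ⟨by norm_num, by omega, ?_⟩
      interval_cases r
      exacts [eventuallyChoosable_four_three, eventuallyChoosable_four_four,
        eventuallyChoosable_four_five]
  · rcases le_or_gt 4 r with h | h
    · exact Or.inl (hasThreshold_five h)
    · obtain rfl : r = 3 := by omega
      exact Or.inr ⟨le_rfl, by norm_num, eventuallyChoosable_five_three⟩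
  · rcases le_or_gt 4 r with h | h
    · exact Or.inl (hasThreshold_six h)
    · obtain rfl : r = 3 := by omega
      exact Or.inl hasThreshold_six_three

lemma eventually_not_rchoosable_le {ε : ℝ} (hε : 0 < ε) :
    ∀ᶠ n : ℕ in atTop, ∀ (k r : ℕ) (p : ℝ), 3 ≤ k → 3 ≤ r →
      (r:ℝ) ^ (k - 1) / Real.sqrt k ≤ 43 * Real.log n → 0 ≤ p →
      p ≤ (3 / 32 : ℝ) * ((r:ℝ) ^ (k - 1) / (k : ℝ) ^ ((3 : ℝ) / 2)) *
        ((n : ℝ) / (n.choose k : ℝ)) →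
      p ≤ 1 ∧
      binPr ((univ : Finset (Fin n)).powersetCard k) p (fun E => ¬ RChoosable r E) ≤ ε := by
  have hfin : ∀ᶠ n : ℕ in atTop, ∀ x ∈ range 6 ×ˢ range 14, EventuallyChoosable x.1 x.2 →
      ∀ p : ℝ, 0 ≤ p →
        p ≤ (3 / 32 : ℝ) * ((x.2:ℝ) ^ (x.1 - 1) / (x.1 : ℝ) ^ ((3 : ℝ) / 2)) *
          ((n : ℝ) / (n.choose x.1 : ℝ)) →
        p ≤ 1 ∧ binPr ((univ : Finset (Fin n)).powersetCard x.1) p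
          (fun E => ¬ RChoosable x.2 E) ≤ ε := by
    rw [eventually_all_finset]
    intro x _
    by_cases h : EventuallyChoosable x.1 x.2
    · exact (h ε hε).mono fun n hn _ => hn
    · exact Eventually.of_forall fun n h' => absurd h' h
  filter_upwards [hfin, eventually_not_rchoosable_of_hasThreshold hε] with n h1 h2 k r p hk hr hR
    hp0 hp
  rcases hasThreshold_or_eventuallyChoosable hk hr with h | ⟨hk5, hr13, h⟩
  · exact h2 k r p hk hr h hR hp0 hp
  · exact h1 (k, r) (mem_product.2 ⟨mem_range.2 (by omega), mem_range.2 (by omega)⟩) h p hp0 hp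

end HG

/-- Suppose `k = k(n) ≥ 3` and `r = r(n) ≥ 3` satisfy
`(3/128) r^(k−1)/√k − ln n → −∞`. If
`p = p(n) ≤ (3/32)(r^(k−1)/k^(3/2)) n / C(n,k)`, then
`P(H(n,k,p) is r-choosable) → 1` as `n → ∞`. -/
theorem stmt15 (k r : ℕ → ℕ) (p : ℕ → ℝ)
    (hk : ∀ n, 3 ≤ k n) (hr : ∀ n, 3 ≤ r n)
    (hd : Tendsto
      (fun n => (3 / 128 : ℝ) * (r n : ℝ) ^ (k n - 1) / Real.sqrt (k n) -
        Real.log n) atTop atBot)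
    (hp0 : ∀ n, 0 ≤ p n)
    (hp : ∀ n, p n ≤ (3 / 32 : ℝ) *
        ((r n : ℝ) ^ (k n - 1) / (k n : ℝ) ^ ((3 : ℝ) / 2)) *
        ((n : ℝ) / (n.choose (k n) : ℝ))) :
    Tendsto (fun n => HG.hyperProb n (k n) (p n) (HG.RChoosable (r n)))
      atTop (nhds 1) := by

  refine tendsto_order.2 ⟨fun a ha => ?_, fun a ha => ?_⟩
  all_goals
    have hε : 0 < |1 - a| / 2 := by
      have : 1 - a ≠ 0 := by intro h; linarith
      positivity
    filter_upwards [HG.eventually_not_rchoosable_le hε, hd.eventually_le_atBot 0] with n hn hdn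
    have hR : (r n : ℝ) ^ (k n - 1) / Real.sqrt (k n) ≤ 43 * Real.log n := by
      have : 0 ≤ (r n : ℝ) ^ (k n - 1) / Real.sqrt (k n) := by positivity
      rw [mul_div_assoc] at hdn
      linarith
    obtain ⟨hp1, hb⟩ := hn _ _ _ (hk n) (hr n) hR (hp0 n) (hp n)
    have hadd := HG.binPr_add_not (K := (univ : Finset (Fin n)).powersetCard (k n)) (p := p n)
      (fun E => HG.RChoosable (r n) E)
    have hle := HG.binPr_le_one (K := (univ : Finset (Fin n)).powersetCard (k n)) (hp0 n) hp1
      (fun E => HG.RChoosable (r n) E)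
    have heq : HG.hyperProb n (k n) (p n) (HG.RChoosable (r n)) =
      HG.binPr ((univ : Finset (Fin n)).powersetCard (k n)) (p n)
        (fun E => HG.RChoosable (r n) E) := rfl
    rw [heq]
  · rw [abs_of_pos (by linarith)] at hb
    linarith
  · linarith
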